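/- Let g be the finite-dimensional simple Lie algebra of type E₈ over ℂ, and let (h,e,f) be an sl₂-triple in g. If e ∈ [g_e,g_e] and the Lie subalgebra g(0)_e = {x ∈ g | ⁅e,x⁆ = 0 and ⁅h,x⁆ = 0} is a semisimple Lie algebra, then g_e = [g_e,g_e]. -/

import Mathlib

/-- The centralizer `g_e` of `e`, i.e. the kernel of `ad e`. -/
noncomputable def centralizer (e : LieAlgebra.e₈ ℂ) : Submodule ℂ (LieAlgebra.e₈ ℂ) :=
  LinearMap.ker (LieAlgebra.ad ℂ (LieAlgebra.e₈ ℂ) e)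

/-- The derived subalgebra `[g_e, g_e]` of the centralizer, as the linear span of all
brackets of pairs of elements of `g_e`. -/
noncomputable def derived (e : LieAlgebra.e₈ ℂ) : Submodule ℂ (LieAlgebra.e₈ ℂ) :=
  Submodule.span ℂ
    {z : LieAlgebra.e₈ ℂ | ∃ x ∈ centralizer e, ∃ y ∈ centralizer e, ⁅x, y⁆ = z}

/-- The Lie subalgebra `g(0)_e = g_e ∩ ker (ad h)`. -/
noncomputable def gZero (h e : LieAlgebra.e₈ ℂ) : LieSubalgebra ℂ (LieAlgebra.e₈ ℂ) where
  carrier := {x : LieAlgebra.e₈ ℂ | ⁅e, x⁆ = 0 ∧ ⁅h, x⁆ = 0}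
  zero_mem' := ⟨lie_zero e, lie_zero h⟩
  add_mem' := by
    rintro x y ⟨hx1, hx2⟩ ⟨hy1, hy2⟩
    exact ⟨by rw [lie_add, hx1, hy1, add_zero], by rw [lie_add, hx2, hy2, add_zero]⟩
  smul_mem' := by
    rintro c x ⟨hx1, hx2⟩
    exact ⟨by rw [lie_smul, hx1, smul_zero], by rw [lie_smul, hx2, smul_zero]⟩
  lie_mem' := by
    rintro x y ⟨hx1, hx2⟩ ⟨hy1, hy2⟩
    exact ⟨by rw [leibniz_lie, hx1, hy1, zero_lie, lie_zero, add_zero],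
           by rw [leibniz_lie, hx2, hy2, zero_lie, lie_zero, add_zero]⟩

namespace E8

/-- The root lattice of type `E₈`, in coordinates with respect to the simple roots. -/
abbrev Q := Fin 8 → ℤ

/-- The simple roots. -/
def sr (i : Fin 8) : Q := Pi.single i 1

/-- The bilinear form of the root lattice. -/
def bil (a b : Q) : ℤ :=
  2 * (a 0 * b 0 + a 1 * b 1 + a 2 * b 2 + a 3 * b 3 + a 4 * b 4 + a 5 * b 5 + a 6 * b 6
    + a 7 * b 7) - (a 0 * b 2 + a 2 * b 0 + a 1 * b 3 + a 3 * b 1 + a 2 * b 3 + a 3 * b 2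
    + a 3 * b 4 + a 4 * b 3 + a 4 * b 5 + a 5 * b 4 + a 5 * b 6 + a 6 * b 5 + a 6 * b 7
    + a 7 * b 6)

/-- A bilinear lift of the sign cocycle. -/
def sgnExp (a b : Q) : ℤ :=
  a 0 * b 0 + a 1 * b 1 + a 2 * b 2 + a 3 * b 3 + a 4 * b 4 + a 5 * b 5 + a 6 * b 6 + a 7 * b 7
    + (a 0 * b 2 + a 1 * b 3 + a 2 * b 3 + a 3 * b 4 + a 4 * b 5 + a 5 * b 6 + a 6 * b 7)

/-- The sign cocycle. -/
def eps (a b : Q) : ℤ := ((sgnExp a b).negOnePow : ℤ)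

/-- The height. -/
def ht (a : Q) : ℤ := ∑ i, a i

/-- The roots are the vectors of norm two. -/
def IsRoot (a : Q) : Prop := bil a a = 2

section lattice

variable (a b c : Q) (i j : Fin 8)

lemma bil_add_left : bil (a + b) c = bil a c + bil b c := by
  simp only [bil, Pi.add_apply]; ring
lemma bil_add_right : bil a (b + c) = bil a b + bil a c := by
  simp only [bil, Pi.add_apply]; ring
lemma bil_sub_left : bil (a - b) c = bil a c - bil b c := by
  simp only [bil, Pi.sub_apply]; ring
lemma bil_sub_right : bil a (b - c) = bil a b - bil a c := by
  simp only [bil, Pi.sub_apply]; ring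
lemma bil_neg_left : bil (-a) b = -bil a b := by
  simp only [bil, Pi.neg_apply]; ring
lemma bil_neg_right : bil a (-b) = -bil a b := by
  simp only [bil, Pi.neg_apply]; ring
lemma bil_comm : bil a b = bil b a := by
  simp only [bil]; ring

lemma bil_sr_sr : bil (sr i) (sr j) = CartanMatrix.E₈ i j := by
  fin_cases i <;> fin_cases j <;> rfl

lemma bil_eq_sum : bil a b = ∑ i, a i * bil (sr i) b := by
  simp [Fin.sum_univ_eight, bil, sr, Pi.single_apply]
  ring

lemma bil_self_nonneg : 0 ≤ bil a a := by
  have : 60 * bil a a = 30 * (2 * a 0 - a 2) ^ 2 + 10 * (3 * a 2 - 2 * a 3) ^ 2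
      + 30 * (2 * a 1 - a 3) ^ 2 + 2 * (5 * a 3 - 6 * a 4) ^ 2 + 3 * (4 * a 4 - 5 * a 5) ^ 2
      + 5 * (3 * a 5 - 4 * a 6) ^ 2 + 10 * (2 * a 6 - 3 * a 7) ^ 2 + 30 * a 7 ^ 2 := by
    simp only [bil]; ring
  nlinarith [sq_nonneg (2 * a 0 - a 2), sq_nonneg (3 * a 2 - 2 * a 3), sq_nonneg (2 * a 1 - a 3),
    sq_nonneg (5 * a 3 - 6 * a 4), sq_nonneg (4 * a 4 - 5 * a 5), sq_nonneg (3 * a 5 - 4 * a 6),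
    sq_nonneg (2 * a 6 - 3 * a 7), sq_nonneg (a 7)]

lemma eq_zero_of_bil_self (h : bil a a = 0) : a = 0 := by
  have h1 : 60 * bil a a = 30 * (2 * a 0 - a 2) ^ 2 + 10 * (3 * a 2 - 2 * a 3) ^ 2
      + 30 * (2 * a 1 - a 3) ^ 2 + 2 * (5 * a 3 - 6 * a 4) ^ 2 + 3 * (4 * a 4 - 5 * a 5) ^ 2
      + 5 * (3 * a 5 - 4 * a 6) ^ 2 + 10 * (2 * a 6 - 3 * a 7) ^ 2 + 30 * a 7 ^ 2 := by
    simp only [bil]; ring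
  have g1 := sq_nonneg (2 * a 0 - a 2)
  have g2 := sq_nonneg (3 * a 2 - 2 * a 3)
  have g3 := sq_nonneg (2 * a 1 - a 3)
  have g4 := sq_nonneg (5 * a 3 - 6 * a 4)
  have g5 := sq_nonneg (4 * a 4 - 5 * a 5)
  have g6 := sq_nonneg (3 * a 5 - 4 * a 6)
  have g7 := sq_nonneg (2 * a 6 - 3 * a 7)
  have g8 := sq_nonneg (a 7)
  have e1 : 2 * a 0 - a 2 = 0 := pow_eq_zero_iff two_ne_zero |>.1 (by linarith)
  have e2 : 3 * a 2 - 2 * a 3 = 0 := pow_eq_zero_iff two_ne_zero |>.1 (by linarith)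
  have e3 : 2 * a 1 - a 3 = 0 := pow_eq_zero_iff two_ne_zero |>.1 (by linarith)
  have e4 : 5 * a 3 - 6 * a 4 = 0 := pow_eq_zero_iff two_ne_zero |>.1 (by linarith)
  have e5 : 4 * a 4 - 5 * a 5 = 0 := pow_eq_zero_iff two_ne_zero |>.1 (by linarith)
  have e6 : 3 * a 5 - 4 * a 6 = 0 := pow_eq_zero_iff two_ne_zero |>.1 (by linarith)
  have e7 : 2 * a 6 - 3 * a 7 = 0 := pow_eq_zero_iff two_ne_zero |>.1 (by linarith)
  have e8 : a 7 = 0 := pow_eq_zero_iff two_ne_zero |>.1 (by linarith)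
  ext i
  fin_cases i <;> simp <;> omega

lemma bil_self_even : Even (bil a a) :=
  ⟨(a 0 * a 0 + a 1 * a 1 + a 2 * a 2 + a 3 * a 3 + a 4 * a 4 + a 5 * a 5 + a 6 * a 6
    + a 7 * a 7) - (a 0 * a 2 + a 1 * a 3 + a 2 * a 3 + a 3 * a 4 + a 4 * a 5 + a 5 * a 6
    + a 6 * a 7), by simp only [bil]; ring⟩

lemma eps_add_left : eps (a + b) c = eps a c * eps b c := by
  have : sgnExp (a + b) c = sgnExp a c + sgnExp b c := by
    simp only [sgnExp, Pi.add_apply]; ring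
  simp [eps, this, Int.negOnePow_add]

lemma eps_add_right : eps a (b + c) = eps a b * eps a c := by
  have : sgnExp a (b + c) = sgnExp a b + sgnExp a c := by
    simp only [sgnExp, Pi.add_apply]; ring
  simp [eps, this, Int.negOnePow_add]

lemma eps_neg_left : eps (-a) b = eps a b := by
  have : sgnExp (-a) b = -sgnExp a b := by
    simp only [sgnExp, Pi.neg_apply]; ring
  simp [eps, this, Int.negOnePow_neg]

lemma eps_neg_right : eps a (-b) = eps a b := by
  have : sgnExp a (-b) = -sgnExp a b := by
    simp only [sgnExp, Pi.neg_apply]; ring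
  simp [eps, this, Int.negOnePow_neg]

lemma eps_eq : eps a b = 1 ∨ eps a b = -1 := by
  rcases Int.units_eq_one_or (sgnExp a b).negOnePow with h | h <;> simp [eps, h]

lemma eps_swap : eps b a = eps a b * ((bil a b).negOnePow : ℤ) := by
  have : sgnExp b a = sgnExp a b + bil a b + 2 * ((a 0 * b 2 + a 1 * b 3 + a 2 * b 3 + a 3 * b 4
      + a 4 * b 5 + a 5 * b 6 + a 6 * b 7) + (b 0 * a 2 + b 1 * a 3 + b 2 * a 3 + b 3 * a 4
      + b 4 * a 5 + b 5 * a 6 + b 6 * a 7) - sgnExp a b) := by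
    simp only [sgnExp, bil]; ring
  simp [eps, this, Int.negOnePow_add]

variable {a b c} {i j}

lemma eps_swap_of_odd (h : bil a b = -1) : eps b a = -eps a b := by
  rw [eps_swap a b, h]; simp

lemma eps_swap_of_zero (h : bil a b = 0) : eps b a = eps a b := by
  rw [eps_swap a b, h]; simp

lemma IsRoot.eps_self (h : IsRoot a) : eps a a = -1 := by
  have : sgnExp a a = 1 + 2 * (a 0 * a 2 + a 1 * a 3 + a 2 * a 3 + a 3 * a 4
      + a 4 * a 5 + a 5 * a 6 + a 6 * a 7) := by
    have := h
    simp only [IsRoot, sgnExp, bil] at *; linarith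
  simp [eps, this, Int.negOnePow_add]

lemma isRoot_sr (i : Fin 8) : IsRoot (sr i) := by
  fin_cases i <;> rfl

lemma bil_sr_self (i : Fin 8) : bil (sr i) (sr i) = 2 := isRoot_sr i

lemma bil_sr_sr_of_ne (h : i ≠ j) : bil (sr i) (sr j) = 0 ∨ bil (sr i) (sr j) = -1 := by
  revert h
  fin_cases i <;> fin_cases j <;> simp [bil, sr]

lemma IsRoot.neg (h : IsRoot a) : IsRoot (-a) := by
  simpa [IsRoot, bil_neg_left, bil_neg_right] using h

lemma IsRoot.ne_zero (h : IsRoot a) : a ≠ 0 := by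
  rintro rfl; simp [IsRoot, bil] at h

lemma IsRoot.add (ha : IsRoot a) (hb : IsRoot b) (h : bil a b = -1) : IsRoot (a + b) := by
  have := bil_comm a b
  simp only [IsRoot, bil_add_left, bil_add_right] at *; linarith

lemma IsRoot.sub (ha : IsRoot a) (hb : IsRoot b) (h : bil a b = 1) : IsRoot (a - b) := by
  have := bil_comm a b
  simp only [IsRoot, bil_sub_left, bil_sub_right] at *; linarith

lemma IsRoot.eq_of_bil (ha : IsRoot a) (hb : IsRoot b) (h : bil a b = 2) : a = b := by
  have := bil_comm a b
  refine sub_eq_zero.1 (eq_zero_of_bil_self _ ?_)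
  simp only [IsRoot, bil_sub_left, bil_sub_right] at *; linarith

lemma IsRoot.eq_neg_of_bil (ha : IsRoot a) (hb : IsRoot b) (h : bil a b = -2) : a = -b :=
  ha.eq_of_bil hb.neg (by rw [bil_neg_right, h]; rfl)

lemma IsRoot.bil_bounds (ha : IsRoot a) (hb : IsRoot b) : -2 ≤ bil a b ∧ bil a b ≤ 2 := by
  have h0 := bil_comm a b
  have h1 := bil_self_nonneg (a + b)
  have h2 := bil_self_nonneg (a - b)
  simp only [IsRoot, bil_sub_left, bil_sub_right, bil_add_left, bil_add_right] at *
  constructor <;> linarith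

lemma two_le_bil_self (h : a ≠ 0) : 2 ≤ bil a a := by
  have h1 := bil_self_nonneg a
  have h2 : bil a a ≠ 0 := fun h' ↦ h (eq_zero_of_bil_self a h')
  obtain ⟨k, hk⟩ := bil_self_even a
  omega

/-- A root is either nonnegative or nonpositive. -/
lemma IsRoot.nonneg_or (ha : IsRoot a) : 0 ≤ a ∨ a ≤ 0 := by
  by_contra! hc
  have key : bil a⁺ a⁻ ≤ 0 := by
    have hz : ∀ i, a⁺ i * a⁻ i = 0 := fun i ↦ by
      rw [Pi.posPart_apply, Pi.negPart_apply]
      rcases le_total 0 (a i) with h | h <;> simp [h]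
    have hn : ∀ i j, 0 ≤ a⁺ i * a⁻ j := fun i j ↦
      mul_nonneg (posPart_nonneg a i) (negPart_nonneg a j)
    simp only [bil, hz]
    linarith [hn 0 2, hn 2 0, hn 1 3, hn 3 1, hn 2 3, hn 3 2, hn 3 4, hn 4 3, hn 4 5, hn 5 4,
      hn 5 6, hn 6 5, hn 6 7, hn 7 6]
  have h1 : a⁺ ≠ 0 := fun h ↦ hc.2 (by simpa using h)
  have h2 : a⁻ ≠ 0 := fun h ↦ hc.1 (by simpa using h)
  have h3 := two_le_bil_self h1
  have h4 := two_le_bil_self h2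
  have h5 := bil_comm a⁺ a⁻
  have h6 : bil (a⁺ - a⁻) (a⁺ - a⁻) = 2 := by rwa [posPart_sub_negPart]
  simp only [bil_sub_left, bil_sub_right] at h6
  linarith

lemma sr_nonneg (i : Fin 8) : 0 ≤ sr i := by
  simp [sr]

/-- Subtracting a simple root from a positive root keeps it positive. -/
lemma IsRoot.sub_sr_nonneg (ha : IsRoot a) (h0 : 0 ≤ a) (h : bil a (sr i) = 1) :
    0 ≤ a - sr i := by
  rcases (ha.sub (isRoot_sr i) h).nonneg_or with h1 | h1
  · exact h1
  · exfalso
    have h2 : a = (a i) • sr i := by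
      ext k
      have h3 := h1 k
      have h4 := h0 k
      simp only [Pi.sub_apply, Pi.zero_apply, sr, Pi.smul_apply, smul_eq_mul, Pi.single_apply]
        at h3 h4 ⊢
      split_ifs at h3 ⊢ with hk
      · subst hk; simp
      · simp at h3 ⊢; omega
    have h5 : bil a (sr i) = a i * 2 := by
      rw [h2, bil_eq_sum]
      simp [sr, Pi.single_apply]
      left; exact bil_sr_self i
    omega

lemma exists_bil_sr_pos (ha : IsRoot a) (h0 : 0 ≤ a) : ∃ i, 0 < bil a (sr i) := by
  by_contra! hc
  have : bil a a ≤ 0 := by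
    rw [bil_eq_sum]
    refine Finset.sum_nonpos fun i _ ↦ mul_nonpos_of_nonneg_of_nonpos (h0 i) ?_
    rw [bil_comm]; exact hc i
  rw [ha] at this; norm_num at this

/-- A positive root is simple, or is obtained from a smaller one by adding a simple root. -/
lemma IsRoot.simple_or (ha : IsRoot a) (h0 : 0 ≤ a) :
    (∃ i, a = sr i) ∨ ∃ i, bil a (sr i) = 1 := by
  obtain ⟨i, hi⟩ := exists_bil_sr_pos ha h0
  have := (ha.bil_bounds (isRoot_sr i)).2
  rcases (by omega : bil a (sr i) = 1 ∨ bil a (sr i) = 2) with h | h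
  · exact Or.inr ⟨i, h⟩
  · exact Or.inl ⟨i, ha.eq_of_bil (isRoot_sr i) h⟩

lemma ht_add (a b : Q) : ht (a + b) = ht a + ht b := by simp [ht, Finset.sum_add_distrib]
lemma ht_sub (a b : Q) : ht (a - b) = ht a - ht b := by simp [ht]
lemma ht_neg (a : Q) : ht (-a) = -ht a := by simp [ht]
lemma ht_sr (i : Fin 8) : ht (sr i) = 1 := by simp [ht, sr]

lemma ht_pos (h : 0 ≤ a) (h0 : a ≠ 0) : 0 < ht a := by
  refine lt_of_le_of_ne (Finset.sum_nonneg fun i _ ↦ h i) fun h' ↦ h0 ?_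
  have := (Finset.sum_eq_zero_iff_of_nonneg fun i _ ↦ h i).1 h'.symm
  ext i; simpa using this i (Finset.mem_univ i)

end lattice
end E8

namespace E8

variable {L : Type*} [LieRing L]

/-- The positive half of the Serre relations. -/
structure HalfSerre (e : Fin 8 → L) : Prop where
  comm : ∀ i j, bil (sr i) (sr j) = 0 → ⁅e i, e j⁆ = 0
  serre : ∀ i j, bil (sr i) (sr j) = -1 → ⁅e i, ⁅e i, e j⁆⁆ = 0

lemma sr_injective : Function.Injective sr := fun i j h ↦ by
  by_contra hij
  have := congrFun h i
  simp [sr, hij] at this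

open Classical in
/-- Root vectors built from simple ones, by induction on the height. -/
noncomputable def posVec (e : Fin 8 → L) : ℕ → Q → L
  | 0, _ => 0
  | n + 1, a =>
    if h : ∃ i, a = sr i then e h.choose
    else if h : ∃ i, bil a (sr i) = 1 then
      eps (sr h.choose) (a - sr h.choose) • ⁅e h.choose, posVec e n (a - sr h.choose)⁆
    else 0

/-- The positive root vectors. -/
noncomputable def pv (e : Fin 8 → L) (a : Q) : L := posVec e (ht a).toNat a

variable {e : Fin 8 → L} {a b : Q}

lemma pv_sr (i : Fin 8) : pv e (sr i) = e i := by
  have h : ∃ j, sr i = sr j := ⟨i, rfl⟩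
  have h2 : h.choose = i := (sr_injective h.choose_spec).symm
  simp only [pv, ht_sr]
  change posVec e (0 + 1) _ = _
  rw [posVec, dif_pos h, h2]

lemma pv_eq (ha : IsRoot a) (h0 : 0 ≤ a) (hs : ¬ ∃ i, a = sr i) :
    ∃ j, bil a (sr j) = 1 ∧ pv e a = eps (sr j) (a - sr j) • ⁅e j, pv e (a - sr j)⁆ := by
  have h := (ha.simple_or h0).resolve_left hs
  refine ⟨h.choose, h.choose_spec, ?_⟩
  have h1 := ht_pos h0 ha.ne_zero
  obtain ⟨n, hn⟩ : ∃ n : ℕ, ht a = n + 1 := ⟨(ht a - 1).toNat, by omega⟩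
  have h2 : ht (a - sr h.choose) = n := by rw [ht_sub, ht_sr, hn]; ring
  rw [pv, pv, h2, hn]
  change posVec e (n + 1) _ = _
  rw [posVec, dif_neg hs, dif_pos h]
  rfl

lemma eps_smul_eq {x y : L} (h : x = eps a b • y) : y = eps a b • x := by
  rcases eps_eq a b with h' | h' <;> simp [h, h']

variable [LieAlgebra ℂ L]

/-- The action of a simple root vector on a positive root vector. -/
lemma HalfSerre.lie_pv (he : HalfSerre e) (n : ℕ) : ∀ a, IsRoot a → 0 ≤ a → ht a = n → ∀ i,
    (bil a (sr i) = -1 → ⁅e i, pv e a⁆ = eps (sr i) a • pv e (sr i + a)) ∧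
    (0 ≤ bil a (sr i) → ⁅e i, pv e a⁆ = 0) := by
  induction n using Nat.strong_induction_on with
  | _ n ih =>
  intro a ha h0 hn i
  have hsub : ∀ {b : Q} {j}, 0 ≤ b → IsRoot b → bil b (sr j) = 1 → ht b ≤ n → 
      ∃ m < n, IsRoot (b - sr j) ∧ 0 ≤ b - sr j ∧ ht (b - sr j) = m := by
    intro b j hb0 hb hj hbn
    have h1 := hb.sub_sr_nonneg hb0 hj
    have h2 := hb.sub (isRoot_sr j) hj
    have h3 := ht_pos h1 h2.ne_zero
    have h4 : ht (b - sr j) = ht b - 1 := by rw [ht_sub, ht_sr]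
    exact ⟨(ht (b - sr j)).toNat, by omega, h2, h1, by omega⟩
  constructor
  · intro hi
    have hb : IsRoot (sr i + a) := (isRoot_sr i).add ha (by rw [bil_comm, hi])
    have hb0 : 0 ≤ sr i + a := add_nonneg (sr_nonneg i) h0
    have hns : ¬ ∃ k, sr i + a = sr k := by
      rintro ⟨k, hk⟩
      have := congrArg ht hk
      have := ht_pos h0 ha.ne_zero
      rw [ht_add, ht_sr, ht_sr] at *; omega
    obtain ⟨j, hj, hz⟩ := pv_eq (e := e) hb hb0 hns
    by_cases hij : i = j
    · subst hij
      rw [add_sub_cancel_left] at hz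
      exact eps_smul_eq hz
    rcases bil_sr_sr_of_ne hij with hc | hc
    · have hja : bil a (sr j) = 1 := by rw [bil_add_left, hc] at hj; linarith
      obtain ⟨m, hm, hd, hd0, hdm⟩ := hsub h0 ha hja hn.le
      have hdj : bil (a - sr j) (sr j) = -1 := by rw [bil_sub_left, hja, bil_sr_self]; rfl
      have hdi : bil (a - sr j) (sr i) = -1 := by rw [bil_sub_left, hi, bil_comm, hc]; rfl
      have h1 := (ih m hm _ hd hd0 hdm j).1 hdj
      have h2 := (ih m hm _ hd hd0 hdm i).1 hdi
      rw [add_sub_cancel] at h1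
      have h3 : sr i + a - sr j = sr i + (a - sr j) := by abel
      have h4 : ⁅e i, ⁅e j, pv e (a - sr j)⁆⁆ = ⁅e j, ⁅e i, pv e (a - sr j)⁆⁆ := by
        rw [leibniz_lie, he.comm i j hc, zero_lie, zero_add]
      have h5 : eps (sr i) a = eps (sr i) (sr j) * eps (sr i) (a - sr j) := by
        rw [← eps_add_right, add_sub_cancel]
      have h6 : eps (sr j) (sr i) = eps (sr i) (sr j) := eps_swap_of_zero hc
      rw [eps_smul_eq h1, lie_zsmul, h4, h2, hz, h3, h5, eps_add_right, h6, lie_zsmul]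
      rcases eps_eq (sr i) (sr j) with g1 | g1 <;> rcases eps_eq (sr j) (a - sr j) with g2 | g2 <;>
        rcases eps_eq (sr i) (a - sr j) with g3 | g3 <;> simp [g1, g2, g3]
    · have haj : bil a (sr j) = 2 := by rw [bil_add_left, hc] at hj; linarith
      have := ha.eq_of_bil (isRoot_sr j) haj
      subst this
      have h3 : sr i + sr j - sr j = sr i := by abel
      rw [hz, h3, pv_sr, pv_sr, eps_swap_of_odd hc, ← lie_skew (e j)]
      rcases eps_eq (sr i) (sr j) with g1 | g1 <;> simp [g1]
  · intro hi
    by_cases hsa : ∃ k, a = sr k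
    · obtain ⟨k, rfl⟩ := hsa
      rw [pv_sr]
      by_cases hik : i = k
      · subst hik; exact lie_self _
      · rcases bil_sr_sr_of_ne hik with hc | hc
        · exact he.comm _ _ hc
        · rw [bil_comm, hc] at hi; omega
    have hb2 := (ha.bil_bounds (isRoot_sr i)).2
    have hne2 : bil a (sr i) ≠ 2 := fun h ↦ hsa ⟨i, ha.eq_of_bil (isRoot_sr i) h⟩
    rcases (by omega : bil a (sr i) = 0 ∨ bil a (sr i) = 1) with hi0 | hi1
    · obtain ⟨j, hj, hz⟩ := pv_eq (e := e) ha h0 hsa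
      have hij : i ≠ j := by rintro rfl; omega
      obtain ⟨m, hm, hd, hd0, hdm⟩ := hsub h0 ha hj hn.le
      rw [hz, lie_zsmul]
      rcases bil_sr_sr_of_ne hij with hc | hc
      · have hdi : bil (a - sr j) (sr i) = 0 := by rw [bil_sub_left, hi0, bil_comm, hc]; rfl
        rw [leibniz_lie, he.comm _ _ hc, (ih m hm _ hd hd0 hdm i).2 hdi.ge]
        simp
      · have hdi : bil (a - sr j) (sr i) = 1 := by rw [bil_sub_left, hi0, bil_comm, hc]; rfl
        obtain ⟨m', hm', hy, hy0, hym⟩ := hsub hd0 hd hdi (by omega)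
        set y := a - sr j - sr i with hydef
        have hyi : bil y (sr i) = -1 := by
          rw [hydef, bil_sub_left, hdi, bil_sr_self]; rfl
        have hyj : bil y (sr j) = 0 := by
          rw [hydef, bil_sub_left, bil_sub_left, hj, bil_sr_self, hc]; rfl
        have h1 := (ih m' hm' _ hy hy0 hym i).1 hyi
        have h2 := (ih m' hm' _ hy hy0 hym j).2 hyj.ge
        have h3 : sr i + y = a - sr j := by rw [hydef]; abel
        rw [h3] at h1
        have h4 := (ih m hm _ hd hd0 hdm i).2 (by omega)
        have h5 : ⁅e i, ⁅e i, pv e y⁆⁆ = 0 := by rw [h1, lie_zsmul, h4, smul_zero]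
        have h6 : ⁅⁅e i, ⁅e i, e j⁆⁆, pv e y⁆ = 0 := by rw [he.serre _ _ hc, zero_lie]
        rw [lie_lie, lie_lie, lie_lie, h2, h5] at h6
        simp only [lie_zero, zero_sub, lie_neg, sub_zero] at h6
        have h7 : (2 : ℂ) • ⁅e i, ⁅e j, ⁅e i, pv e y⁆⁆⁆ = 0 := by
          rw [two_smul]; rw [← neg_eq_zero]; rw [← h6]; abel
        have h8 := (smul_eq_zero.1 h7).resolve_left two_ne_zero
        rw [h1, lie_zsmul, lie_zsmul] at h8
        have h9 : ⁅e i, ⁅e j, pv e (a - sr j)⁆⁆ = 0 := by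
          rcases eps_eq (sr i) y with g1 | g1 <;> rw [g1] at h8
          · rwa [one_smul] at h8
          · rwa [neg_smul, one_smul, neg_eq_zero] at h8
        rw [h9, smul_zero]
    · obtain ⟨m, hm, hd, hd0, hdm⟩ := hsub h0 ha hi1 hn.le
      have hdi : bil (a - sr i) (sr i) = -1 := by rw [bil_sub_left, hi1, bil_sr_self]; rfl
      have h1 := (ih m hm _ hd hd0 hdm i).1 hdi
      rw [add_sub_cancel] at h1
      suffices h : ⁅e i, ⁅e i, pv e (a - sr i)⁆⁆ = 0 by
        rw [eps_smul_eq h1, lie_zsmul, h, smul_zero]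
      by_cases hsd : ∃ k, a - sr i = sr k
      · obtain ⟨k, hk⟩ := hsd
        rw [hk, pv_sr]
        exact he.serre _ _ (by rw [hk] at hdi; rw [bil_comm, hdi])
      obtain ⟨j, hj, hz⟩ := pv_eq (e := e) hd hd0 hsd
      have hij : i ≠ j := by rintro rfl; omega
      obtain ⟨m', hm', hy, hy0, hym⟩ := hsub hd0 hd hj (by omega)
      set y := a - sr i - sr j with hydef
      rw [hz, lie_zsmul, lie_zsmul]
      rcases bil_sr_sr_of_ne hij with hc | hc
      · have hyi : bil y (sr i) = -1 := by
          rw [hydef, bil_sub_left, hdi, bil_comm, hc]; rfl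
        have h2 := (ih m' hm' _ hy hy0 hym i).1 hyi
        have hr := (isRoot_sr i).add hy (by rw [bil_comm, hyi])
        have hri : bil (sr i + y) (sr i) = 1 := by rw [bil_add_left, bil_sr_self, hyi]; rfl
        have hrh : ht (sr i + y) = m := by
          rw [ht_add, ht_sr, hydef, ht_sub, hdm, ht_sr]; ring
        have h3 := (ih m hm _ hr (add_nonneg (sr_nonneg i) hy0) hrh i).2 (by omega)
        have h4 : ∀ x : L, ⁅e i, ⁅e j, x⁆⁆ = ⁅e j, ⁅e i, x⁆⁆ := fun x ↦ by
          rw [leibniz_lie, he.comm i j hc, zero_lie, zero_add]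
        rw [h4, h4, h2, lie_zsmul, h3, smul_zero, lie_zero, smul_zero]
      · have hyi : bil y (sr i) = 0 := by
          rw [hydef, bil_sub_left, hdi, bil_comm, hc]; rfl
        have h5 := (ih m' hm' _ hy hy0 hym i).2 hyi.ge
        have h6 : ⁅⁅e i, ⁅e i, e j⁆⁆, pv e y⁆ = 0 := by rw [he.serre _ _ hc, zero_lie]
        rw [lie_lie, lie_lie, lie_lie, h5] at h6
        simp only [lie_zero, sub_zero] at h6
        rw [h6, smul_zero]

end E8

namespace E8

variable {L : Type*} [LieRing L]

/-- A system of elements satisfying the Serre relations of type `E₈`. -/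
structure Serre (h e f : Fin 8 → L) : Prop where
  hh : ∀ i j, ⁅h i, h j⁆ = 0
  ef : ∀ i, ⁅e i, f i⁆ = h i
  ef_ne : ∀ i j, i ≠ j → ⁅e i, f j⁆ = 0
  he : ∀ i j, ⁅h i, e j⁆ = bil (sr i) (sr j) • e j
  hf : ∀ i j, ⁅h i, f j⁆ = -(bil (sr i) (sr j) • f j)
  pos : HalfSerre e
  neg : HalfSerre f

lemma HalfSerre.neg {e : Fin 8 → L} (he : HalfSerre e) : HalfSerre (-e) where
  comm i j hij := by simp [he.comm i j hij]
  serre i j hij := by simp [he.serre i j hij]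

lemma Serre.swap {h e f : Fin 8 → L} (S : Serre h e f) : Serre (-h) (-f) (-e) where
  hh i j := by simp [S.hh]
  ef i := by simp [← lie_skew (f i), S.ef]
  ef_ne i j hij := by
    simpa using by rw [← lie_skew, S.ef_ne j i hij.symm, neg_zero]
  he i j := by simp [S.hf]
  hf i j := by simp [S.he]
  pos := S.neg.neg
  neg := S.pos.neg

open Classical in
/-- The root vectors. -/
noncomputable def rv (e f : Fin 8 → L) (a : Q) : L := if 0 ≤ a then pv e a else pv (-f) (-a)

/-- The coroots. -/
def cr (h : Fin 8 → L) (a : Q) : L := ∑ i, a i • h i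

variable {h e f : Fin 8 → L} {a b : Q}

lemma cr_add : cr h (a + b) = cr h a + cr h b := by
  simp [cr, add_smul, Finset.sum_add_distrib]

lemma cr_neg : cr h (-a) = -cr h a := by simp [cr]

lemma cr_sr (i : Fin 8) : cr h (sr i) = h i := by
  simp [cr, sr, Pi.single_apply]

lemma cr_neg_left : cr (-h) a = -cr h a := by simp [cr]

lemma rv_of_nonneg (ha : 0 ≤ a) : rv e f a = pv e a := if_pos ha

lemma not_nonneg_neg (ha : a ≠ 0) (h0 : 0 ≤ a) : ¬ 0 ≤ -a := fun h1 ↦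
  ha (le_antisymm (by simpa using h1) h0)

lemma rv_neg_of_nonneg (ha : a ≠ 0) (h0 : 0 ≤ a) : rv e f (-a) = pv (-f) a := by
  rw [rv, if_neg (not_nonneg_neg ha h0), neg_neg]

lemma rv_sr (i : Fin 8) : rv e f (sr i) = e i := by
  rw [rv_of_nonneg (sr_nonneg i), pv_sr]

lemma rv_neg_sr (i : Fin 8) : rv e f (-sr i) = -f i := by
  rw [rv_neg_of_nonneg (isRoot_sr i).ne_zero (sr_nonneg i), pv_sr]; rfl

lemma rv_swap (ha : IsRoot a) : rv (-f) (-e) a = rv e f (-a) := by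
  rcases ha.nonneg_or with h0 | h0
  · rw [rv_of_nonneg h0, rv_neg_of_nonneg ha.ne_zero h0]
  · have h1 : 0 ≤ -a := by simpa using h0
    rw [rv_of_nonneg h1, ← neg_neg a, rv_neg_of_nonneg ha.neg.ne_zero h1]; simp

lemma pv_induction {C : Q → L → Prop}
    (h1 : ∀ i, C (sr i) (e i)) (h2 : ∀ i b x, C b x → C (sr i + b) ⁅e i, x⁆)
    (h3 : ∀ b (k : ℤ) x, C b x → C b (k • x)) (n : ℕ) :
    ∀ a, IsRoot a → 0 ≤ a → ht a = n → C a (pv e a) := by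
  induction n with
  | zero => 
    intro a ha h0 hn
    have := ht_pos h0 ha.ne_zero
    omega
  | succ n ih =>
    intro a ha h0 hn
    by_cases hs : ∃ i, a = sr i
    · obtain ⟨i, rfl⟩ := hs
      rw [pv_sr]; exact h1 i
    · obtain ⟨j, hj, hz⟩ := pv_eq (e := e) ha h0 hs
      rw [hz]
      refine h3 _ _ _ ?_
      have := h2 j _ _ (ih _ (ha.sub (isRoot_sr j) hj) (ha.sub_sr_nonneg h0 hj)
        (by rw [ht_sub, ht_sr, hn]; push_cast; ring))
      rwa [add_sub_cancel] at this

lemma pv_induction' {C : Q → L → Prop}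
    (h1 : ∀ i, C (sr i) (e i)) (h2 : ∀ i b x, C b x → C (sr i + b) ⁅e i, x⁆)
    (h3 : ∀ b (k : ℤ) x, C b x → C b (k • x)) (ha : IsRoot a) (h0 : 0 ≤ a) : C a (pv e a) :=
  pv_induction h1 h2 h3 (ht a).toNat a ha h0
    (by have := ht_pos h0 ha.ne_zero; omega)

namespace Serre

variable (S : Serre h e f)
include S

lemma h_rv (ha : IsRoot a) (i : Fin 8) : ⁅h i, rv e f a⁆ = bil (sr i) a • rv e f a := by
  rcases ha.nonneg_or with h0 | h0
  · rw [rv_of_nonneg h0]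
    refine pv_induction' (C := fun b x ↦ ⁅h i, x⁆ = bil (sr i) b • x) (fun j ↦ S.he i j) ?_ ?_ ha h0
    · intro j b x hx
      rw [leibniz_lie, S.he, hx, smul_lie, lie_smul, bil_add_right, add_smul]
    · intro b k x hx
      rw [lie_smul, hx, smul_comm]
  · have h1 : 0 ≤ -a := by simpa using h0
    rw [← neg_neg a, rv_neg_of_nonneg ha.neg.ne_zero h1]
    refine pv_induction' (C := fun b x ↦ ⁅h i, x⁆ = bil (sr i) (-b) • x) ?_ ?_ ?_ ha.neg h1
    · intro j
      simp [S.hf, bil_neg_right]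
    · intro j b x hx
      rw [leibniz_lie, Pi.neg_apply, lie_neg, S.hf, hx, neg_neg, smul_lie, lie_smul, neg_add,
        bil_add_right, add_smul, bil_neg_right (sr i) (sr j), neg_smul]
      simp only [neg_lie, smul_neg, neg_neg]
    · intro b k x hx
      rw [lie_smul, hx, smul_comm]

lemma cr_rv (hb : IsRoot b) (a : Q) : ⁅cr h a, rv e f b⁆ = bil a b • rv e f b := by
  rw [cr, sum_lie, bil_eq_sum, Finset.sum_smul]
  exact Finset.sum_congr rfl fun i _ ↦ by rw [smul_lie, S.h_rv hb, smul_smul]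

lemma rv_cr (hb : IsRoot b) (a : Q) : ⁅rv e f b, cr h a⁆ = -(bil a b • rv e f b) := by
  rw [← lie_skew, S.cr_rv hb]

variable [LieAlgebra ℂ L]

/-- The action of a simple root vector on a negative root vector. -/
lemma lie_neg_pv (n : ℕ) : ∀ a, IsRoot a → 0 ≤ a → ht a = n → ∀ i, a ≠ sr i →
    (bil a (sr i) = 1 → ⁅e i, pv (-f) a⁆ = eps (sr i) a • pv (-f) (a - sr i)) ∧
    (bil a (sr i) ≤ 0 → ⁅e i, pv (-f) a⁆ = 0) := by
  induction n with
  | zero =>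
    intro a ha h0 hn
    have := ht_pos h0 ha.ne_zero
    omega
  | succ n ih =>
  intro a ha h0 hn i hai
  by_cases hs : ∃ j, a = sr j
  · obtain ⟨j, rfl⟩ := hs
    have hij : i ≠ j := fun h ↦ hai (by rw [h])
    refine ⟨fun h1 ↦ ?_, fun _ ↦ by rw [pv_sr]; simp [S.ef_ne i j hij]⟩
    rcases bil_sr_sr_of_ne hij.symm with h2 | h2 <;> omega
  obtain ⟨j, hj, hz⟩ := pv_eq (e := -f) ha h0 hs
  set d := a - sr j with hd
  have had : a = sr j + d := by rw [hd]; abel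
  have hdr : IsRoot d := ha.sub (isRoot_sr j) hj
  have hd0 : 0 ≤ d := ha.sub_sr_nonneg h0 hj
  have hdn : ht d = n := by rw [hd, ht_sub, ht_sr, hn]; push_cast; ring
  have hdj : bil d (sr j) = -1 := by rw [hd, bil_sub_left, hj, bil_sr_self]; rfl
  by_cases hij : i = j
  · subst hij
    have hdi : d ≠ sr i := fun h ↦ by rw [h, bil_sr_self] at hdj; omega
    have h1 := (ih d hdr hd0 hdn i hdi).2 (by omega)
    have h2 := S.h_rv hdr.neg i
    rw [rv_neg_of_nonneg hdr.ne_zero hd0, bil_neg_right, bil_comm, hdj] at h2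
    refine ⟨fun _ ↦ ?_, fun h ↦ by omega⟩
    rw [hz, lie_smul, leibniz_lie, h1, Pi.neg_apply, lie_neg, S.ef, neg_lie, h2, had,
      eps_add_right, (isRoot_sr i).eps_self]
    simp
  have hc := bil_sr_sr_of_ne hij
  have hz' : ⁅e i, pv (-f) a⁆ = eps (sr j) d • ⁅-f j, ⁅e i, pv (-f) d⁆⁆ := by
    rw [hz, lie_smul, leibniz_lie, Pi.neg_apply, lie_neg, S.ef_ne i j hij]; simp
  by_cases hdi : d = sr i
  · have hc1 : bil (sr i) (sr j) = -1 := by rw [← hdi, hdj]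
    have hb : bil a (sr i) = 1 := by rw [had, hdi, bil_add_left, bil_comm, hc1, bil_sr_self]; rfl
    refine ⟨fun _ ↦ ?_, fun h ↦ by omega⟩
    have h1 : a - sr i = sr j := by rw [had, hdi]; abel
    have h2 : ⁅-f j, ⁅e i, -f i⁆⁆ = -f j := by
      rw [lie_neg, S.ef, lie_neg, neg_lie, neg_neg, ← lie_skew, S.hf, hc1]; simp
    rw [hz', hdi, h1, pv_sr, pv_sr, Pi.neg_apply, h2, had, hdi, eps_add_right,
      (isRoot_sr i).eps_self, eps_swap_of_odd hc1, Pi.neg_apply]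
    simp
  have hda : bil d (sr i) = bil a (sr i) - bil (sr i) (sr j) := by
    rw [hd, bil_sub_left, bil_comm (sr j)]
  have hd2 : bil d (sr i) ≠ 2 := fun h ↦ hdi (hdr.eq_of_bil (isRoot_sr i) h)
  have hd2' := hdr.bil_bounds (isRoot_sr i)
  by_cases hdn0 : bil d (sr i) ≤ 0
  · have h1 := (ih d hdr hd0 hdn i hdi).2 hdn0
    refine ⟨fun h ↦ by omega, fun h ↦ ?_⟩
    rw [hz', h1, lie_zero, smul_zero]
  have hd1 : bil d (sr i) = 1 := by omega
  have h1 := (ih d hdr hd0 hdn i hdi).1 hd1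
  have h2 := hdr.sub (isRoot_sr i) hd1
  have h3 := hdr.sub_sr_nonneg hd0 hd1
  have h4 : bil (d - sr i) (sr j) = -1 - bil (sr i) (sr j) := by rw [bil_sub_left, hdj]
  have h5 := S.neg.neg.lie_pv (ht (d - sr i)).toNat _ h2 h3
    (by have := ht_pos h3 h2.ne_zero; omega) j
  rw [h1, lie_smul, ← Pi.neg_apply f j] at hz'
  rcases hc with hc | hc
  · refine ⟨fun _ ↦ ?_, fun h ↦ by omega⟩
    have h6 : sr j + (d - sr i) = a - sr i := by rw [had]; abel
    have h7 : eps (sr j) (d - sr i) = eps (sr j) d * eps (sr j) (sr i) := by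
      rw [sub_eq_add_neg, eps_add_right, eps_neg_right]
    rw [hz', h5.1 (by omega), h6, h7, had, eps_add_right, ← eps_swap_of_zero hc]
    rcases eps_eq (sr j) d with g1 | g1 <;> rcases eps_eq (sr j) (sr i) with g2 | g2 <;>
        rcases eps_eq (sr i) d with g3 | g3 <;> simp [g1, g2, g3]
  · refine ⟨fun h ↦ by omega, fun _ ↦ ?_⟩
    rw [hz', h5.2 (by omega)]; simp

lemma lie_simple (hb : IsRoot b) (i : Fin 8) :
    (bil (sr i) b = -1 → ⁅rv e f (sr i), rv e f b⁆ = eps (sr i) b • rv e f (sr i + b)) ∧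
    (0 ≤ bil (sr i) b → ⁅rv e f (sr i), rv e f b⁆ = 0) ∧
    (b = -sr i → ⁅rv e f (sr i), rv e f b⁆ = -cr h (sr i)) := by
  rw [rv_sr, cr_sr]
  rcases hb.nonneg_or with h0 | h0
  · have h1 := S.pos.lie_pv (ht b).toNat b hb h0 (by have := ht_pos h0 hb.ne_zero; omega) i
    rw [bil_comm, rv_of_nonneg h0, rv_of_nonneg (add_nonneg (sr_nonneg i) h0)]
    refine ⟨h1.1, h1.2, fun h ↦ ?_⟩
    exact absurd (h ▸ h0) (not_nonneg_neg (isRoot_sr i).ne_zero (sr_nonneg i))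
  · obtain ⟨c, rfl⟩ : ∃ c, b = -c := ⟨-b, (neg_neg b).symm⟩
    have hc : IsRoot c := by simpa using hb.neg
    have hc0 : 0 ≤ c := by simpa using h0
    rw [rv_neg_of_nonneg hc.ne_zero hc0, bil_neg_right, bil_comm]
    by_cases hci : c = sr i
    · subst hci
      rw [bil_sr_self, pv_sr, Pi.neg_apply, lie_neg, S.ef]
      exact ⟨fun h ↦ by omega, fun h ↦ by omega, fun _ ↦ rfl⟩
    · have h1 := S.lie_neg_pv (ht c).toNat c hc hc0 (by have := ht_pos hc0 hc.ne_zero; omega) i hci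
      refine ⟨fun h ↦ ?_, fun h ↦ h1.2 (by omega), fun h ↦ absurd (neg_injective h) hci⟩
      have h3 := hc.sub_sr_nonneg hc0 (i := i) (by omega)
      have h4 := hc.sub (isRoot_sr i) (by omega)
      have h2 : sr i + -c = -(c - sr i) := by abel
      rw [h1.1 (by omega), h2, rv_neg_of_nonneg h4.ne_zero h3, eps_neg_right]

lemma lie_rv_aux (n : ℕ) : ∀ a, IsRoot a → 0 ≤ a → ht a = n → ∀ b, IsRoot b →
    (bil a b = -1 → ⁅rv e f a, rv e f b⁆ = eps a b • rv e f (a + b)) ∧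
    (0 ≤ bil a b → ⁅rv e f a, rv e f b⁆ = 0) ∧
    (b = -a → ⁅rv e f a, rv e f b⁆ = -cr h a) := by
  induction n with
  | zero =>
    intro a ha h0 hn
    have := ht_pos h0 ha.ne_zero
    omega
  | succ n ih =>
  intro a ha h0 hn b hb
  by_cases hs : ∃ j, a = sr j
  · obtain ⟨j, rfl⟩ := hs
    exact S.lie_simple hb j
  obtain ⟨j, hj, hz⟩ := pv_eq (e := e) ha h0 hs
  set c := a - sr j with hc
  have hac : a = sr j + c := by rw [hc]; abel
  have hcr : IsRoot c := ha.sub (isRoot_sr j) hj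
  have hc0 : 0 ≤ c := ha.sub_sr_nonneg h0 hj
  have hcn : ht c = n := by rw [hc, ht_sub, ht_sr, hn]; push_cast; ring
  have hcj : bil c (sr j) = -1 := by rw [hc, bil_sub_left, hj, bil_sr_self]; rfl
  have hz' : ⁅rv e f a, rv e f b⁆ = eps (sr j) c •
      (⁅rv e f (sr j), ⁅rv e f c, rv e f b⁆⁆ - ⁅rv e f c, ⁅rv e f (sr j), rv e f b⁆⁆) := by
    rw [rv_of_nonneg h0, hz, smul_lie, lie_lie, rv_sr, rv_of_nonneg hc0]
  clear hz
  have hG := ih c hcr hc0 hcn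
  have hD := fun {b} (hb : IsRoot b) ↦ S.lie_simple hb j
  have hdr := isRoot_sr j
  generalize sr j = d at *
  have hdc : bil d c = -1 := by rw [bil_comm, hcj]
  have hsw : eps c d = -eps d c := eps_swap_of_odd hdc
  have hab : bil a b = bil d b + bil c b := by rw [hac, bil_add_left]
  have b1 := hdr.bil_bounds hb
  have b2 := hcr.bil_bounds hb
  refine ⟨fun h ↦ ?_, fun h ↦ ?_, fun h ↦ ?_⟩
  · rcases (by omega : bil c b = -2 ∨ bil c b = -1 ∨ bil c b = 0 ∨ bil c b = 1) with p | p | p | p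
    · obtain rfl : b = -c := by rw [hcr.eq_neg_of_bil hb p, neg_neg]
      have h1 : a + -c = d := by rw [hac]; abel
      rw [hz', (hG _ hb).2.2 rfl, (hD hb).2.1 (by omega), lie_neg, S.rv_cr hdr, hcj, h1,
        hac, eps_neg_right, eps_add_left, hcr.eps_self]
      simp
    · have hcb := hcr.add hb p
      have h1 : d + (c + b) = a + b := by rw [hac]; abel
      rw [hz', (hG _ hb).1 p, (hD hb).2.1 (by omega), lie_smul,
        (hD hcb).1 (by rw [bil_add_right]; omega), h1, eps_add_right]
      have h2 : eps a b = eps d b * eps c b := by rw [hac, eps_add_left]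
      rw [h2]
      rcases eps_eq d c with g1 | g1 <;> rcases eps_eq c b with g2 | g2 <;>
        rcases eps_eq d b with g3 | g3 <;> simp [g1, g2, g3]
    · have hdb := hdr.add hb (by omega)
      have h1 : c + (d + b) = a + b := by rw [hac]; abel
      rw [hz', (hG _ hb).2.1 p.ge, (hD hb).1 (by omega), lie_smul,
        (hG _ hdb).1 (by rw [bil_add_right]; omega), h1, eps_add_right, hsw]
      have h2 : eps a b = eps d b * eps c b := by rw [hac, eps_add_left]
      rw [h2]
      rcases eps_eq d c with g1 | g1 <;> rcases eps_eq c b with g2 | g2 <;>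
        rcases eps_eq d b with g3 | g3 <;> simp [g1, g2, g3]
    · obtain rfl : b = -d := by rw [hdr.eq_neg_of_bil hb (by omega), neg_neg]
      have h1 : a + -d = c := by rw [hac]; abel
      rw [hz', (hG _ hb).2.1 (by omega), (hD hb).2.2 rfl, lie_neg, S.rv_cr hcr, hdc, h1,
        hac, eps_neg_right, eps_add_left, hdr.eps_self, hsw]
      simp
  · suffices ⁅rv e f d, ⁅rv e f c, rv e f b⁆⁆ = 0 ∧ ⁅rv e f c, ⁅rv e f d, rv e f b⁆⁆ = 0 by
      rw [hz', this.1, this.2]; simp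
    have e1 : bil c b ≠ -2 := fun h' ↦ by
      obtain rfl : b = -c := by rw [hcr.eq_neg_of_bil hb h', neg_neg]
      rw [bil_neg_right d] at hab; omega
    have e2 : bil d b ≠ -2 := fun h' ↦ by
      obtain rfl : b = -d := by rw [hdr.eq_neg_of_bil hb h', neg_neg]
      rw [bil_neg_right c] at hab; omega
    constructor
    · by_cases p : 0 ≤ bil c b
      · rw [(hG _ hb).2.1 p, lie_zero]
      · have p : bil c b = -1 := by omega
        rw [(hG _ hb).1 p, lie_smul, (hD (hcr.add hb p)).2.1 (by rw [bil_add_right]; omega),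
          smul_zero]
    · by_cases p : 0 ≤ bil d b
      · rw [(hD hb).2.1 p, lie_zero]
      · have p : bil d b = -1 := by omega
        rw [(hD hb).1 p, lie_smul, (hG _ (hdr.add hb p)).2.1 (by rw [bil_add_right]; omega),
          smul_zero]
  · subst h
    have p1 : bil c (-a) = -1 := by
      rw [bil_neg_right, hac, bil_add_right, hcj, hcr]; rfl
    have p2 : bil d (-a) = -1 := by
      rw [bil_neg_right, hac, bil_add_right, hdc, hdr]; rfl
    have q1 : c + -a = -d := by rw [hac]; abel
    have q2 : d + -a = -c := by rw [hac]; abel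
    rw [hz', (hG _ hb).1 p1, (hD hb).1 p2, q1, q2, lie_smul, lie_smul, (hD hdr.neg).2.2 rfl,
      (hG _ hcr.neg).2.2 rfl, eps_neg_right, eps_neg_right, hac, eps_add_right, eps_add_right,
      hcr.eps_self, hdr.eps_self, hsw, cr_add]
    rcases eps_eq d c with g1 | g1 <;> simp [g1] <;> abel

lemma lie_rv_all (ha : IsRoot a) (hb : IsRoot b) :
    (bil a b = -1 → ⁅rv e f a, rv e f b⁆ = eps a b • rv e f (a + b)) ∧
    (0 ≤ bil a b → ⁅rv e f a, rv e f b⁆ = 0) ∧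
    (b = -a → ⁅rv e f a, rv e f b⁆ = -cr h a) := by
  rcases ha.nonneg_or with h0 | h0
  · exact S.lie_rv_aux (ht a).toNat a ha h0 (by have := ht_pos h0 ha.ne_zero; omega) b hb
  · have h1 : 0 ≤ -a := by simpa using h0
    have h2 := S.swap.lie_rv_aux (ht (-a)).toNat (-a) ha.neg h1
      (by have := ht_pos h1 ha.neg.ne_zero; omega) (-b) hb.neg
    rw [rv_swap ha.neg, rv_swap hb.neg, neg_neg, neg_neg, bil_neg_left, bil_neg_right, neg_neg,
      cr_neg_left, cr_neg, neg_neg] at h2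
    refine ⟨fun h ↦ ?_, h2.2.1, fun h ↦ h2.2.2 (by rw [h, neg_neg])⟩
    rw [h2.1 h, ← neg_add, rv_swap (ha.add hb h).neg, neg_neg, eps_neg_left, eps_neg_right]

lemma lie_rv (ha : IsRoot a) (hb : IsRoot b) (hab : bil a b = -1) :
    ⁅rv e f a, rv e f b⁆ = eps a b • rv e f (a + b) := (S.lie_rv_all ha hb).1 hab

lemma lie_rv_zero (ha : IsRoot a) (hb : IsRoot b) (hab : 0 ≤ bil a b) :
    ⁅rv e f a, rv e f b⁆ = 0 := (S.lie_rv_all ha hb).2.1 hab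

lemma lie_rv_neg (ha : IsRoot a) : ⁅rv e f a, rv e f (-a)⁆ = -cr h a :=
  (S.lie_rv_all ha ha.neg).2.2 rfl

end Serre
end E8

namespace E8

/-- The fundamental coweights. -/
def fw : Fin 8 → Q :=
  ![![4, 5, 7, 10, 8, 6, 4, 2], ![5, 8, 10, 15, 12, 9, 6, 3], ![7, 10, 14, 20, 16, 12, 8, 4],
    ![10, 15, 20, 30, 24, 18, 12, 6], ![8, 12, 16, 24, 20, 15, 10, 5],
    ![6, 9, 12, 18, 15, 12, 8, 4], ![4, 6, 8, 12, 10, 8, 6, 3], ![2, 3, 4, 6, 5, 4, 3, 2]]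

lemma bil_fw (i : Fin 8) (a : Q) : bil (fw i) a = a i := by
  fin_cases i <;> simp [fw, bil] <;> ring

lemma bil_smul_left (k : ℤ) (a b : Q) : bil (k • a) b = k * bil a b := by
  simp only [bil, Pi.smul_apply, smul_eq_mul]; ring

lemma bil_smul_right (k : ℤ) (a b : Q) : bil a (k • b) = k * bil a b := by
  simp only [bil, Pi.smul_apply, smul_eq_mul]; ring

lemma bil_sq_le (a b : Q) (hb : 0 < bil b b) : bil a b ^ 2 ≤ bil a a * bil b b := by
  have h := bil_self_nonneg (bil b b • a - bil a b • b)
  have h1 := bil_comm a b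
  simp only [bil_sub_left, bil_sub_right, bil_smul_left, bil_smul_right] at h
  rw [← h1] at h
  nlinarith

lemma IsRoot.coord_le {a : Q} (ha : IsRoot a) (i : Fin 8) : -7 ≤ a i ∧ a i ≤ 7 := by
  have h0 : 0 < bil (fw i) (fw i) ∧ bil (fw i) (fw i) ≤ 30 := by
    fin_cases i <;> decide
  have h := bil_sq_le a (fw i) h0.1
  rw [bil_comm, bil_fw, ha] at h
  constructor <;> nlinarith

instance : Finite {a : Q // IsRoot a} := by
  refine ((Set.finite_Icc (fun _ ↦ -7 : Q) (fun _ ↦ 7)).subset fun a ha ↦ ?_).to_subtype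
  exact ⟨fun i ↦ (IsRoot.coord_le ha i).1, fun i ↦ (IsRoot.coord_le ha i).2⟩

noncomputable instance : Fintype {a : Q // IsRoot a} := Fintype.ofFinite _

/-- An element separating the roots. -/
def sep : Q := ∑ i : Fin 8, (16 ^ (i : ℕ) : ℤ) • fw i

lemma bil_sep (a : Q) : bil sep a = a 0 + 16 * a 1 + 256 * a 2 + 4096 * a 3 + 65536 * a 4
    + 1048576 * a 5 + 16777216 * a 6 + 268435456 * a 7 := by
  simp only [sep, Fin.sum_univ_eight, bil_add_left, bil_smul_left, bil_fw]
  norm_num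

lemma bil_sep_injOn {a b : Q} (ha : IsRoot a) (hb : IsRoot b) (h : bil sep a = bil sep b) :
    a = b := by
  rw [bil_sep, bil_sep] at h
  have h1 := fun i ↦ ha.coord_le i
  have h2 := fun i ↦ hb.coord_le i
  have := h1 0; have := h1 1; have := h1 2; have := h1 3; have := h1 4; have := h1 5
  have := h1 6; have := h1 7; have := h2 0; have := h2 1; have := h2 2; have := h2 3
  have := h2 4; have := h2 5; have := h2 6; have := h2 7
  ext i
  fin_cases i <;> simp <;> omega

lemma bil_sep_ne_zero {a : Q} (ha : IsRoot a) : bil sep a ≠ 0 := fun h ↦ by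
  have h1 : bil sep a = bil sep (-a) := by rw [bil_neg_right, h]; rfl
  have h2 := bil_sep_injOn ha ha.neg h1
  refine ha.ne_zero ?_
  ext i
  have := congrFun h2 i
  simp at this ⊢; omega

lemma exists_bil_sr_ne {a : Q} (ha : a ≠ 0) : ∃ i, bil (sr i) a ≠ 0 := by
  by_contra! h
  refine ha (eq_zero_of_bil_self a ?_)
  rw [bil_eq_sum]
  simp [h]

variable {L : Type*} [LieRing L] [LieAlgebra ℂ L] {h e f : Fin 8 → L} {a b : Q}

/-- A family of elements spanning the Lie algebra generated by a Serre system. -/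
noncomputable def fam (h e f : Fin 8 → L) : Fin 8 ⊕ {a : Q // IsRoot a} → L :=
  Sum.elim h fun a ↦ rv e f a

lemma cr_mem_span : cr h a ∈ Submodule.span ℂ (Set.range (fam h e f)) :=
  Submodule.sum_mem _ fun i _ ↦ zsmul_mem (Submodule.subset_span (Set.mem_range_self (Sum.inl i))) _

lemma rv_mem_span (ha : IsRoot a) : rv e f a ∈ Submodule.span ℂ (Set.range (fam h e f)) :=
  Submodule.subset_span ⟨Sum.inr ⟨a, ha⟩, rfl⟩

namespace Serre

section
variable (S : Serre h e f)
include S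

lemma fam_lie_mem (i j : Fin 8 ⊕ {a : Q // IsRoot a}) :
    ⁅fam h e f i, fam h e f j⁆ ∈ Submodule.span ℂ (Set.range (fam h e f)) := by
  have hz : ∀ i (a : {a : Q // IsRoot a}), ⁅h i, rv e f a⁆ ∈
      Submodule.span ℂ (Set.range (fam h e f)) := fun i a ↦ by
    rw [S.h_rv a.2]; exact zsmul_mem (rv_mem_span a.2) _
  rcases i with i | ⟨a, ha⟩ <;> rcases j with j | ⟨b, hb⟩
  · simp [fam, S.hh]
  · exact hz _ ⟨b, hb⟩
  · change ⁅rv e f a, h j⁆ ∈ _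
    rw [← lie_skew]
    exact neg_mem (hz _ ⟨a, ha⟩)
  · change ⁅rv e f a, rv e f b⁆ ∈ _
    obtain ⟨b1, -⟩ := ha.bil_bounds hb
    rcases (by omega : 0 ≤ bil a b ∨ bil a b = -1 ∨ bil a b = -2) with p | p | p
    · rw [S.lie_rv_zero ha hb p]; exact zero_mem _
    · rw [S.lie_rv ha hb p]; exact zsmul_mem (rv_mem_span (ha.add hb p)) _
    · obtain rfl : b = -a := by rw [ha.eq_neg_of_bil hb p, neg_neg]
      rw [S.lie_rv_neg ha]; exact neg_mem cr_mem_span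

lemma span_fam (hg : LieSubalgebra.lieSpan ℂ L (Set.range h ∪ Set.range e ∪ Set.range f) = ⊤) :
    Submodule.span ℂ (Set.range (fam h e f)) = ⊤ := by
  let M : LieSubalgebra ℂ L :=
    { Submodule.span ℂ (Set.range (fam h e f)) with
      lie_mem' := by
        intro x y hx hy
        change ⁅x, y⁆ ∈ Submodule.span ℂ (Set.range (fam h e f))
        refine Submodule.span_induction₂ (p := fun x y _ _ ↦ ⁅x, y⁆ ∈ Submodule.span ℂ (Set.range (fam h e f))) ?_ ?_ ?_ ?_ ?_ ?_ ?_ hx hy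
        · rintro _ _ ⟨i, rfl⟩ ⟨j, rfl⟩
          exact S.fam_lie_mem i j
        · simp
        · simp
        · intro x y z _ _ _ h1 h2
          rw [add_lie]; exact add_mem h1 h2
        · intro x y z _ _ _ h1 h2
          rw [lie_add]; exact add_mem h1 h2
        · intro r x y _ _ h1
          rw [smul_lie]; exact Submodule.smul_mem _ _ h1
        · intro r x y _ _ h1
          rw [lie_smul]; exact Submodule.smul_mem _ _ h1 }
  have h1 : LieSubalgebra.lieSpan ℂ L (Set.range h ∪ Set.range e ∪ Set.range f) ≤ M := by
    refine LieSubalgebra.lieSpan_le.2 ?_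
    rintro x ((⟨i, rfl⟩ | ⟨i, rfl⟩) | ⟨i, rfl⟩)
    · exact Submodule.subset_span ⟨Sum.inl i, rfl⟩
    · have := rv_mem_span (h := h) (e := e) (f := f) (isRoot_sr i)
      rwa [rv_sr] at this
    · have := rv_mem_span (h := h) (e := e) (f := f) (isRoot_sr i).neg
      rw [rv_neg_sr] at this
      rw [← neg_neg (f i)]
      exact neg_mem this
  rw [hg] at h1
  exact eq_top_iff.2 fun x _ ↦ h1 (LieSubalgebra.mem_top x)

lemma rv_eq_zero_of (ha : IsRoot a) (h0 : rv e f a = 0) (hb : IsRoot b) (hab : bil a b ≠ 0) :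
    rv e f b = 0 := by
  have h1 := S.lie_rv_neg ha
  rw [h0, zero_lie, zero_eq_neg] at h1
  have h2 := S.cr_rv hb a
  rw [h1, zero_lie, ← Int.cast_smul_eq_zsmul ℂ] at h2
  exact (smul_eq_zero.1 h2.symm).resolve_left (by exact_mod_cast hab)

lemma rv_ne_zero [Nontrivial L] (hs : Submodule.span ℂ (Set.range (fam h e f)) = ⊤)
    (ha : IsRoot a) : rv e f a ≠ 0 := fun h0 ↦ by
  obtain ⟨i, hi⟩ := exists_bil_sr_ne ha.ne_zero
  have h1 := S.rv_eq_zero_of ha h0 (isRoot_sr i) (by rwa [bil_comm])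
  have hstep : ∀ i j, bil (sr i) (sr j) ≠ 0 → rv e f (sr i) = 0 → rv e f (sr j) = 0 :=
    fun i j hij h ↦ S.rv_eq_zero_of (isRoot_sr i) h (isRoot_sr j) hij
  have h3 : rv e f (sr 3) = 0 := by
    have t1 := hstep 2 3 (by rw [bil_sr_sr]; decide); have t2 := hstep 0 2 (by rw [bil_sr_sr]; decide)
    have t3 := hstep 1 3 (by rw [bil_sr_sr]; decide); have t4 := hstep 4 3 (by rw [bil_sr_sr]; decide)
    have t5 := hstep 5 4 (by rw [bil_sr_sr]; decide); have t6 := hstep 6 5 (by rw [bil_sr_sr]; decide)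
    have t7 := hstep 7 6 (by rw [bil_sr_sr]; decide)
    fin_cases i
    exacts [t1 (t2 h1), t3 h1, t1 h1, h1, t4 h1, t4 (t5 h1), t4 (t5 (t6 h1)),
      t4 (t5 (t6 (t7 h1)))]
  have h4 : ∀ i, rv e f (sr i) = 0 := by
    have t1 := hstep 3 2 (by rw [bil_sr_sr]; decide); have t2 := hstep 2 0 (by rw [bil_sr_sr]; decide)
    have t3 := hstep 3 1 (by rw [bil_sr_sr]; decide); have t4 := hstep 3 4 (by rw [bil_sr_sr]; decide)
    have t5 := hstep 4 5 (by rw [bil_sr_sr]; decide); have t6 := hstep 5 6 (by rw [bil_sr_sr]; decide)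
    have t7 := hstep 6 7 (by rw [bil_sr_sr]; decide)
    intro i
    fin_cases i
    exacts [t2 (t1 h3), t3 h3, t1 h3, h3, t4 h3, t5 (t4 h3), t6 (t5 (t4 h3)),
      t7 (t6 (t5 (t4 h3)))]
  have h5 : ∀ x, fam h e f x = 0 := by
    rintro (i | ⟨b, hb⟩)
    · have := S.lie_rv_neg (isRoot_sr i)
      rw [h4, zero_lie, zero_eq_neg, cr_sr] at this
      exact this
    · obtain ⟨i, hi⟩ := exists_bil_sr_ne hb.ne_zero
      exact S.rv_eq_zero_of (isRoot_sr i) (h4 i) hb hi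
  have h6 : Submodule.span ℂ (Set.range (fam h e f)) = ⊥ := by
    rw [Submodule.span_eq_bot]
    rintro _ ⟨i, rfl⟩; exact h5 i
  exact bot_ne_top (h6.symm.trans hs)

lemma linearIndependent_fam (h0 : ∀ a, IsRoot a → rv e f a ≠ 0) :
    LinearIndependent ℂ (fam h e f) := by
  have hz : LinearIndependent ℂ fun a : {a : Q // IsRoot a} ↦ rv e f a := by
    refine Module.End.eigenvectors_linearIndependent' (LieAlgebra.ad ℂ L (cr h sep))
      (fun a : {a : Q // IsRoot a} ↦ ((bil sep a : ℤ) : ℂ)) ?_ (fun a ↦ rv e f a) ?_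
    · intro a b hab
      exact Subtype.ext (bil_sep_injOn a.2 b.2 (by simpa using hab))
    · intro a
      refine ⟨Module.End.mem_eigenspace_iff.2 ?_, h0 _ a.2⟩
      rw [LieAlgebra.ad_apply, S.cr_rv a.2, Int.cast_smul_eq_zsmul]
  rw [Fintype.linearIndependent_iff]
  intro g hg
  rw [Fintype.sum_sum_type] at hg
  simp only [fam, Sum.elim_inl, Sum.elim_inr] at hg
  have hth : ∀ t i, ⁅cr h t, h i⁆ = 0 := fun t i ↦ by simp [cr, sum_lie, S.hh]
  have h1 : ∑ a : {a : Q // IsRoot a}, (g (Sum.inr a) * (bil sep a : ℤ)) • rv e f a = 0 := by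
    have := congrArg (fun x ↦ ⁅cr h sep, x⁆) hg
    simpa [lie_sum, hth, S.cr_rv, Subtype.prop, ← Int.cast_smul_eq_zsmul ℂ, smul_smul] using this
  have h2 : ∀ a, g (Sum.inr a) = 0 := fun a ↦ by
    have := Fintype.linearIndependent_iff.1 hz _ h1 a
    exact (mul_eq_zero.1 this).resolve_right (by exact_mod_cast bil_sep_ne_zero a.2)
  simp only [h2, zero_smul, Finset.sum_const_zero, add_zero] at hg
  have h3 : ∀ a, IsRoot a → ∑ i, g (Sum.inl i) * (bil (sr i) a : ℤ) = 0 := fun a ha ↦ by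
    have := congrArg (fun x ↦ ⁅x, rv e f a⁆) hg
    simp only [sum_lie, smul_lie, S.h_rv ha, ← Int.cast_smul_eq_zsmul ℂ, smul_smul, zero_lie,
      ← Finset.sum_smul] at this
    exact (smul_eq_zero.1 this).resolve_right (h0 a ha)
  have h4 : ∀ k, g (Sum.inl k) = 0 := by
    have key : ∀ k : Fin 8, g (Sum.inl k) = ∑ i, (fw k i : ℂ) *
        ∑ j, (bil (sr i) (sr j) : ℂ) * g (Sum.inl j) := by
      intro k
      fin_cases k <;> simp [Fin.sum_univ_eight, bil, sr, Pi.single_apply, fw] <;> ring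
    intro k
    rw [key]
    refine Finset.sum_eq_zero fun i _ ↦ ?_
    have := h3 _ (isRoot_sr i)
    rw [Finset.sum_congr rfl fun j _ ↦ by rw [bil_comm (sr i), mul_comm], this, mul_zero]
  rintro (i | a)
  exacts [h4 i, h2 a]

end

end Serre


end E8

namespace E8

open CartanMatrix LieAlgebra

/-- The quotient map from the free Lie algebra on the Serre generators. -/
noncomputable def fproj : FreeLieAlgebra ℂ (Generators (Fin 8)) →ₗ⁅ℂ⁆ e₈ ℂ :=
  { (Submodule.mkQ (Relations.toIdeal ℂ CartanMatrix.E₈).toSubmodule :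
      FreeLieAlgebra ℂ (Generators (Fin 8)) →ₗ[ℂ] e₈ ℂ) with
    map_lie' := rfl }

lemma fproj_surjective : Function.Surjective fproj :=
  Submodule.mkQ_surjective (Relations.toIdeal ℂ CartanMatrix.E₈).toSubmodule

lemma fproj_eq_zero {x : FreeLieAlgebra ℂ (Generators (Fin 8))}
    (hx : x ∈ Relations.toSet ℂ CartanMatrix.E₈) : fproj x = 0 :=
  (Submodule.Quotient.mk_eq_zero (Relations.toIdeal ℂ CartanMatrix.E₈).toSubmodule).2
    (LieSubmodule.subset_lieSpan hx)

/-- The generators `h_i`. -/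
noncomputable def gh (i : Fin 8) : e₈ ℂ := fproj (FreeLieAlgebra.of ℂ (Generators.H i))
/-- The generators `e_i`. -/
noncomputable def ge (i : Fin 8) : e₈ ℂ := fproj (FreeLieAlgebra.of ℂ (Generators.E i))
/-- The generators `f_i`. -/
noncomputable def gf (i : Fin 8) : e₈ ℂ := fproj (FreeLieAlgebra.of ℂ (Generators.F i))

lemma half_aux (x : Fin 8 → e₈ ℂ)
    (hx : ∀ i j, ((ad ℂ (e₈ ℂ) (x i)) ^ (-CartanMatrix.E₈ i j).toNat) ⁅x i, x j⁆ = 0) :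
    HalfSerre x where
  comm i j hij := by
    have := hx i j
    rw [← bil_sr_sr, hij] at this
    simpa using this
  serre i j hij := by
    have := hx i j
    rw [← bil_sr_sr, hij] at this
    simpa using this

lemma fproj_ad_pow (x y : FreeLieAlgebra ℂ (Generators (Fin 8))) (n : ℕ) :
    fproj (((ad ℂ _ x) ^ n) y) = ((ad ℂ _ (fproj x)) ^ n) (fproj y) := by
  induction n with
  | zero => simp
  | succ n ih => rw [pow_succ', pow_succ', Module.End.mul_apply, Module.End.mul_apply, ad_apply,
      ad_apply, LieHom.map_lie, ih]

lemma serre_e₈ : Serre gh ge gf where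
  hh i j := by
    have := fproj_eq_zero (x := Relations.HH ℂ (i, j)) (by simp [Relations.toSet])
    simpa [gh, ge, gf, Relations.HH] using this
  ef i := by
    have := fproj_eq_zero (x := Relations.EF ℂ (i, i)) (by simp [Relations.toSet])
    simpa [gh, ge, gf, Relations.EF, sub_eq_zero] using this
  ef_ne i j hij := by
    have := fproj_eq_zero (x := Relations.EF ℂ (i, j)) (by simp [Relations.toSet])
    simpa [gh, ge, gf, Relations.EF, hij] using this
  he i j := by
    have := fproj_eq_zero (x := Relations.HE ℂ CartanMatrix.E₈ (i, j)) (by simp [Relations.toSet])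
    rw [bil_sr_sr]
    simpa [gh, ge, gf, Relations.HE, sub_eq_zero] using this
  hf i j := by
    have := fproj_eq_zero (x := Relations.HF ℂ CartanMatrix.E₈ (i, j)) (by simp [Relations.toSet])
    rw [bil_sr_sr]
    simpa [gh, ge, gf, Relations.HF, add_eq_zero_iff_eq_neg] using this
  pos := half_aux _ fun i j ↦ by
    have := fproj_eq_zero (x := Relations.adE ℂ CartanMatrix.E₈ (i, j)) (by simp [Relations.toSet])
    simpa only [ge, Function.comp_apply, Relations.adE, Function.uncurry_apply_pair, fproj_ad_pow, LieHom.map_lie] using this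
  neg := half_aux _ fun i j ↦ by
    have := fproj_eq_zero (x := Relations.adF ℂ CartanMatrix.E₈ (i, j)) (by simp [Relations.toSet])
    simpa only [gf, Function.comp_apply, Relations.adF, Function.uncurry_apply_pair, fproj_ad_pow, LieHom.map_lie] using this

lemma lieSpan_generators :
    LieSubalgebra.lieSpan ℂ (e₈ ℂ) (Set.range gh ∪ Set.range ge ∪ Set.range gf) = ⊤ := by
  set M := LieSubalgebra.lieSpan ℂ (e₈ ℂ) (Set.range gh ∪ Set.range ge ∪ Set.range gf)
  have hM : ∀ g, fproj (FreeLieAlgebra.of ℂ g) ∈ M := by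
    rintro (i | i | i) <;> apply LieSubalgebra.subset_lieSpan
    · exact Or.inl (Or.inl ⟨i, rfl⟩)
    · exact Or.inl (Or.inr ⟨i, rfl⟩)
    · exact Or.inr ⟨i, rfl⟩
  let φ : FreeLieAlgebra ℂ (Generators (Fin 8)) →ₗ⁅ℂ⁆ M :=
    FreeLieAlgebra.lift ℂ fun g ↦ ⟨_, hM g⟩
  have hφ : M.incl.comp φ = fproj := by
    refine FreeLieAlgebra.hom_ext ?_
    intro g
    simp [φ]
  refine eq_top_iff.2 fun x _ ↦ ?_
  obtain ⟨y, rfl⟩ := fproj_surjective x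
  rw [← hφ]
  exact (φ y).2

lemma span_fam_e₈ : Submodule.span ℂ (Set.range (fam gh ge gf)) = ⊤ :=
  serre_e₈.span_fam lieSpan_generators

end E8

namespace E8

open Filter Topology

section normed

variable {E : Type*} [NormedAddCommGroup E] [NormedSpace ℂ E] [CompleteSpace E]

lemma hasDerivAt_exp_smul_apply (A : E →L[ℂ] E) {u : ℂ → E} {u' : E} {t : ℂ}
    (hu : HasDerivAt u u' t) :
    HasDerivAt (fun t ↦ NormedSpace.exp (t • A) (u t))
      (NormedSpace.exp (t • A) (A (u t) + u')) t := by
  have h1 := (hasDerivAt_exp_smul_const A t).clm_apply hu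
  simpa [add_comm] using h1

lemma exp_apply_of_cube (A : E →L[ℂ] E) (x : E) (hx : A (A (A x)) = 0) :
    NormedSpace.exp A x = x + A x + (1 / 2 : ℂ) • A (A x) := by
  have hd : ∀ t : ℂ, HasDerivAt (fun t : ℂ ↦ NormedSpace.exp (t • A)
      (x + (1 - t) • A x + ((1 - t) ^ 2 / 2) • A (A x))) 0 t := fun t ↦ by
    have h1 : HasDerivAt (fun t : ℂ ↦ 1 - t) (-1) t := by simpa using (hasDerivAt_id t).const_sub 1
    have h2 : HasDerivAt (fun t : ℂ ↦ (1 - t) ^ 2 / 2) (-(1 - t)) t := by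
      refine ((h1.pow 2).div_const 2).congr_deriv ?_
      push_cast; ring
    have h3 := ((h1.smul_const (A x)).const_add x).add (h2.smul_const (A (A x)))
    refine (hasDerivAt_exp_smul_apply A h3).congr_deriv ?_
    have : A (x + (1 - t) • A x + ((1 - t) ^ 2 / 2) • A (A x)) +
      ((-1 : ℂ) • A x + (-(1 - t)) • A (A x)) = 0 := by
      simp only [map_add, map_smul, hx]
      module
    rw [Pi.add_apply, this, map_zero]
  have h0 := is_const_of_deriv_eq_zero (fun t ↦ (hd t).differentiableAt) (fun t ↦ (hd t).deriv) 1 0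
  simpa using h0

lemma exp_apply_bracket (D : E →L[ℂ] E →L[ℂ] E) (A : E →L[ℂ] E)
    (hA : ∀ x y, A (D x y) = D (A x) y + D x (A y)) (x y : E) :
    NormedSpace.exp A (D x y) = D (NormedSpace.exp A x) (NormedSpace.exp A y) := by
  have he : ∀ (x : E) (t : ℂ), HasDerivAt (fun t : ℂ ↦ NormedSpace.exp ((1 - t) • A) x)
      (-(A (NormedSpace.exp ((1 - t) • A) x))) t := fun x t ↦ by
    have h1 : HasDerivAt (fun t : ℂ ↦ 1 - t) (-1) t := by simpa using (hasDerivAt_id t).const_sub 1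
    have h2 := ((hasDerivAt_exp_smul_const' A (1 - t)).clm_apply
      (hasDerivAt_const (1 - t) x)).scomp t h1
    simpa [Function.comp_def] using h2
  have hd : ∀ t : ℂ, HasDerivAt (fun t : ℂ ↦ NormedSpace.exp (t • A)
      (D (NormedSpace.exp ((1 - t) • A) x) (NormedSpace.exp ((1 - t) • A) y))) 0 t := fun t ↦ by
    have h3 := ((D.hasFDerivAt.comp_hasDerivAt t (he x t))).clm_apply (he y t)
    refine (hasDerivAt_exp_smul_apply A h3).congr_deriv ?_
    simp only [hA, Function.comp_apply, map_add, map_neg, neg_apply]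
    abel
  have h0 := is_const_of_deriv_eq_zero (fun t ↦ (hd t).differentiableAt) (fun t ↦ (hd t).deriv) 1 0
  simpa using h0

lemma exp_mem (A : E →L[ℂ] E) (W : Submodule ℂ E) (hW : IsClosed (W : Set E))
    (hA : ∀ w ∈ W, A w ∈ W) {w : E} (hw : w ∈ W) : NormedSpace.exp A w ∈ W := by
  have h1 := NormedSpace.exp_series_hasSum_exp' (𝕂 := ℂ) A
  have h2 := h1.mapL (ContinuousLinearMap.apply ℂ E w)
  refine hW.mem_of_tendsto h2 (Eventually.of_forall fun s ↦ W.sum_mem fun n _ ↦ ?_)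
  have h3 : ∀ n : ℕ, (A ^ n) w ∈ W := fun n ↦ by
    induction n with
    | zero => simpa
    | succ n ih => rw [pow_succ']; exact hA _ ih
  simpa using W.smul_mem _ (h3 n)

lemma exp_open [FiniteDimensional ℂ E] (D : E →L[ℂ] E →L[ℂ] E) (A S W : Submodule ℂ E) {s₀ : E}
    (hs₀ : s₀ ∈ W) (hSW : S ≤ W) (hAW : ∀ a ∈ A, ∀ w ∈ W, D a w ∈ W)
    (hsurj : ∀ w ∈ W, ∃ a ∈ A, ∃ s ∈ S, D a s₀ + s = w) {v : E} (hv : v ∈ W) :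
    ∀ᶠ t : ℂ in 𝓝 0, ∃ a ∈ A, ∃ s ∈ S, NormedSpace.exp (D a) (s₀ + s) = s₀ + t • v := by
  obtain ⟨π, hπ⟩ := W.subtype.exists_leftInverse_of_injective (by simp)
  have hπ' : ∀ w (hw : w ∈ W), π w = ⟨w, hw⟩ := fun w hw ↦ LinearMap.congr_fun hπ ⟨w, hw⟩
  let π' := LinearMap.toContinuousLinearMap π
  let F : A × S → W := fun p ↦ π' (NormedSpace.exp (D p.1) (s₀ + p.2))
  have h1 : HasStrictFDerivAt (fun p : A × S ↦ NormedSpace.exp (D p.1))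
      (((1 : (E →L[ℂ] E) →L[ℂ] (E →L[ℂ] E))).comp
        (D.comp (A.subtypeL.comp (ContinuousLinearMap.fst ℂ A S)))) 0 := by
    refine HasStrictFDerivAt.comp (g := NormedSpace.exp) (0 : A × S) ?_
      (D.comp (A.subtypeL.comp (ContinuousLinearMap.fst ℂ A S))).hasStrictFDerivAt
    simpa using hasStrictFDerivAt_exp_zero (𝕂 := ℂ) (𝔸 := E →L[ℂ] E)
  have h2 : HasStrictFDerivAt (fun p : A × S ↦ s₀ + (p.2 : E))
      (S.subtypeL.comp (ContinuousLinearMap.snd ℂ A S)) 0 :=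
    (S.subtypeL.comp (ContinuousLinearMap.snd ℂ A S)).hasStrictFDerivAt.const_add s₀
  have h3 := π'.hasStrictFDerivAt.comp 0 (h1.clm_apply h2)
  have h4 := h3.map_nhds_eq_of_surj (by
    rw [LinearMap.range_eq_top]
    rintro ⟨w, hw⟩
    obtain ⟨a, ha, s, hs, rfl⟩ := hsurj w hw
    refine ⟨(⟨a, ha⟩, ⟨s, hs⟩), ?_⟩
    simpa [add_comm, π'] using hπ' _ hw)
  have h5 : Tendsto (fun t : ℂ ↦ (⟨s₀, hs₀⟩ : W) + t • ⟨v, hv⟩) (𝓝 0) (𝓝 ⟨s₀, hs₀⟩) := by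
    have : Continuous (fun t : ℂ ↦ (⟨s₀, hs₀⟩ : W) + t • ⟨v, hv⟩) := by fun_prop
    simpa using this.tendsto 0
  have h6 : F 0 = ⟨s₀, hs₀⟩ := by simpa [F, π'] using hπ' _ hs₀
  have h7 : Set.range F ∈ 𝓝 (⟨s₀, hs₀⟩ : W) := by
    rw [← h6]
    change _ ∈ 𝓝 (π' (NormedSpace.exp (D (0 : A × S).1) (s₀ + ((0 : A × S).2 : E))))
    rw [← h4]
    exact range_mem_map
  filter_upwards [h5 h7] with t ht
  obtain ⟨p, hp⟩ := ht
  refine ⟨p.1, p.1.2, p.2, p.2.2, ?_⟩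
  have h8 : NormedSpace.exp (D p.1) (s₀ + p.2) ∈ W :=
    exp_mem _ W W.closed_of_finiteDimensional (hAW _ p.1.2) (add_mem hs₀ (hSW p.2.2))
  have h9 : π (NormedSpace.exp (D p.1) (s₀ + p.2)) = _ := hp
  rw [hπ' _ h8] at h9
  simpa using congrArg Subtype.val h9

end normed

section lie

variable {L : Type*} [LieRing L] [LieAlgebra ℂ L]

/-- An automorphism acting as the exponential of `ad a` on vectors killed by its cube. -/
def IsExp (a : L) (φ : L ≃ₗ⁅ℂ⁆ L) : Prop :=
  ∀ x, ⁅a, ⁅a, ⁅a, x⁆⁆⁆ = 0 → φ x = x + ⁅a, x⁆ + (1 / 2 : ℂ) • ⁅a, ⁅a, x⁆⁆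

lemma IsExp.fix {a x : L} {φ : L ≃ₗ⁅ℂ⁆ L} (h : IsExp a φ) (hx : ⁅a, x⁆ = 0) : φ x = x := by
  simpa [hx] using h x (by simp [hx])

variable [FiniteDimensional ℂ L]

variable (L) in
/-- A linear identification with a normed space. -/
noncomputable def toNormed : L ≃ₗ[ℂ] (Fin (Module.finrank ℂ L) → ℂ) :=
  (Module.finBasis ℂ L).equivFun

variable (L) in
/-- The bracket transported to a normed space. -/
noncomputable def normedBracket :
    (Fin (Module.finrank ℂ L) → ℂ) →L[ℂ] (Fin (Module.finrank ℂ L) → ℂ) →L[ℂ]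
      (Fin (Module.finrank ℂ L) → ℂ) :=
  LinearMap.toContinuousLinearMap (LinearMap.toContinuousLinearMap.toLinearMap ∘ₗ
    ((LieModule.toEnd ℂ L L : L →ₗ[ℂ] L →ₗ[ℂ] L).compl₁₂ (toNormed L).symm.toLinearMap
      (toNormed L).symm.toLinearMap).compr₂ (toNormed L).toLinearMap)

lemma normedBracket_apply (a x : L) :
    normedBracket L (toNormed L a) (toNormed L x) = toNormed L ⁅a, x⁆ := by
  simp [normedBracket]

/-- The exponential of `ad a`. -/
noncomputable def expAd (a : L) : L →ₗ[ℂ] L :=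
  (toNormed L).symm.toLinearMap ∘ₗ
    (NormedSpace.exp (normedBracket L (toNormed L a))).toLinearMap ∘ₗ (toNormed L).toLinearMap

lemma toNormed_expAd (a x : L) : toNormed L (expAd a x) =
    NormedSpace.exp (normedBracket L (toNormed L a)) (toNormed L x) := by
  simp [expAd]

lemma expAd_neg (a x : L) : expAd (-a) (expAd a x) = x := by
  apply (toNormed L).injective
  have h1 := NormedSpace.exp_add_of_commute_of_mem_ball (𝕂 := ℂ)
    (Commute.refl (normedBracket L (toNormed L a))).neg_left
    (by simp [NormedSpace.expSeries_radius_eq_top]) (by simp [NormedSpace.expSeries_radius_eq_top])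
  rw [neg_add_cancel, NormedSpace.exp_zero] at h1
  rw [toNormed_expAd, toNormed_expAd, map_neg, map_neg]
  exact (DFunLike.congr_fun h1 (toNormed L x)).symm

lemma expAd_lie (a x y : L) : expAd a ⁅x, y⁆ = ⁅expAd a x, expAd a y⁆ := by
  apply (toNormed L).injective
  rw [toNormed_expAd, ← normedBracket_apply x y, ← normedBracket_apply (expAd a x),
    toNormed_expAd, toNormed_expAd]
  refine exp_apply_bracket _ _ (fun x y ↦ ?_) _ _
  obtain ⟨x, rfl⟩ := (toNormed L).surjective x
  obtain ⟨y, rfl⟩ := (toNormed L).surjective y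
  simp only [normedBracket_apply, ← map_add]
  rw [leibniz_lie]

/-- The exponential of `ad a` as an automorphism. -/
noncomputable def expAut (a : L) : L ≃ₗ⁅ℂ⁆ L :=
  { expAd a with
    map_lie' := expAd_lie a _ _
    invFun := expAd (-a)
    left_inv := expAd_neg a
    right_inv := fun x ↦ by simpa using expAd_neg (-a) x }

lemma isExp_expAut (a : L) : IsExp a (expAut a) := fun x hx ↦ by
  apply (toNormed L).injective
  change toNormed L (expAd a x) = _
  rw [toNormed_expAd, exp_apply_of_cube]
  · simp only [normedBracket_apply, map_add, map_smul]
  · simp only [normedBracket_apply, hx, map_zero]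

/-- The image of a small deformation of `s₀` under exponentials is open. -/
theorem exists_isExp (A S W : Submodule ℂ L) {s₀ : L}
    (hs₀ : s₀ ∈ W) (hSW : S ≤ W) (hAW : ∀ a ∈ A, ∀ w ∈ W, ⁅a, w⁆ ∈ W)
    (hsurj : ∀ w ∈ W, ∃ a ∈ A, ∃ s ∈ S, ⁅a, s₀⁆ + s = w) {v : L} (hv : v ∈ W) :
    ∀ᶠ t : ℂ in 𝓝 0, ∃ a ∈ A, ∃ φ : L ≃ₗ⁅ℂ⁆ L, IsExp a φ ∧ ∃ s ∈ S, φ (s₀ + s) = s₀ + t • v := by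
  have key := exp_open (normedBracket L) (A.map (toNormed L).toLinearMap)
    (S.map (toNormed L).toLinearMap) (W.map (toNormed L).toLinearMap) (s₀ := toNormed L s₀)
    (v := toNormed L v) ⟨_, hs₀, rfl⟩ (Submodule.map_mono hSW) ?_ ?_ ⟨_, hv, rfl⟩
  · filter_upwards [key] with t
    rintro ⟨_, ⟨a, ha, rfl⟩, _, ⟨s, hs, rfl⟩, h⟩
    refine ⟨a, ha, expAut a, isExp_expAut a, s, hs, (toNormed L).injective ?_⟩
    change toNormed L (expAd a (s₀ + s)) = _
    rw [toNormed_expAd, (toNormed L).map_add, (toNormed L).map_add, (toNormed L).map_smul]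
    exact h
  · rintro _ ⟨a, ha, rfl⟩ _ ⟨w, hw, rfl⟩
    exact ⟨_, hAW a ha w hw, (normedBracket_apply a w).symm⟩
  · rintro _ ⟨w, hw, rfl⟩
    obtain ⟨a, ha, s, hs, rfl⟩ := hsurj w hw
    refine ⟨_, ⟨a, ha, rfl⟩, _, ⟨s, hs, rfl⟩, ?_⟩
    simp [normedBracket_apply]

end lie

/-- A relation which is locally constant off a finite set is constant off that set. -/
lemma rel_of_eventually {F : Set ℂ} (hF : F.Finite) (r : ℂ → ℂ → Prop)
    (hsymm : ∀ {x y}, r x y → r y x) (htrans : ∀ {x y z}, r x y → r y z → r x z)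
    (h : ∀ t ∉ F, ∀ᶠ s in 𝓝 t, r t s) {x y : ℂ} (hx : x ∉ F) (hy : y ∉ F) : r x y := by
  have h1 : IsPreconnected Fᶜ :=
    (hF.countable.isConnected_compl_of_one_lt_rank (by simp)).isPreconnected
  exact h1.induction₂ r (fun t ht ↦ (h t ht).filter_mono nhdsWithin_le_nhds)
    (fun _ _ _ _ _ _ ↦ htrans) (fun _ _ _ _ ↦ hsymm) hx hy

/-- Surjectivity of a linear pencil persists off a finite set. -/
lemma finite_not_surjective {V W : Type*} [AddCommGroup V] [Module ℂ V] [AddCommGroup W]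
    [Module ℂ W] [FiniteDimensional ℂ W] (A B : V →ₗ[ℂ] W) (hA : Function.Surjective A) :
    {t : ℂ | ¬ Function.Surjective (A + t • B)}.Finite := by
  obtain ⟨s, hs⟩ := A.exists_rightInverse_of_surjective (LinearMap.range_eq_top.2 hA)
  let M := LinearMap.toMatrix (Module.finBasis ℂ W) (Module.finBasis ℂ W) (B ∘ₗ s)
  let p : Polynomial ℂ := (1 + (Polynomial.X : Polynomial ℂ) • M.map Polynomial.C).det
  have hp : ∀ t : ℂ, p.eval t = LinearMap.det ((A + t • B) ∘ₗ s) := fun t ↦ by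
    have h1 : (A + t • B) ∘ₗ s = 1 + t • (B ∘ₗ s) := by
      rw [LinearMap.add_comp, hs]; rfl
    rw [h1, ← LinearMap.det_toMatrix (Module.finBasis ℂ W), map_add, map_smul,
      LinearMap.toMatrix_one, ← Polynomial.coe_evalRingHom, RingHom.map_det]
    congr 1
    ext i j
    simp [M, Matrix.one_apply, apply_ite]
    ring
  have hp0 : p ≠ 0 := fun h ↦ by
    have := hp 0
    simp [h, hs] at this
  refine (p.roots.toFinset.finite_toSet).subset fun t ht ↦ ?_
  by_contra h
  refine ht ?_
  have h1 : p.eval t ≠ 0 := by simpa [hp0] using h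
  rw [hp] at h1
  have h2 := ((LinearMap.equivOfDetNeZero _ h1).surjective)
  intro w
  obtain ⟨u, hu⟩ := h2 w
  exact ⟨s u, hu⟩

end E8

namespace E8

/-- The index type of a Chevalley basis. -/
abbrev Idx := Fin 8 ⊕ {a : Q // IsRoot a}

/-- A Chevalley basis of type `E₈`. -/
class ChevalleyBasis (L : Type*) [LieRing L] [LieAlgebra ℂ L] where
  /-- The coroots. -/
  H : Q →+ L
  /-- The root vectors. -/
  R : Q → L
  /-- The underlying basis. -/
  basis : Module.Basis Idx ℂ L
  basis_inl (i : Fin 8) : basis (Sum.inl i) = H (sr i)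
  basis_inr (a : {a : Q // IsRoot a}) : basis (Sum.inr a) = R a
  lie_H_H (a b : Q) : ⁅H a, H b⁆ = 0
  lie_H_R (a : Q) {b : Q} : IsRoot b → ⁅H a, R b⁆ = (bil a b : ℂ) • R b
  lie_R_R {a b : Q} : IsRoot a → IsRoot b → bil a b = -1 → ⁅R a, R b⁆ = (eps a b : ℂ) • R (a + b)
  lie_R_R_zero {a b : Q} : IsRoot a → IsRoot b → 0 ≤ bil a b → ⁅R a, R b⁆ = 0
  lie_R_R_neg {a : Q} : IsRoot a → ⁅R a, R (-a)⁆ = -H a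

/-- The Chevalley basis of the Lie algebra defined by the Serre relations. -/
@[reducible] noncomputable def chevalleyBasis [Nontrivial (LieAlgebra.e₈ ℂ)] :
    ChevalleyBasis (LieAlgebra.e₈ ℂ) where
  H := AddMonoidHom.mk' (cr (gh : _ → LieAlgebra.e₈ ℂ)) fun _ _ ↦ cr_add
  R := rv ge gf
  basis := Module.Basis.mk (serre_e₈.linearIndependent_fam fun _ ↦ serre_e₈.rv_ne_zero span_fam_e₈)
    span_fam_e₈.ge
  basis_inl i := by
    rw [Module.Basis.mk_apply]
    exact (cr_sr (h := gh) i).symm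
  basis_inr a := by
    rw [Module.Basis.mk_apply]
    rfl
  lie_H_H a b := by
    simp [cr, sum_lie, lie_sum, serre_e₈.hh]
  lie_H_R a b hb := by simpa [Int.cast_smul_eq_zsmul] using serre_e₈.cr_rv hb a
  lie_R_R ha hb hab := by
    simpa [Int.cast_smul_eq_zsmul] using serre_e₈.lie_rv ha hb hab
  lie_R_R_zero ha hb hab := serre_e₈.lie_rv_zero ha hb hab
  lie_R_R_neg ha := serre_e₈.lie_rv_neg ha

open ChevalleyBasis

section

variable {L : Type*} [LieRing L] [LieAlgebra ℂ L] [ChevalleyBasis L]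

lemma finiteDimensional_of_chevalleyBasis : FiniteDimensional ℂ L := basis.finiteDimensional_of_finite

lemma H_eq_sum (a : Q) : (H a : L) = ∑ i, (a i : ℂ) • H (sr i) := by
  have h1 : a = ∑ i, a i • sr i := by
    ext j
    simp [sr, Pi.single_apply]
  conv_lhs => rw [h1]
  simp only [map_sum, map_zsmul, Int.cast_smul_eq_zsmul]

/-- The degree of a basis vector with respect to a coweight. -/
def deg (c : Q) : Idx → ℤ := Sum.elim 0 fun a ↦ bil c a

lemma lie_H_basis (c : Q) (i : Idx) : ⁅(H c : L), basis i⁆ = (deg c i : ℂ) • (basis i : L) := by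
  rcases i with i | a
  · simp [basis_inl, lie_H_H, deg]
  · simp [basis_inr, lie_H_R _ a.2, deg]

variable (L) in
/-- The homogeneous part of degree `k` of the grading defined by `c`. -/
def G (c : Q) (k : ℤ) : Submodule ℂ L where
  carrier := {x | ⁅(H c : L), x⁆ = (k : ℂ) • x}
  zero_mem' := by simp
  add_mem' := by
    intro x y hx hy
    simp only [Set.mem_ofPred_eq] at *
    rw [lie_add, hx, hy, smul_add]
  smul_mem' := by
    intro r x hx
    simp only [Set.mem_ofPred_eq] at *
    rw [lie_smul, hx, smul_comm]

lemma mem_G {c : Q} {k : ℤ} {x : L} : x ∈ G L c k ↔ ⁅(H c : L), x⁆ = (k : ℂ) • x := Iff.rfl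

lemma basis_mem_G (c : Q) (i : Idx) : (basis i : L) ∈ G L c (deg c i) := lie_H_basis c i

lemma H_mem_G (c a : Q) : (H a : L) ∈ G L c 0 := by simp [mem_G, lie_H_H]

lemma R_mem_G (c : Q) {a : Q} (ha : IsRoot a) : (R a : L) ∈ G L c (bil c a) := lie_H_R c ha

lemma lie_mem_G {c : Q} {j k : ℤ} {x y : L} (hx : x ∈ G L c j) (hy : y ∈ G L c k) :
    ⁅x, y⁆ ∈ G L c (j + k) := by
  rw [mem_G] at *
  rw [leibniz_lie, hx, hy]
  simp [add_smul]

/-- The projection onto the homogeneous part of degree `k`. -/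
noncomputable def proj (c : Q) (k : ℤ) : L →ₗ[ℂ] L :=
  basis.constr ℂ fun i ↦ if deg c i = k then basis i else 0

lemma proj_basis (c : Q) (k : ℤ) (i : Idx) :
    proj c k (basis i : L) = if deg c i = k then basis i else 0 := by
  rw [proj, Module.Basis.constr_basis]

lemma proj_lie_H (c : Q) (k : ℤ) (a : Q) (x : L) :
    proj c k ⁅(H a : L), x⁆ = ⁅(H a : L), proj c k x⁆ := by
  have : (proj c k : L →ₗ[ℂ] L) ∘ₗ (LieAlgebra.ad ℂ L (H a) : L →ₗ[ℂ] L) =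
      (LieAlgebra.ad ℂ L (H a) : L →ₗ[ℂ] L) ∘ₗ proj c k := by
    refine basis.ext fun i ↦ ?_
    simp only [LinearMap.comp_apply, LieAlgebra.ad_apply, lie_H_basis, map_smul, proj_basis]
    split_ifs <;> simp [lie_H_basis]
  exact LinearMap.congr_fun this x

lemma proj_mem (c : Q) (k : ℤ) (x : L) : proj c k x ∈ G L c k := by
  rw [← basis.sum_repr x, map_sum]
  refine Submodule.sum_mem _ fun i _ ↦ ?_
  rw [map_smul, proj_basis]
  refine Submodule.smul_mem _ _ ?_
  split_ifs with h
  · exact h ▸ basis_mem_G c i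
  · exact zero_mem _

lemma proj_mem_G (c c' : Q) (k j : ℤ) {x : L} (hx : x ∈ G L c' j) : proj c k x ∈ G L c' j := by
  rw [mem_G] at *
  rw [← proj_lie_H, hx, map_smul]

lemma eq_zero_of_mem_G {c : Q} {j k : ℤ} (hjk : j ≠ k) {x : L} (hj : x ∈ G L c j)
    (hk : x ∈ G L c k) : x = 0 := by
  rw [mem_G] at *
  rw [hj] at hk
  have : ((j : ℂ) - k) • x = 0 := by rw [sub_smul, hk, sub_self]
  refine (smul_eq_zero.1 this).resolve_left ?_
  exact sub_ne_zero.2 (by exact_mod_cast hjk)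

lemma proj_of_ne {c : Q} {j k : ℤ} (hjk : j ≠ k) {x : L} (hx : x ∈ G L c j) : proj c k x = 0 :=
  eq_zero_of_mem_G hjk (proj_mem_G c c k j hx) (proj_mem c k x)

/-- The degrees occurring in the grading defined by `c`. -/
noncomputable def degs (c : Q) : Finset ℤ := Finset.univ.image (deg c)

lemma sum_proj (c : Q) (x : L) : ∑ k ∈ degs c, proj c k x = x := by
  have : (∑ k ∈ degs c, proj c k : L →ₗ[ℂ] L) = LinearMap.id := by
    refine basis.ext fun i ↦ ?_
    rw [LinearMap.sum_apply]
    simp only [proj_basis]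
    rw [Finset.sum_ite_eq]
    exact if_pos (Finset.mem_image_of_mem _ (Finset.mem_univ _))
  simpa using LinearMap.congr_fun this x

lemma mem_of_proj_mem (c : Q) (W : Submodule ℂ L) {x : L} (h : ∀ k, proj c k x ∈ W) : x ∈ W := by
  rw [← sum_proj c x]
  exact W.sum_mem fun k _ ↦ h k

lemma proj_of_mem {c : Q} {k : ℤ} {x : L} (hx : x ∈ G L c k) : proj c k x = x := by
  have h0 : x - proj c k x = 0 := by
    have h1 : ∀ j, proj c j (x - proj c k x) = 0 := fun j ↦ by
      rcases eq_or_ne k j with rfl | h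
      · have : (proj c k ∘ₗ proj c k : L →ₗ[ℂ] L) = proj c k := basis.ext fun i ↦ by
          simp only [LinearMap.comp_apply, proj_basis]
          split_ifs with h <;> simp [proj_basis, h]
        rw [map_sub, sub_eq_zero]
        exact (LinearMap.congr_fun this x).symm
      · exact proj_of_ne h (sub_mem hx (proj_mem c k x))
    rw [← sum_proj c (x - proj c k x)]
    exact Finset.sum_eq_zero fun j _ ↦ h1 j
  exact (sub_eq_zero.1 h0).symm

lemma proj_lie {c : Q} {j : ℤ} {x : L} (hx : x ∈ G L c j) (k : ℤ) (y : L) :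
    proj c (j + k) ⁅x, y⁆ = ⁅x, proj c k y⁆ := by
  have : (proj c (j + k) : L →ₗ[ℂ] L) ∘ₗ (LieAlgebra.ad ℂ L x : L →ₗ[ℂ] L) =
      (LieAlgebra.ad ℂ L x : L →ₗ[ℂ] L) ∘ₗ proj c k := by
    refine basis.ext fun i ↦ ?_
    simp only [LinearMap.comp_apply, LieAlgebra.ad_apply, proj_basis]
    have h1 := lie_mem_G hx (basis_mem_G c i)
    split_ifs with h
    · rw [← h, proj_of_mem h1]
    · rw [lie_zero, proj_of_ne (by omega) h1]
  exact LinearMap.congr_fun this y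

lemma lie_proj_eq_zero {c : Q} {j : ℤ} {x : L} (hx : x ∈ G L c j) (k : ℤ) {y : L}
    (h : ⁅x, y⁆ = 0) : ⁅x, proj c k y⁆ = 0 := by
  rw [← proj_lie hx, h, map_zero]

lemma repr_eq_zero_of_mem_G {c : Q} {k : ℤ} {x : L} (hx : x ∈ G L c k) {i : Idx}
    (hi : deg c i ≠ k) : basis.repr x i = 0 := by
  have : (basis.coord i ∘ₗ proj c k : L →ₗ[ℂ] ℂ) = 0 := basis.ext fun j ↦ by
    simp only [LinearMap.comp_apply, proj_basis]
    split_ifs with h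
    · have : j ≠ i := fun h' ↦ hi (h' ▸ h)
      simp [this]
    · simp
  have h2 := LinearMap.congr_fun this x
  rw [LinearMap.comp_apply, proj_of_mem hx] at h2
  exact h2

lemma G_eq_span (c : Q) (k : ℤ) :
    G L c k = Submodule.span ℂ (Set.range fun i : {i // deg c i = k} ↦ (basis i.1 : L)) := by
  apply le_antisymm
  · intro x hx
    rw [← basis.sum_repr x]
    refine Submodule.sum_mem _ fun i _ ↦ ?_
    by_cases h : deg c i = k
    · exact Submodule.smul_mem _ _ (Submodule.subset_span ⟨⟨i, h⟩, rfl⟩)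
    · simp [repr_eq_zero_of_mem_G hx h]
  · rw [Submodule.span_le]
    rintro _ ⟨i, rfl⟩
    have := basis_mem_G (L := L) c i.1
    rwa [i.2] at this

lemma finrank_G (c : Q) (k : ℤ) :
    Module.finrank ℂ (G L c k) = Fintype.card {i : Idx // deg c i = k} := by
  rw [G_eq_span]
  exact finrank_span_eq_card (basis.linearIndependent.comp _ Subtype.val_injective)

end

end E8

namespace E8

open ChevalleyBasis

section

variable {L : Type*} [LieRing L] [LieAlgebra ℂ L] [ChevalleyBasis L]

/-- The Killing form. -/
local notation "κ" => killingForm ℂ L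

omit [ChevalleyBasis L] in
lemma kil_lie (x y z : L) : κ ⁅x, y⁆ z = κ x ⁅y, z⁆ := LieModule.traceForm_apply_lie_apply ℂ L L x y z

omit [ChevalleyBasis L] in
lemma kil_comm (x y : L) : κ x y = κ y x := LieModule.traceForm_comm ℂ L L x y

omit [ChevalleyBasis L] in
lemma kil_lie' (x y z : L) : κ x ⁅y, z⁆ = -κ ⁅y, x⁆ z := by
  rw [← kil_lie, ← lie_skew, map_neg, LinearMap.neg_apply]

lemma kil_H_H (u v : Q) : κ (H u) (H v) = ∑ i : Idx, (deg u i : ℂ) * deg v i := by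
  rw [killingForm_apply_apply, LinearMap.trace_eq_matrix_trace ℂ basis, Matrix.trace]
  refine Finset.sum_congr rfl fun i _ ↦ ?_
  simp [Matrix.diag_apply, LinearMap.toMatrix_apply, LieAlgebra.ad_apply, lie_H_basis, mul_comm]

lemma kil_G {c : Q} {j k : ℤ} (hjk : j + k ≠ 0) {x y : L} (hx : x ∈ G L c j) (hy : y ∈ G L c k) :
    κ x y = 0 := by
  have h1 := kil_lie' (H c) x y
  have h2 := kil_lie x (H c) y
  rw [hy, map_smul] at h2
  have h3 : ⁅x, (H c : L)⁆ = -((j : ℂ) • x) := by rw [← lie_skew, hx]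
  rw [h3, map_neg, LinearMap.neg_apply, map_smul, LinearMap.smul_apply] at h2
  have h4 : ((j + k : ℤ) : ℂ) * κ x y = 0 := by
    push_cast
    simp only [smul_eq_mul] at h2
    linear_combination -h2
  exact (mul_eq_zero.1 h4).resolve_left (by exact_mod_cast hjk)

lemma kil_R_R_of_ne {a b : Q} (ha : IsRoot a) (hb : IsRoot b) (hab : a + b ≠ 0) :
    κ (R a) (R b) = 0 := by
  obtain ⟨i, hi⟩ := exists_bil_sr_ne hab
  refine kil_G (c := sr i) ?_ (R_mem_G _ ha) (R_mem_G _ hb)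
  rwa [← bil_add_right]

lemma two_mul_kil_R_R_neg {a : Q} (ha : IsRoot a) :
    2 * κ (R a) (R (-a)) = -κ (H a) (H a) := by
  have h1 := kil_lie (H a : L) (R a) (R (-a))
  rw [lie_H_R _ ha, lie_R_R_neg ha, show bil a a = 2 from ha] at h1
  simpa using h1

lemma kil_H_self_ne {u : Q} {a : Q} (ha : IsRoot a) (hua : bil u a ≠ 0) : κ (H u) (H u) ≠ 0 := by
  rw [kil_H_H]
  have : 0 < ∑ i : Idx, deg u i * deg u i :=
    Finset.sum_pos' (fun i _ ↦ mul_self_nonneg _) ⟨Sum.inr ⟨a, ha⟩, Finset.mem_univ _,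
      mul_self_pos.2 hua⟩
  exact_mod_cast this.ne'

lemma kil_R_R_neg_ne {a : Q} (ha : IsRoot a) : κ (R a) (R (-a)) ≠ 0 := fun h ↦ by
  have := two_mul_kil_R_R_neg (L := L) ha
  rw [h, mul_zero, eq_comm, neg_eq_zero] at this
  exact kil_H_self_ne ha (show bil a a ≠ 0 by rw [show bil a a = 2 from ha]; decide) this

lemma kil_nondeg {c : Q} {k : ℤ} {x : L} (hx : x ∈ G L c k)
    (h : ∀ y ∈ G L c (-k), κ x y = 0) : x = 0 := by
  have hr : ∀ a, IsRoot a → κ x (R a) = 0 := fun a ha ↦ by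
    by_cases hk : bil c a = -k
    · exact h _ (hk ▸ R_mem_G c ha)
    · exact kil_G (by omega) hx (R_mem_G c ha)
  have hR : ∀ a : {a : Q // IsRoot a}, basis.repr x (Sum.inr a) = 0 := by
    rintro ⟨a, ha⟩
    have h1 : κ x (R (-a)) = 0 := hr _ ha.neg
    conv at h1 => rw [← basis.sum_repr x, map_sum, LinearMap.sum_apply]
    rw [Finset.sum_eq_single (Sum.inr ⟨a, ha⟩)] at h1
    · rw [map_smul, LinearMap.smul_apply, basis_inr, smul_eq_mul] at h1
      exact (mul_eq_zero.1 h1).resolve_right (kil_R_R_neg_ne ha)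
    · intro j _ hj
      rw [map_smul, LinearMap.smul_apply]
      rcases j with j | ⟨b, hb⟩
      · obtain ⟨u, hu⟩ := exists_bil_sr_ne ha.ne_zero
        rw [basis_inl, kil_G (c := sr u) (j := 0) (k := bil (sr u) (-a))
          (by rwa [bil_neg_right, zero_add, neg_ne_zero]) (H_mem_G _ _) (R_mem_G _ ha.neg), smul_zero]
      · rw [basis_inr, kil_R_R_of_ne hb ha.neg, smul_zero]
        intro h'
        exact hj (by simp [add_neg_eq_zero.1 h'])
    · simp
  have hx' : x = ∑ i, basis.repr x (Sum.inl i) • (H (sr i) : L) := by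
    conv_lhs => rw [← basis.sum_repr x, Fintype.sum_sum_type]
    simp [hR, basis_inl]
  rcases eq_or_ne k 0 with rfl | hk
  swap
  · rw [hx']
    refine Finset.sum_eq_zero fun i _ ↦ ?_
    rw [repr_eq_zero_of_mem_G hx (i := Sum.inl i) hk.symm, zero_smul]
  have hl : ∀ j, ∑ i, basis.repr x (Sum.inl i) * (bil (sr i) (sr j) : ℂ) = 0 := fun j ↦ by
    have h1 : ⁅x, R (sr j)⁆ =
        (∑ i, basis.repr x (Sum.inl i) * (bil (sr i) (sr j) : ℂ)) • (R (sr j) : L) := by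
      conv_lhs => rw [hx']
      simp only [sum_lie, smul_lie, lie_H_R _ (isRoot_sr j), Finset.sum_smul, smul_smul]
    have h2 := kil_lie x (R (sr j)) (R (-sr j))
    rw [lie_R_R_neg (isRoot_sr j), h1, map_neg, h _ (neg_zero (G := ℤ) ▸ H_mem_G c _), map_smul,
      LinearMap.smul_apply, neg_zero, smul_eq_mul] at h2
    exact (mul_eq_zero.1 h2).resolve_right (kil_R_R_neg_ne (isRoot_sr j))
  rw [hx']
  refine Finset.sum_eq_zero fun k _ ↦ ?_
  have h3 : ∑ j, (fw k j : ℂ) * ∑ i, basis.repr x (Sum.inl i) * (bil (sr i) (sr j) : ℂ) = 0 :=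
    Finset.sum_eq_zero fun j _ ↦ by rw [hl, mul_zero]
  have h4 : ∀ i, ∑ j, (fw k j : ℂ) * (bil (sr i) (sr j) : ℂ) = if i = k then 1 else 0 := fun i ↦ by
    have : bil (sr i) (fw k) = ∑ j, fw k j * bil (sr i) (sr j) := by
      rw [bil_comm, bil_eq_sum]
      exact Finset.sum_congr rfl fun j _ ↦ by rw [bil_comm]
    rw [bil_comm, bil_fw, show sr i k = if k = i then 1 else 0 from Pi.single_apply ..] at this
    have h5 : ((if k = i then 1 else 0 : ℤ) : ℂ) = _ := congrArg (fun z : ℤ ↦ (z : ℂ)) this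
    push_cast at h5
    rw [← h5]
    simp only [eq_comm]
  simp only [Finset.mul_sum] at h3
  rw [Finset.sum_comm] at h3
  have h6 : ∀ i, ∑ j, (fw k j : ℂ) * (basis.repr x (Sum.inl i) * (bil (sr i) (sr j) : ℂ)) =
      if i = k then basis.repr x (Sum.inl i) else 0 := fun i ↦ by
    rw [show (if i = k then basis.repr x (Sum.inl i) else 0) =
      basis.repr x (Sum.inl i) * if i = k then 1 else 0 by simp, ← h4, Finset.mul_sum]
    exact Finset.sum_congr rfl fun j _ ↦ by ring
  simp only [h6, Finset.sum_ite_eq', Finset.mem_univ, if_true] at h3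
  rw [h3, zero_smul]

lemma mem_G_neg {c : Q} {k : ℤ} {x : L} : x ∈ G L (-c) k ↔ x ∈ G L c (-k) := by
  rw [mem_G, mem_G, map_neg, neg_lie, neg_eq_iff_eq_neg, Int.cast_neg, neg_smul]

/-- An `sl₂`-triple with semisimple element the coroot `H c`. -/
structure Triple (c : Q) (e f : L) : Prop where
  he : e ∈ G L c 2
  hf : f ∈ G L c (-2)
  hef : ⁅e, f⁆ = H c

namespace Triple

variable {c : Q} {e f : L}

lemma symm (T : Triple c e f) : Triple (-c) f e where
  he := mem_G_neg.2 T.hf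
  hf := mem_G_neg.2 (by simpa using T.he)
  hef := by rw [← lie_skew, T.hef, map_neg]

lemma isSl2Triple (T : Triple c e f) (h0 : (H c : L) ≠ 0) : IsSl2Triple (H c : L) e f where
  h_ne_zero := h0
  lie_e_f := T.hef
  lie_h_e_nsmul := by rw [T.he]; norm_num [two_smul]
  lie_h_f_nsmul := by rw [T.hf]; norm_num [two_smul]

lemma nonneg_of_lie_eq_zero (T : Triple c e f) {k : ℤ} {x : L} (hx : x ∈ G L c k) (hx0 : x ≠ 0)
    (h : ⁅e, x⁆ = 0) : 0 ≤ k := by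
  have : FiniteDimensional ℂ L := finiteDimensional_of_chevalleyBasis
  by_cases h0 : (H c : L) = 0
  · rw [mem_G, h0, zero_lie, eq_comm] at hx
    have := (smul_eq_zero.1 hx).resolve_right hx0
    exact (by exact_mod_cast this : k = 0).ge
  · have P : (T.isSl2Triple h0).HasPrimitiveVectorWith x (k : ℂ) := ⟨hx0, hx, h⟩
    obtain ⟨n, hn⟩ := P.exists_nat
    have : k = n := by exact_mod_cast hn
    omega

lemma eq_zero_of_lie (T : Triple c e f) {k : ℤ} (hk : k < 0) {x : L} (hx : x ∈ G L c k)
    (h : ⁅e, x⁆ = 0) : x = 0 := by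
  by_contra h0
  exact absurd (T.nonneg_of_lie_eq_zero hx h0 h) (by omega)

lemma eq_zero_of_lie' (T : Triple c e f) {k : ℤ} (hk : 0 < k) {x : L} (hx : x ∈ G L c k)
    (h : ⁅f, x⁆ = 0) : x = 0 :=
  T.symm.eq_zero_of_lie (k := -k) (by omega) (mem_G_neg.2 (by simpa using hx)) h

/-- `ad e` as a map between homogeneous parts. -/
noncomputable def adG {c : Q} {j : ℤ} {e : L} (he : e ∈ G L c j) (k : ℤ) : G L c k →ₗ[ℂ] G L c (k + j) :=
  (LieAlgebra.ad ℂ L e : L →ₗ[ℂ] L).restrict fun x hx ↦ by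
    rw [add_comm]; exact lie_mem_G he hx

lemma coe_adG {j : ℤ} (he : e ∈ G L c j) (k : ℤ) (x : G L c k) : (adG he k x : L) = ⁅e, (x : L)⁆ := rfl

lemma surjective (T : Triple c e f) {k : ℤ} (hk : -1 ≤ k) {z : L} (hz : z ∈ G L c (k + 2)) :
    ∃ x ∈ G L c k, ⁅e, x⁆ = z := by
  have : FiniteDimensional ℂ L := finiteDimensional_of_chevalleyBasis
  have key : LinearMap.range (adG T.he k) = ⊤ := by
    by_contra hne
    obtain ⟨φ, hφ, hle⟩ := Submodule.exists_le_ker_of_lt_top _ (lt_top_iff_ne_top.2 hne)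
    let B : G L c (-(k + 2)) →ₗ[ℂ] Module.Dual ℂ (G L c (k + 2)) :=
      ((κ).domRestrict₁₂ (G L c (-(k + 2))) (G L c (k + 2)))
    have hB : Function.Surjective B := by
      let B' : G L c (k + 2) →ₗ[ℂ] Module.Dual ℂ (G L c (-(k + 2))) :=
        ((κ).domRestrict₁₂ (G L c (k + 2)) (G L c (-(k + 2))))
      have i1 : Function.Injective B := by
        rw [injective_iff_map_eq_zero]
        intro x hx
        refine Subtype.ext (kil_nondeg x.2 fun y hy ↦ ?_)
        rw [neg_neg] at hy
        exact LinearMap.congr_fun hx ⟨y, hy⟩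
      have i2 : Function.Injective B' := by
        rw [injective_iff_map_eq_zero]
        intro x hx
        exact Subtype.ext (kil_nondeg x.2 fun y hy ↦ LinearMap.congr_fun hx ⟨y, hy⟩)
      have d1 := LinearMap.finrank_le_finrank_of_injective i1
      have d2 := LinearMap.finrank_le_finrank_of_injective i2
      rw [Subspace.dual_finrank_eq] at d1 d2
      refine (LinearMap.injective_iff_surjective_of_finrank_eq_finrank ?_).1 i1
      rw [Subspace.dual_finrank_eq]
      omega
    obtain ⟨w, rfl⟩ := hB φ
    refine hφ ?_
    have : (w : L) = 0 := by
      refine T.eq_zero_of_lie (by omega) w.2 (kil_nondeg (c := c) (k := -k) ?_ fun y hy ↦ ?_)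
      · have := lie_mem_G T.he w.2
        rwa [show 2 + -(k + 2) = -k by ring] at this
      · rw [neg_neg] at hy
        rw [← neg_eq_zero, ← kil_lie']
        exact LinearMap.mem_ker.1 (hle (LinearMap.mem_range_self (adG T.he k) ⟨y, hy⟩))
    rw [Subtype.ext (a1 := w) (a2 := 0) this, map_zero]
  have : (⟨z, hz⟩ : G L c (k + 2)) ∈ LinearMap.range (adG T.he k) := key ▸ Submodule.mem_top
  obtain ⟨x, hx⟩ := this
  exact ⟨x, x.2, congrArg Subtype.val hx⟩

end Triple

end

end E8

namespace E8

open ChevalleyBasis Module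

section

variable {L : Type*} [LieRing L] [LieAlgebra ℂ L]

/-- The centralizer of `e`. -/
def cent (e : L) : Submodule ℂ L := LinearMap.ker (LieAlgebra.ad ℂ L e : L →ₗ[ℂ] L)

lemma mem_cent {e x : L} : x ∈ cent e ↔ ⁅e, x⁆ = 0 := Iff.rfl

/-- The derived algebra of the centralizer of `e`. -/
def der (e : L) : Submodule ℂ L :=
  Submodule.span ℂ {z | ∃ x ∈ cent e, ∃ y ∈ cent e, ⁅x, y⁆ = z}

lemma lie_mem_der {e x y : L} (hx : ⁅e, x⁆ = 0) (hy : ⁅e, y⁆ = 0) : ⁅x, y⁆ ∈ der e :=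
  Submodule.subset_span ⟨x, hx, y, hy, rfl⟩

lemma even_finrank_of_alternating {V : Type*} [AddCommGroup V] [Module ℂ V] [FiniteDimensional ℂ V]
    (B : LinearMap.BilinForm ℂ V) (hB : ∀ x y, B y x = -B x y)
    (hn : ∀ x, (∀ y, B x y = 0) → x = 0) : Even (finrank ℂ V) := by
  let b := finBasis ℂ V
  have h1 : B.Nondegenerate := by
    refine ⟨fun x hx ↦ hn x hx, fun x hx ↦ hn x fun y ↦ ?_⟩
    rw [← neg_eq_zero, ← hB]
    exact hx y
  have h2 := (LinearMap.BilinForm.nondegenerate_iff_det_ne_zero b).1 h1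
  set M := LinearMap.BilinForm.toMatrix b B
  have h3 : M.transpose = -M := by
    ext i j
    simp [M, LinearMap.BilinForm.toMatrix_apply, hB (b i) (b j)]
  have h4 := congrArg Matrix.det h3
  rw [Matrix.det_transpose, Matrix.det_neg, Fintype.card_fin] at h4
  by_contra ho
  rw [(Nat.not_even_iff_odd.1 ho).neg_one_pow] at h4
  exact h2 (by linear_combination h4 / 2)

variable [ChevalleyBasis L]

local notation "κ" => killingForm ℂ L

namespace Triple

variable {c : Q} {e f : L} (T : Triple c e f)

include T in
lemma kil_e_f_ne (hc : c ≠ 0) : κ f e ≠ 0 := by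
  obtain ⟨i, hi⟩ := exists_bil_sr_ne hc
  intro h0
  have h1 := kil_lie (H c) e f
  rw [T.hef, T.he, map_smul, LinearMap.smul_apply, kil_comm e f, h0, smul_zero] at h1
  exact kil_H_self_ne (isRoot_sr i) (by rwa [bil_comm]) h1.symm

include T in
lemma lie_f_eq_zero {x : L} (hx : x ∈ G L c 0) (h : ⁅e, x⁆ = 0) : ⁅f, x⁆ = 0 := by
  refine T.eq_zero_of_lie (k := -2) (by norm_num) (by simpa using lie_mem_G T.hf hx) ?_
  have h0 : ⁅(H c : L), x⁆ = 0 := by rw [mem_G.1 hx]; simp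
  rw [leibniz_lie, T.hef, h0, h, lie_zero, add_zero]

include T in
lemma finrank_le {k : ℤ} (hk : -1 ≤ k) : finrank ℂ (G L c (k + 2)) ≤ finrank ℂ (G L c k) := by
  have : FiniteDimensional ℂ L := finiteDimensional_of_chevalleyBasis
  refine LinearMap.finrank_le_finrank_of_surjective (f := adG T.he k) fun z ↦ ?_
  obtain ⟨x, hx, h⟩ := T.surjective hk z.2
  exact ⟨⟨x, hx⟩, Subtype.ext h⟩

include T in
lemma finrank_ker {k : ℤ} (hk : -1 ≤ k) :
    finrank ℂ ↥(G L c k ⊓ cent e) + finrank ℂ (G L c (k + 2)) = finrank ℂ (G L c k) := by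
  have : FiniteDimensional ℂ L := finiteDimensional_of_chevalleyBasis
  have h1 : LinearMap.range (adG T.he k) = ⊤ := LinearMap.range_eq_top.2 fun z ↦ by
    obtain ⟨x, hx, h⟩ := T.surjective hk z.2
    exact ⟨⟨x, hx⟩, Subtype.ext h⟩
  have h2 := LinearMap.finrank_range_add_finrank_ker (adG T.he k)
  rw [h1, finrank_top] at h2
  have h3 : LinearMap.ker (adG T.he k) = (cent e).comap (G L c k).subtype := by
    ext x
    simp [mem_cent, Subtype.ext_iff, coe_adG]
  have h4 : finrank ℂ (LinearMap.ker (adG T.he k)) = finrank ℂ ↥(G L c k ⊓ cent e) := by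
    rw [h3, ← Submodule.map_comap_subtype]
    exact (LinearEquiv.finrank_eq (Submodule.equivSubtypeMap _ _)).trans rfl
  omega

include T in
lemma lie_e_pow (m : ℕ) {k : ℤ} {x : L} (hx : x ∈ G L c k) :
    ⁅e, (LieModule.toEnd ℂ L L f ^ (m + 1)) x⁆ = (LieModule.toEnd ℂ L L f ^ (m + 1)) ⁅e, x⁆ +
      ((m + 1) * (k - m) : ℂ) • (LieModule.toEnd ℂ L L f ^ m) x := by
  have hm : ∀ m : ℕ, (LieModule.toEnd ℂ L L f ^ m) x ∈ G L c (k - 2 * m) := fun m ↦ by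
    induction m with
    | zero => simpa using hx
    | succ m ih =>
      rw [pow_succ', Module.End.mul_apply, LieModule.toEnd_apply_apply]
      convert lie_mem_G T.hf ih using 2
      push_cast; ring
  induction m with
  | zero =>
    simp only [zero_add, pow_one, LieModule.toEnd_apply_apply, pow_zero, Module.End.one_apply]
    rw [leibniz_lie, T.hef, mem_G.1 hx, add_comm]
    simp
  | succ m ih =>
    rw [pow_succ', Module.End.mul_apply, LieModule.toEnd_apply_apply, leibniz_lie, T.hef, ih,
      mem_G.1 (hm (m + 1)), lie_add, lie_smul, ← LieModule.toEnd_apply_apply ℂ L L f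
        ((LieModule.toEnd ℂ L L f ^ m) x), ← Module.End.mul_apply, ← pow_succ',
      Module.End.mul_apply, LieModule.toEnd_apply_apply, add_comm, add_assoc, ← add_smul]
    congr 2
    push_cast
    ring

include T in
lemma pow_ne_zero (n : ℕ) {x : L} (hx : x ∈ G L c n)
    (h : (LieModule.toEnd ℂ L L f ^ n) x = 0) : x = 0 := by
  have : FiniteDimensional ℂ L := finiteDimensional_of_chevalleyBasis
  rcases Nat.eq_zero_or_pos n with rfl | hn
  · simpa using h
  obtain ⟨N, hN⟩ : ∃ N : ℤ, ∀ k, N < k → G L c k = ⊥ := by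
    obtain ⟨N, hN⟩ := (degs c).bddAbove
    refine ⟨N, fun k hk ↦ (Submodule.eq_bot_iff _).2 fun x hx ↦ ?_⟩
    rw [← sum_proj c x]
    refine Finset.sum_eq_zero fun j hj ↦ proj_of_ne ?_ hx
    have := hN hj
    omega
  induction hd : (N + 1 - n).toNat using Nat.strong_induction_on generalizing n x with
  | _ d ih =>
    by_cases hk : N < n
    · have := hN _ hk ▸ hx
      simpa using this
    have he : ⁅e, x⁆ = 0 := by
      have h2 : ⁅e, x⁆ ∈ G L c ((n + 2 : ℕ) : ℤ) := by
        have := lie_mem_G T.he hx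
        rwa [add_comm] at this
      refine ih _ (by omega) (n + 2) h2 ?_ (by omega) rfl
      have h1 := T.lie_e_pow n hx
      rw [pow_succ', Module.End.mul_apply, h] at h1
      simp only [map_zero, lie_zero, Int.cast_natCast, sub_self, mul_zero, zero_smul,
        add_zero] at h1
      rw [pow_succ', Module.End.mul_apply, pow_succ', ← h1, map_zero]
    by_contra h0
    have hH : (H c : L) ≠ 0 := fun h' ↦ by
      rw [mem_G, h', zero_lie, eq_comm] at hx
      have := (smul_eq_zero.1 hx).resolve_right h0
      have : n = 0 := by exact_mod_cast this
      omega
    have P : (T.isSl2Triple hH).HasPrimitiveVectorWith x (n : ℂ) := ⟨h0, by rw [mem_G.1 hx]; simp, he⟩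
    exact P.pow_toEnd_f_ne_zero_of_eq_nat rfl le_rfl h

include T in
lemma even_finrank {n : ℕ} (hn : Odd n) : Even (finrank ℂ (G L c n)) := by
  have : FiniteDimensional ℂ L := finiteDimensional_of_chevalleyBasis
  have hk : ∀ m (x y : L), κ ((LieModule.toEnd ℂ L L f ^ m) x) y =
      (-1) ^ m * κ x ((LieModule.toEnd ℂ L L f ^ m) y) := fun m ↦ by
    induction m with
    | zero => simp
    | succ m ih =>
      intro x y
      rw [pow_succ', Module.End.mul_apply, LieModule.toEnd_apply_apply, ← neg_inj, ← kil_lie', ih,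
        ← LieModule.toEnd_apply_apply ℂ L L f y, ← Module.End.mul_apply, ← pow_succ,
        ← pow_succ', pow_succ (-1 : ℂ)]
      ring
  let B : LinearMap.BilinForm ℂ (G L c n) :=
    LinearMap.mk₂ ℂ (fun x y ↦ κ ((LieModule.toEnd ℂ L L f ^ n) (x : L)) y)
      (by simp) (by simp) (by simp) (by simp)
  refine even_finrank_of_alternating B (fun x y ↦ ?_) fun x hx ↦ ?_
  · change κ _ _ = -κ _ _
    rw [hk, hn.neg_one_pow, neg_one_mul, kil_comm]
  · refine Subtype.ext (T.pow_ne_zero n x.2 (kil_nondeg (c := c) (k := -n) ?_ fun y hy ↦ ?_))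
    · have : ∀ m : ℕ, (LieModule.toEnd ℂ L L f ^ m) (x : L) ∈ G L c (n - 2 * m) := fun m ↦ by
        induction m with
        | zero => simp
        | succ m ih =>
          rw [pow_succ', Module.End.mul_apply, LieModule.toEnd_apply_apply]
          convert lie_mem_G T.hf ih using 2
          push_cast; ring
      convert this n using 2
      ring
    · rw [neg_neg] at hy
      exact hx ⟨y, hy⟩

include T in
lemma map_eq_zero_of_mem_der (l : L →ₗ[ℂ] ℂ)
    (h02 : ∀ x ∈ G L c 0 ⊓ cent e, ∀ y ∈ G L c 2 ⊓ cent e, l ⁅x, y⁆ = 0)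
    (h11 : ∀ x ∈ G L c 1 ⊓ cent e, ∀ y ∈ G L c 1 ⊓ cent e, l ⁅x, y⁆ = 0)
    (hr : e ∈ der e) : l e = 0 := by
  rw [← proj_of_mem T.he]
  suffices der e ≤ LinearMap.ker (l ∘ₗ proj c 2) from this hr
  rw [der, Submodule.span_le]
  rintro _ ⟨x, hx, y, hy, rfl⟩
  change l (proj c 2 ⁅x, y⁆) = 0
  have hp : ∀ k {x : L}, x ∈ cent e → proj c k x ∈ G L c k ⊓ cent e := fun k x hx ↦
    ⟨proj_mem _ _ _, lie_proj_eq_zero T.he k hx⟩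
  have hn : ∀ k {x : L}, x ∈ cent e → k < 0 → proj c k x = 0 := fun k x hx hk ↦
    T.eq_zero_of_lie hk (proj_mem _ _ _) (hp k hx).2
  rw [← sum_proj c x, sum_lie, map_sum, map_sum]
  refine Finset.sum_eq_zero fun j _ ↦ ?_
  rw [show (2 : ℤ) = j + (2 - j) by ring, proj_lie (proj_mem _ _ _)]
  rcases lt_trichotomy j 1 with hj | rfl | hj
  · rcases lt_or_ge j 0 with hj' | hj'
    · rw [hn j hx hj', zero_lie, map_zero]
    · obtain rfl : j = 0 := by omega
      exact h02 _ (hp _ hx) _ (hp 2 hy)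
  · exact h11 _ (hp _ hx) _ (hp 1 hy)
  · rcases lt_or_ge 2 j with hj' | hj'
    · rw [hn (2 - j) hy (by omega), lie_zero, map_zero]
    · obtain rfl : j = 2 := by omega
      rw [← lie_skew, map_neg, sub_self, h02 _ (hp 0 hy) _ (hp _ hx), neg_zero]

include T in
lemma finrank_lt_of_mem_der (hc : c ≠ 0) (hr : e ∈ der e) :
    finrank ℂ (G L c 3) < finrank ℂ (G L c 1) := by
  by_contra hle
  have : FiniteDimensional ℂ L := finiteDimensional_of_chevalleyBasis
  have h1 := T.finrank_ker (k := 1) (by norm_num)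
  rw [show (1 : ℤ) + 2 = 3 by norm_num] at h1
  have h2 : G L c 1 ⊓ cent e = ⊥ := Submodule.finrank_eq_zero.1 (by omega)
  refine T.kil_e_f_ne hc (T.map_eq_zero_of_mem_der (κ f) (fun x hx y _ ↦ ?_) (fun x hx y _ ↦ ?_) hr)
  · rw [← kil_lie, T.lie_f_eq_zero hx.1 hx.2, map_zero, LinearMap.zero_apply]
  · rw [h2, Submodule.mem_bot] at hx
    rw [hx, zero_lie, map_zero]

include T in
lemma finrank_lt (hc : c ≠ 0) : finrank ℂ (G L c 4) < finrank ℂ (G L c 2) := by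
  have : FiniteDimensional ℂ L := finiteDimensional_of_chevalleyBasis
  have h1 := T.finrank_ker (k := 2) (by norm_num)
  rw [show (2 : ℤ) + 2 = 4 by norm_num] at h1
  have h2 : G L c 2 ⊓ cent e ≠ ⊥ := fun h ↦ by
    have h3 : e ∈ G L c 2 ⊓ cent e := ⟨T.he, lie_self e⟩
    rw [h, Submodule.mem_bot] at h3
    exact T.kil_e_f_ne hc (by rw [h3, map_zero])
  have := Submodule.one_le_finrank_iff.2 h2
  omega

end Triple

end

end E8

namespace E8

open Module

section

variable {L : Type*} [LieRing L] [LieAlgebra ℂ L]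

lemma lie_toEnd_pow {h u : L} {μ : ℂ} (hu : ⁅h, u⁆ = μ • u) (n : ℕ) (y : L) :
    ⁅h, (LieModule.toEnd ℂ L L u ^ n) y⁆ =
      (LieModule.toEnd ℂ L L u ^ n) ⁅h, y⁆ + (n * μ) • (LieModule.toEnd ℂ L L u ^ n) y := by
  induction n with
  | zero => simp
  | succ n ih =>
    rw [pow_succ', Module.End.mul_apply, LieModule.toEnd_apply_apply, leibniz_lie, hu, ih,
      Module.End.mul_apply, LieModule.toEnd_apply_apply, lie_add, lie_smul, smul_lie]
    push_cast
    module

variable [FiniteDimensional ℂ L]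

lemma false_of_eigenvectors {h : L} {a b : ℂ} (hb : b ≠ 0) (N : ℕ) (z : ℕ → L)
    (hz : ∀ n ≥ N, z n ≠ 0 ∧ ⁅h, z n⁆ = (a + n * b) • z n) : False := by
  have h1 : (Set.range fun n : ℕ ↦ a + (N + n : ℕ) * b).Infinite :=
    Set.infinite_range_of_injective fun m n hmn ↦ by
      have := mul_right_cancel₀ hb (add_left_cancel hmn)
      exact add_left_cancel (by exact_mod_cast this : N + m = N + n)
  refine h1 ((Module.End.finite_hasEigenvalue (LieModule.toEnd ℂ L L h)).subset ?_)
  rintro _ ⟨n, rfl⟩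
  obtain ⟨h2, h3⟩ := hz (N + n) (by omega)
  exact Module.End.hasEigenvalue_of_hasEigenvector ⟨Module.End.mem_eigenspace_iff.2 h3, h2⟩

variable {h e f : L}

lemma primitive_semisimple (t : IsSl2Triple h e f) (n : ℕ) {p : L} (hp : ⁅e, p⁆ = 0)
    (hq : ⁅h, ⁅h, p⁆ - (n : ℂ) • p⁆ = (n : ℂ) • (⁅h, p⁆ - (n : ℂ) • p)) :
    ⁅h, p⁆ = (n : ℂ) • p := by
  have hf : ⁅h, f⁆ = (-2 : ℂ) • f := by rw [t.lie_lie_smul_f ℂ, neg_smul]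
  have he : ⁅h, e⁆ = (2 : ℂ) • e := t.lie_h_e_smul ℂ
  rw [← sub_eq_zero]
  set q := ⁅h, p⁆ - (n : ℂ) • p with hqd
  have hhp : ⁅h, p⁆ = (n : ℂ) • p + q := by rw [hqd]; abel
  by_contra hq0
  have heq : ⁅e, q⁆ = 0 := by
    rw [hqd, lie_sub, lie_smul, hp, smul_zero, sub_zero, leibniz_lie, hp, lie_zero, add_zero,
      ← lie_skew e h, he, neg_lie, smul_lie, hp, smul_zero, neg_zero]
  have P : t.HasPrimitiveVectorWith q (n : ℂ) := ⟨hq0, hq, heq⟩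
  have hF : ∀ m, (LieModule.toEnd ℂ L L f ^ m) ⁅h, p⁆ =
      (n : ℂ) • (LieModule.toEnd ℂ L L f ^ m) p + (LieModule.toEnd ℂ L L f ^ m) q := fun m ↦ by
    rw [hhp, map_add, map_smul]
  have hE : ∀ m : ℕ, ⁅e, (LieModule.toEnd ℂ L L f ^ (m + 1)) p⁆ =
      ((m + 1) * (n - m) : ℂ) • (LieModule.toEnd ℂ L L f ^ m) p +
        (m + 1 : ℂ) • (LieModule.toEnd ℂ L L f ^ m) q := fun m ↦ by
    induction m with
    | zero =>
      simp only [zero_add, pow_one, LieModule.toEnd_apply_apply, pow_zero, Module.End.one_apply]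
      rw [leibniz_lie, t.lie_e_f, hp, hhp]
      simp
    | succ m ih =>
      rw [pow_succ', Module.End.mul_apply, LieModule.toEnd_apply_apply, leibniz_lie, t.lie_e_f, ih,
        lie_toEnd_pow hf, hF, lie_add, lie_smul, lie_smul, pow_succ' _ m, Module.End.mul_apply,
        Module.End.mul_apply, LieModule.toEnd_apply_apply, LieModule.toEnd_apply_apply]
      push_cast
      module
  have hqn : ∀ m, (LieModule.toEnd ℂ L L f ^ (n + 1 + m)) q = 0 := fun m ↦ by
    rw [add_comm, pow_add, Module.End.mul_apply, P.pow_toEnd_f_eq_zero_of_eq_nat rfl, map_zero]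
  have hne : ∀ m, (LieModule.toEnd ℂ L L f ^ (n + 1 + m)) p ≠ 0 := fun m ↦ by
    induction m with
    | zero =>
      intro h0
      have h1 := hE n
      rw [add_zero] at h0
      rw [h0, lie_zero, sub_self, mul_zero, zero_smul, zero_add, eq_comm, smul_eq_zero] at h1
      exact P.pow_toEnd_f_ne_zero_of_eq_nat rfl le_rfl
        (h1.resolve_left (by exact_mod_cast n.succ_ne_zero))
    | succ m ih =>
      intro h0
      have h1 := hE (n + 1 + m)
      rw [show n + 1 + m + 1 = n + 1 + (m + 1) by ring, h0, lie_zero, hqn, smul_zero, add_zero,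
        eq_comm, smul_eq_zero] at h1
      refine mul_ne_zero ?_ ?_ (h1.resolve_right ih)
      · exact_mod_cast (n + 1 + m).succ_ne_zero
      · rw [sub_ne_zero]
        exact_mod_cast (by omega : n ≠ n + 1 + m)
  refine false_of_eigenvectors (h := h) (a := n) (b := -2) (by norm_num) (n + 1)
    (fun m ↦ (LieModule.toEnd ℂ L L f ^ m) p) fun m hm ↦ ?_
  obtain ⟨k, rfl⟩ := Nat.exists_eq_add_of_le hm
  refine ⟨hne k, ?_⟩
  rw [lie_toEnd_pow hf, hF, hqn, add_zero, ← add_smul]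

/-- The semisimple element of an `sl₂`-triple acts semisimply on its null space. -/
lemma lie_eq_zero_of_lie_lie (t : IsSl2Triple h e f) {x : L} (hx : ⁅h, ⁅h, x⁆⁆ = 0) :
    ⁅h, x⁆ = 0 := by
  have he : ⁅h, e⁆ = (2 : ℂ) • e := t.lie_h_e_smul ℂ
  have key : ∀ n : ℕ, ∀ x : L, ⁅h, ⁅h, x⁆⁆ = 0 → (LieModule.toEnd ℂ L L e ^ n) x = 0 →
      ⁅h, x⁆ = 0 := fun n ↦ by
    induction n with
    | zero => intro x _ h0; rw [show x = 0 by simpa using h0, lie_zero]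
    | succ n ih =>
      intro x hx h0
      set p := (LieModule.toEnd ℂ L L e ^ n) x with hp
      have hep : ⁅e, p⁆ = 0 := by
        rwa [pow_succ', Module.End.mul_apply, LieModule.toEnd_apply_apply, ← hp] at h0
      have hhp : ⁅h, p⁆ - ((2 * n : ℕ) : ℂ) • p = (LieModule.toEnd ℂ L L e ^ n) ⁅h, x⁆ := by
        rw [hp, lie_toEnd_pow he]
        push_cast
        module
      have h1 : ⁅h, p⁆ = ((2 * n : ℕ) : ℂ) • p := by
        refine primitive_semisimple t (2 * n) hep ?_
        rw [hhp, lie_toEnd_pow he, hx, map_zero]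
        push_cast
        module
      by_cases hp0 : p = 0
      · exact ih x hx hp0
      have P : t.HasPrimitiveVectorWith p ((2 * n : ℕ) : ℂ) := ⟨hp0, h1, hep⟩
      have hf : ⁅h, f⁆ = (-2 : ℂ) • f := by rw [t.lie_lie_smul_f ℂ, neg_smul]
      have hE : ∀ m ≤ n, ∃ c : ℂ, c ≠ 0 ∧
          (LieModule.toEnd ℂ L L e ^ m) ((LieModule.toEnd ℂ L L f ^ m) p) = c • p := fun m ↦ by
        induction m with
        | zero => exact fun _ ↦ ⟨1, one_ne_zero, by simp⟩
        | succ m ihm =>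
          intro hm
          obtain ⟨c, hc, h2⟩ := ihm (by omega)
          refine ⟨(m + 1) * ((2 * n : ℕ) - m) * c, mul_ne_zero (mul_ne_zero ?_ ?_) hc, ?_⟩
          · exact_mod_cast m.succ_ne_zero
          · rw [sub_ne_zero]
            exact_mod_cast (by omega : 2 * n ≠ m)
          · rw [pow_succ, Module.End.mul_apply, LieModule.toEnd_apply_apply,
              P.lie_e_pow_succ_toEnd_f, map_smul, h2, smul_smul]
      obtain ⟨c, hc, h2⟩ := hE n le_rfl
      have h3 : ⁅h, (LieModule.toEnd ℂ L L f ^ n) p⁆ = 0 := by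
        rw [lie_toEnd_pow hf, h1, map_smul]
        push_cast
        module
      have h4 := ih (x - c⁻¹ • (LieModule.toEnd ℂ L L f ^ n) p)
        (by rw [lie_sub, lie_smul, h3, smul_zero, sub_zero, hx])
        (by rw [map_sub, map_smul, h2, smul_smul, inv_mul_cancel₀ hc, one_smul, sub_self])
      rwa [lie_sub, lie_smul, h3, smul_zero, sub_zero] at h4
  classical
  by_contra hhx
  have hne : ∀ n, (LieModule.toEnd ℂ L L e ^ n) ⁅h, x⁆ ≠ 0 ∨
      (LieModule.toEnd ℂ L L e ^ n) x ≠ 0 := fun n ↦ .inr fun h0 ↦ hhx (key n x hx h0)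
  refine false_of_eigenvectors (h := h) (a := 0) (b := 2) two_ne_zero 0
    (fun n ↦ if (LieModule.toEnd ℂ L L e ^ n) ⁅h, x⁆ = 0 then (LieModule.toEnd ℂ L L e ^ n) x
      else (LieModule.toEnd ℂ L L e ^ n) ⁅h, x⁆) fun n _ ↦ ?_
  split_ifs with h0
  · refine ⟨(hne n).resolve_left (not_not.2 h0), ?_⟩
    rw [lie_toEnd_pow he, h0, zero_add, zero_add]
  · refine ⟨h0, ?_⟩
    rw [lie_toEnd_pow he, hx, map_zero, zero_add, zero_add]

end

end E8

namespace E8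

open Module LieAlgebra LieSubalgebra Filter Topology

section

variable {L : Type*} [LieRing L] [LieAlgebra ℂ L]

lemma mem_engel_map (φ : L ≃ₗ⁅ℂ⁆ L) {x z : L} : φ z ∈ engel ℂ (φ x) ↔ z ∈ engel ℂ x := by
  have h : ∀ n : ℕ, (ad ℂ L (φ x) ^ n) (φ z) = φ ((ad ℂ L x ^ n) z) := fun n ↦ by
    induction n with
    | zero => rfl
    | succ n ih =>
      rw [pow_succ', pow_succ', Module.End.mul_apply, ih, Module.End.mul_apply, ad_apply, ad_apply,
        LieEquiv.map_lie]
  rw [mem_engel_iff, mem_engel_iff]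
  simp only [h, EmbeddingLike.map_eq_zero_iff]

/-- Engel subalgebras of `x` and `y` are conjugate. -/
def EngelConj (x y : L) : Prop := ∃ φ : L ≃ₗ⁅ℂ⁆ L, ∀ z, φ z ∈ engel ℂ y ↔ z ∈ engel ℂ x

lemma EngelConj.symm {x y : L} : EngelConj x y → EngelConj y x := fun ⟨φ, h⟩ ↦
  ⟨φ.symm, fun z ↦ by rw [← h, LieEquiv.apply_symm_apply]⟩

lemma EngelConj.trans {x y z : L} : EngelConj x y → EngelConj y z → EngelConj x z :=
  fun ⟨φ, h⟩ ⟨ψ, h'⟩ ↦ ⟨φ.trans ψ, fun z ↦ by rw [LieEquiv.trans_apply, h', h]⟩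

lemma finrank_engel_map (φ : L ≃ₗ⁅ℂ⁆ L) (x : L) :
    finrank ℂ (engel ℂ (φ x)) = finrank ℂ (engel ℂ x) := by
  have : (engel ℂ (φ x)).toSubmodule = (engel ℂ x).toSubmodule.map (φ.toLinearEquiv : L →ₗ[ℂ] L) := by
    ext y
    obtain ⟨y, rfl⟩ : ∃ z, φ z = y := ⟨φ.symm y, φ.apply_symm_apply y⟩
    rw [LieSubalgebra.mem_toSubmodule, mem_engel_map]
    refine ⟨fun h ↦ ⟨y, h, rfl⟩, ?_⟩
    rintro ⟨z, hz, h⟩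
    rwa [← φ.injective h]
  change finrank ℂ (engel ℂ (φ x)).toSubmodule = finrank ℂ (engel ℂ x).toSubmodule
  rw [this, LinearEquiv.finrank_map_eq]

variable [FiniteDimensional ℂ L]

lemma exists_lie_add_engel (x w : L) : ∃ a ∈ (⊤ : Submodule ℂ L), ∃ s ∈ (engel ℂ x).toSubmodule,
    ⁅a, x⁆ + s = w := by
  have h := (LinearMap.isCompl_iSup_ker_pow_iInf_range_pow (ad ℂ L x : L →ₗ[ℂ] L)).sup_eq_top
  obtain ⟨s, hs, y, hy, rfl⟩ := Submodule.mem_sup.1 (h ▸ Submodule.mem_top : w ∈ _)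
  obtain ⟨a, rfl⟩ := (Submodule.mem_iInf _).1 hy 1
  refine ⟨-a, trivial, s, ?_, ?_⟩
  · obtain ⟨n, hn⟩ := (Submodule.mem_iSup_of_directed _
      (LinearMap.iterateKer (ad ℂ L x : L →ₗ[ℂ] L)).monotone.directed_le).1 hs
    exact (mem_engel_iff ℂ x s).2 ⟨n, hn⟩
  · rw [pow_one, neg_lie, lie_skew, add_comm]
    rfl

lemma isRegular_map (φ : L ≃ₗ⁅ℂ⁆ L) {x : L} : IsRegular ℂ (φ x) ↔ IsRegular ℂ x := by
  rw [isRegular_iff_finrank_engel_eq_rank, isRegular_iff_finrank_engel_eq_rank, finrank_engel_map]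

lemma engel_eq_of_isRegular {x y : L} (hx : IsRegular ℂ x) (hy : IsRegular ℂ y)
    (hyx : y ∈ engel ℂ x) : engel ℂ y = engel ℂ x := by
  rw [isRegular_iff_finrank_engel_eq_rank] at hx hy
  have hle : ∀ z w : L, engel ℂ z ≤ engel ℂ w → finrank ℂ (engel ℂ w) = rank ℂ L →
      engel ℂ z = engel ℂ w := fun z w h hw ↦ by
    refine LieSubalgebra.toSubmodule_injective (Submodule.eq_of_le_of_finrank_le h ?_)
    exact hw.trans_le (rank_le_finrank_engel ℂ z)
  have key := engel_isBot_of_isMin (K := ℂ) (L := L)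
    ((Cardinal.natCast_le_aleph0).trans (Cardinal.aleph0_le_mk ℂ)) (engel ℂ x)
    ⟨engel ℂ x, x, self_mem_engel ℂ x, rfl⟩ le_rfl ?_
  · exact (hle x y (key ⟨engel ℂ y, y, hyx, rfl⟩) hy).symm
  · rintro ⟨_, z, hz, rfl⟩ h
    exact (hle z x h hx).ge

lemma finite_not_isRegular (x v : L) (h : ∃ t : ℂ, IsRegular ℂ (x + t • v)) :
    {t : ℂ | ¬ IsRegular ℂ (x + t • v)}.Finite := by
  classical
  let b := finBasis ℂ L
  let P := (LinearMap.polyCharpoly (ad ℂ L : L →ₗ[ℂ] Module.End ℂ L) b).coeff (rank ℂ L)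
  let p : Polynomial ℂ := MvPolynomial.aeval
    (fun i ↦ Polynomial.C (b.repr x i) + Polynomial.X * Polynomial.C (b.repr v i)) P
  have hp : ∀ t, p.eval t = MvPolynomial.eval (b.repr (x + t • v)) P := fun t ↦ by
    change Polynomial.eval t (MvPolynomial.aeval _ P) = _
    rw [← Polynomial.coe_evalRingHom, MvPolynomial.aeval_def, MvPolynomial.hom_eval₂]
    rw [MvPolynomial.eval, MvPolynomial.coe_eval₂Hom]
    congr 1
    · ext; simp
    · ext i; simp; ring
  have hr : ∀ t, IsRegular ℂ (x + t • v) ↔ p.eval t ≠ 0 := fun t ↦ by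
    rw [hp]; exact isRegular_iff_coeff_polyCharpoly_rank_ne_zero ℂ b _
  obtain ⟨t, ht⟩ := h
  have hp0 : p ≠ 0 := fun h ↦ by simp [hr, h] at ht
  refine p.roots.toFinset.finite_toSet.subset fun s hs ↦ ?_
  have : p.eval s = 0 := by simpa [hr] using hs
  simpa [hp0] using this

lemma engelConj_of_isRegular {x y : L} (hx : IsRegular ℂ x) (hy : IsRegular ℂ y) :
    EngelConj x y := by
  have hF := finite_not_isRegular x (y - x) ⟨0, by simpa⟩
  have key := rel_of_eventually hF (fun s t ↦ EngelConj (x + s • (y - x)) (x + t • (y - x)))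
    EngelConj.symm EngelConj.trans ?_ (x := 0) (y := 1) (by simpa using hx) (by simpa using hy)
  · simpa using key
  · intro t ht
    have h1 := exists_isExp ⊤ (engel ℂ (x + t • (y - x))).toSubmodule ⊤
      (s₀ := x + t • (y - x)) (v := y - x) trivial le_top (fun _ _ _ _ ↦ trivial)
      (fun w _ ↦ exists_lie_add_engel _ w) trivial
    have h2 : Tendsto (fun s : ℂ ↦ s - t) (𝓝 t) (𝓝 0) := by
      have : Continuous fun s : ℂ ↦ s - t := by fun_prop
      simpa using this.tendsto t
    filter_upwards [h2.eventually h1, hF.isClosed.isOpen_compl.mem_nhds ht] with s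
    rintro ⟨-, -, φ, -, u, hu, hφ⟩ hs
    rw [add_assoc x _ ((s - t) • _), ← add_smul, add_sub_cancel] at hφ
    have hs' : IsRegular ℂ (x + s • (y - x)) := not_not.1 hs
    rw [← hφ, isRegular_map] at hs'
    refine ⟨φ, fun z ↦ ?_⟩
    rw [← hφ, mem_engel_map, engel_eq_of_isRegular (not_not.1 ht) hs']
    exact add_mem (self_mem_engel ℂ _) hu

lemma exists_isRegular_add (x : L) : ∃ s ∈ engel ℂ x, IsRegular ℂ (x + s) := by
  obtain ⟨y, hy⟩ := LieAlgebra.exists_isRegular ℂ L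
  have hF := finite_not_isRegular x (y - x) ⟨1, by simpa using hy⟩
  have h1 := exists_isExp ⊤ (engel ℂ x).toSubmodule ⊤
      (s₀ := x) (v := y - x) trivial le_top (fun _ _ _ _ ↦ trivial)
      (fun w _ ↦ exists_lie_add_engel _ w) trivial
  have h2 : ∀ᶠ t : ℂ in 𝓝[≠] 0, IsRegular ℂ (x + t • (y - x)) := by
    have := (hF.sdiff (t := {0})).isClosed.isOpen_compl.mem_nhds (x := 0) (by simp)
    filter_upwards [nhdsWithin_le_nhds this, self_mem_nhdsWithin] with t ht ht0
    by_contra h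
    exact ht ⟨h, ht0⟩
  obtain ⟨t, ⟨-, -, φ, -, s, hs, hφ⟩, ht⟩ := ((h1.filter_mono nhdsWithin_le_nhds).and h2).exists
  exact ⟨s, hs, by rwa [← hφ, isRegular_map] at ht⟩

lemma exists_map_mem_engel {h e f x : L} (t : IsSl2Triple h e f) (hx : IsRegular ℂ x) :
    ∃ φ : L ≃ₗ⁅ℂ⁆ L, φ h ∈ engel ℂ x := by
  obtain ⟨s, hs, hr⟩ := exists_isRegular_add h
  obtain ⟨φ, hφ⟩ := engelConj_of_isRegular hr hx
  refine ⟨φ, (hφ _).2 ?_⟩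
  have hs' : ⁅h, s⁆ = 0 := by
    obtain ⟨n, hn⟩ := (mem_engel_iff ℂ h s).1 hs
    clear hr hφ
    induction n with
    | zero => rw [show s = 0 by simpa using hn, lie_zero]
    | succ n ih =>
      rcases n with _ | n
      · simpa using hn
      · refine ih ?_
        rw [pow_succ', Module.End.mul_apply, ad_apply]
        rw [pow_succ', Module.End.mul_apply, pow_succ', Module.End.mul_apply, ad_apply,
          ad_apply] at hn
        exact lie_eq_zero_of_lie_lie t hn
  refine (mem_engel_iff ℂ _ _).2 ⟨1, ?_⟩
  rw [pow_one, ad_apply, add_lie, lie_self, zero_add, ← lie_skew, hs', neg_zero]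

end

section

open ChevalleyBasis

variable {L : Type*} [LieRing L] [LieAlgebra ℂ L] [ChevalleyBasis L]

lemma lie_eq_zero_of_mem_G_sep {x y : L} (hx : x ∈ G L sep 0) (hy : y ∈ G L sep 0) :
    ⁅x, y⁆ = 0 := by
  have : ∀ x ∈ G L sep 0, x ∈ Submodule.span ℂ (Set.range fun i ↦ (H (sr i) : L)) := fun x hx ↦ by
    rw [G_eq_span] at hx
    refine Submodule.span_mono ?_ hx
    rintro _ ⟨⟨i | ⟨a, ha⟩, hi⟩, rfl⟩
    · exact ⟨i, basis_inl i |>.symm⟩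
    · exact absurd hi (bil_sep_ne_zero ha)
  have h1 := this x hx
  have h2 := this y hy
  clear hx hy
  induction h1, h2 using Submodule.span_induction₂ with
  | mem_mem x y hx hy =>
    obtain ⟨i, rfl⟩ := hx
    obtain ⟨j, rfl⟩ := hy
    exact lie_H_H _ _
  | zero_left => rw [zero_lie]
  | zero_right => rw [lie_zero]
  | add_left x y z _ _ _ h1 h2 => rw [add_lie, h1, h2, add_zero]
  | add_right x y z _ _ _ h1 h2 => rw [lie_add, h1, h2, add_zero]
  | smul_left r x y _ _ h => rw [smul_lie, h, smul_zero]
  | smul_right r x y _ _ h => rw [lie_smul, h, smul_zero]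

lemma engel_H (c : Q) : (engel ℂ (H c : L)).toSubmodule = G L c 0 := by
  ext x
  rw [LieSubalgebra.mem_toSubmodule, mem_engel_iff]
  constructor
  · rintro ⟨n, hn⟩
    refine mem_of_proj_mem c _ fun k ↦ ?_
    rcases eq_or_ne k 0 with rfl | hk
    · exact proj_mem _ _ _
    have h1 : ∀ n : ℕ, ((ad ℂ L (H c : L)) ^ n) (proj c k x) = ((k : ℂ) ^ n) • proj c k x := fun n ↦ by
      induction n with
      | zero => simp
      | succ n ih =>
        rw [pow_succ', Module.End.mul_apply, ih, map_smul, ad_apply, proj_mem c k x, smul_smul,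
          pow_succ]
    have h2 : ∀ n : ℕ, ((ad ℂ L (H c : L)) ^ n) (proj c k x) =
        proj c k (((ad ℂ L (H c : L)) ^ n) x) := fun n ↦ by
      induction n with
      | zero => simp
      | succ n ih =>
        rw [pow_succ', Module.End.mul_apply, ih, Module.End.mul_apply, ad_apply, ad_apply,
          proj_lie_H]
    have h3 := h1 n
    rw [h2, hn, map_zero, eq_comm] at h3
    rw [(smul_eq_zero.1 h3).resolve_left (pow_ne_zero _ (by exact_mod_cast hk))]
    exact zero_mem _
  · exact fun h ↦ ⟨1, by rw [pow_one, ad_apply, mem_G.1 h]; simp⟩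

lemma isRegular_H_sep [FiniteDimensional ℂ L] : LieAlgebra.IsRegular ℂ (H sep : L) := by
  obtain ⟨s, hs, hr⟩ := exists_isRegular_add (H sep : L)
  rw [isRegular_iff_finrank_engel_eq_rank] at hr ⊢
  refine le_antisymm ?_ (rank_le_finrank_engel ℂ _)
  rw [← hr]
  refine Submodule.finrank_mono fun x hx ↦ ?_
  rw [engel_H] at hx
  have hs' : s ∈ G L sep 0 := engel_H (L := L) sep ▸ hs
  refine (mem_engel_iff ℂ _ _).2 ⟨1, ?_⟩
  rw [pow_one, ad_apply, lie_eq_zero_of_mem_G_sep (add_mem (H_mem_G _ _) hs') hx]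

/-- The semisimple element of an `sl₂`-triple is conjugate into the split Cartan subalgebra. -/
lemma exists_map_mem_G_sep {h e f : L} (t : IsSl2Triple h e f) :
    ∃ φ : L ≃ₗ⁅ℂ⁆ L, φ h ∈ G L sep 0 := by
  have : FiniteDimensional ℂ L := finiteDimensional_of_chevalleyBasis
  obtain ⟨φ, hφ⟩ := exists_map_mem_engel t (isRegular_H_sep (L := L))
  exact ⟨φ, engel_H (L := L) sep ▸ hφ⟩

end

end E8

namespace E8

open ChevalleyBasis

variable {L : Type*} [LieRing L] [LieAlgebra ℂ L]

lemma exists_int_eigenvalue [FiniteDimensional ℂ L] {h e f v : L} {μ : ℂ} (t : IsSl2Triple h e f)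
    (hv : v ≠ 0) (hμ : ⁅h, v⁆ = μ • v) : ∃ n : ℤ, μ = n := by
  have he : ⁅h, e⁆ = (2 : ℂ) • e := t.lie_h_e_smul ℂ
  have h1 : ∀ n : ℕ, ⁅h, (LieModule.toEnd ℂ L L e ^ n) v⁆ =
      (μ + n * 2) • (LieModule.toEnd ℂ L L e ^ n) v := fun n ↦ by
    rw [lie_toEnd_pow he, hμ, map_smul, add_smul]
  have h2 : ∃ n : ℕ, (LieModule.toEnd ℂ L L e ^ n) v = 0 := by
    by_contra! h
    exact false_of_eigenvectors two_ne_zero 0 _ fun n _ ↦ ⟨h n, h1 n⟩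
  obtain ⟨n, hn, hn'⟩ := Nat.exists_not_and_succ_of_not_zero_of_exists (by simpa using hv) h2
  have P : t.HasPrimitiveVectorWith ((LieModule.toEnd ℂ L L e ^ n) v) (μ + n * 2) :=
    ⟨hn, h1 n, by rwa [pow_succ', Module.End.mul_apply] at hn'⟩
  obtain ⟨k, hk⟩ := P.exists_nat
  exact ⟨k - n * 2, by push_cast; rw [← hk]; ring⟩

variable [ChevalleyBasis L]

lemma mem_G_sep {x : L} (hx : x ∈ G L sep 0) : ∃ z : Fin 8 → ℂ, x = ∑ i, z i • (H (sr i) : L) := by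
  rw [G_eq_span] at hx
  have h1 : x ∈ Submodule.span ℂ (Set.range fun i ↦ (H (sr i) : L)) := by
    refine Submodule.span_mono ?_ hx
    rintro _ ⟨⟨i | ⟨a, ha⟩, hi⟩, rfl⟩
    · exact ⟨i, (basis_inl i).symm⟩
    · exact absurd hi (bil_sep_ne_zero ha)
  obtain ⟨z, hz⟩ := (Submodule.mem_span_range_iff_exists_fun ℂ).1 h1
  exact ⟨z, hz.symm⟩

lemma lie_eq_H {h : L} (hh : h ∈ G L sep 0) (hz : ∀ i, ∃ n : ℤ, ⁅h, (R (sr i) : L)⁆ = (n : ℂ) • R (sr i)) :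
    ∃ c : Q, h = H c := by
  obtain ⟨z, rfl⟩ := mem_G_sep hh
  choose n hn using hz
  have h0 : ∀ i, (R (sr i) : L) ≠ 0 := fun i ↦ by
    rw [← basis_inr ⟨_, isRoot_sr i⟩]; exact basis.ne_zero _
  have h1 : ∀ i, ∑ j, z j * bil (sr j) (sr i) = n i := fun i ↦ by
    have := hn i
    simp only [sum_lie, smul_lie, lie_H_R _ (isRoot_sr _), smul_smul,
      ← Finset.sum_smul] at this
    exact smul_left_injective ℂ (h0 i) this
  refine ⟨fun k ↦ ∑ i, fw k i * n i, ?_⟩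
  rw [H_eq_sum]
  refine Finset.sum_congr rfl fun k _ ↦ ?_
  congr 1
  have h2 : ∀ j, ∑ i, fw k i * bil (sr j) (sr i) = if k = j then 1 else 0 := fun j ↦ by
    have h3 := bil_fw k (sr j)
    rw [bil_eq_sum] at h3
    simp only [bil_comm (sr j), h3]
    simp only [sr, Pi.single_apply]
  calc z k = ∑ j, z j * ((∑ i, fw k i * bil (sr j) (sr i) : ℤ) : ℂ) := by simp [h2]
    _ = ∑ i, fw k i * ∑ j, z j * bil (sr j) (sr i) := by
      push_cast
      simp only [Finset.mul_sum]
      rw [Finset.sum_comm]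
      exact Finset.sum_congr rfl fun _ _ ↦ Finset.sum_congr rfl fun _ _ ↦ by ring
    _ = _ := by push_cast; simp only [h1]

/-- The semisimple element of an `sl₂`-triple is conjugate to an element of the root lattice. -/
lemma exists_map_eq_H {h e f : L} (t : IsSl2Triple h e f) :
    ∃ φ : L ≃ₗ⁅ℂ⁆ L, ∃ c : Q, φ h = H c := by
  have : FiniteDimensional ℂ L := finiteDimensional_of_chevalleyBasis
  obtain ⟨φ, hφ⟩ := exists_map_mem_G_sep t
  have hI : ∀ i : Fin 8, ∃ n : ℤ, ⁅φ h, (R (sr i) : L)⁆ = (n : ℂ) • R (sr i) := fun i ↦ by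
    obtain ⟨z, hz⟩ := mem_G_sep hφ
    have h1 : ⁅φ h, (R (sr i) : L)⁆ = (∑ j, z j * bil (sr j) (sr i)) • R (sr i) := by
      simp only [hz, sum_lie, smul_lie, lie_H_R _ (isRoot_sr _), smul_smul, ← Finset.sum_smul]
    have h0 : φ.symm (R (sr i) : L) ≠ 0 := by
      rw [Ne, EmbeddingLike.map_eq_zero_iff, ← basis_inr ⟨_, isRoot_sr i⟩]
      exact basis.ne_zero _
    obtain ⟨n, hn⟩ := exists_int_eigenvalue t h0 (μ := ∑ j, z j * bil (sr j) (sr i)) (by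
      apply φ.injective
      change φ ⁅h, φ.symm (R (sr i))⁆ = φ (_ • φ.symm (R (sr i)))
      rw [LieEquiv.map_lie, LieEquiv.apply_symm_apply, h1, map_smul, LieEquiv.apply_symm_apply])
    exact ⟨n, by rw [h1, hn]⟩
  obtain ⟨c, hc⟩ := lie_eq_H hφ hI
  exact ⟨φ, c, hc⟩

/-- The automorphism of `L` inducing the reflection in a root. -/
lemma exists_reflection {a : Q} (ha : IsRoot a) :
    ∃ φ : L ≃ₗ⁅ℂ⁆ L, ∀ c, φ (H c) = H (c - bil c a • a) := by
  have : FiniteDimensional ℂ L := finiteDimensional_of_chevalleyBasis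
  have hR : ∀ {b : Q}, IsRoot b → ∀ c, ⁅(R b : L), (H c : L)⁆ = -((bil c b : ℂ) • R b) :=
    fun hb c ↦ by rw [← lie_skew, lie_H_R _ hb]
  have hna := ha.neg
  have haa : bil a a = 2 := ha
  have hE : ∀ c, expAut (R a : L) (H c) = H c - (bil c a : ℂ) • R a := fun c ↦ by
    rw [isExp_expAut _ _ (by simp [hR ha])]
    simp [hR ha, sub_eq_add_neg]
  have hF : ∀ c, expAut (R (-a) : L) (H c) = H c + (bil c a : ℂ) • R (-a) := fun c ↦ by
    rw [isExp_expAut _ _ (by simp [hR hna])]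
    simp [hR hna, bil_neg_right]
  have hfe : ⁅(R (-a) : L), (R a : L)⁆ = H a := by
    rw [← lie_skew, lie_R_R_neg ha, neg_neg]
  have hFe : expAut (R (-a) : L) (R a) = R a + H a + R (-a) := by
    rw [isExp_expAut _ _ (by simp [hfe, hR hna])]
    rw [hfe, hR hna, bil_neg_right, haa]
    push_cast
    module
  have hEf : expAut (R a : L) (R (-a)) = R (-a) - H a + R a := by
    rw [isExp_expAut _ _ (by simp [lie_R_R_neg ha, hR ha])]
    rw [lie_R_R_neg ha, lie_neg, hR ha, haa]
    push_cast
    module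
  refine ⟨((expAut (R a : L)).trans (expAut (R (-a) : L))).trans (expAut (R a : L)), fun c ↦ ?_⟩
  have hEe : expAut (R a : L) (R a) = R a := (isExp_expAut _).fix (lie_self _)
  simp only [LieEquiv.trans_apply, hE, map_sub, map_smul, hF, hFe, map_add, hEf, hEe, map_zsmul, haa]
  rw [← Int.cast_smul_eq_zsmul ℂ]
  push_cast
  module

lemma exists_dominant (c : Q) : ∃ φ : L ≃ₗ⁅ℂ⁆ L, ∃ d : Q, φ (H c) = H d ∧ ∀ i, 0 ≤ bil d (sr i) := by
  let P : ℤ → Prop := fun n ↦ ∃ φ : L ≃ₗ⁅ℂ⁆ L, ∃ d : Q, φ (H c) = H d ∧ bil d d = bil c c ∧ ht d = n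
  let r : Q := ∑ i, fw i
  have hr : ∀ d, ht d = bil r d := fun d ↦ by
    simp only [r, ht, Fin.sum_univ_eight, bil_add_left, bil_fw]
  have hb : ∀ n, P n → n ≤ bil r r * bil c c + 1 := by
    rintro n ⟨φ, d, -, hd, rfl⟩
    rw [hr]
    rcases (bil_self_nonneg d).eq_or_lt with h0 | h0
    · rw [eq_zero_of_bil_self _ h0.symm, ← hd, ← h0, mul_zero]
      simp [bil]
    · have := bil_sq_le r d h0
      rw [hd] at this
      nlinarith [sq_nonneg (bil r d - 1)]
  obtain ⟨n, ⟨φ, d, h1, h2, h3⟩, hmax⟩ :=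
    Int.exists_greatest_of_bdd ⟨_, hb⟩ ⟨_, LieEquiv.refl, c, rfl, rfl, rfl⟩
  refine ⟨φ, d, h1, fun i ↦ ?_⟩
  obtain ⟨ψ, hψ⟩ := exists_reflection (L := L) (isRoot_sr i)
  have := hmax (ht (d - bil d (sr i) • sr i)) ⟨φ.trans ψ, _, by rw [LieEquiv.trans_apply, h1, hψ], ?_, rfl⟩
  · rw [ht_sub, h3] at this
    have h4 : ht (bil d (sr i) • sr i) = bil d (sr i) := by
      rw [hr, bil_smul_right, ← hr, ht_sr, mul_one]
    omega
  · have := bil_comm d (sr i)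
    simp only [bil_sub_left, bil_sub_right, bil_smul_left, bil_smul_right, h2, bil_sr_self]
    rw [this]; ring

end E8

namespace E8

open ChevalleyBasis Module Filter Topology

section

variable {L : Type*} [LieRing L] [LieAlgebra ℂ L]

/-- The centralizer of `h` and `e`. -/
def gz (h e : L) : Submodule ℂ L := cent e ⊓ cent h

/-- The span of the brackets of elements of `S`. -/
def brk (S : Submodule ℂ L) : Submodule ℂ L :=
  Submodule.span ℂ {z | ∃ x ∈ S, ∃ y ∈ S, ⁅x, y⁆ = z}

lemma brk_mono {S T : Submodule ℂ L} (h : S ≤ T) : brk S ≤ brk T :=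
  Submodule.span_mono fun _ ⟨x, hx, y, hy, hz⟩ ↦ ⟨x, h hx, y, h hy, hz⟩

lemma map_mem_brk {S T : Submodule ℂ L} (φ : L ≃ₗ⁅ℂ⁆ L) (hφ : ∀ x ∈ S, φ x ∈ T) {x : L}
    (hx : x ∈ brk S) : φ x ∈ brk T := by
  induction hx using Submodule.span_induction with
  | mem z hz =>
    obtain ⟨x, hx, y, hy, rfl⟩ := hz
    exact Submodule.subset_span ⟨_, hφ x hx, _, hφ y hy, (φ.map_lie x y).symm⟩
  | zero => rw [map_zero]; exact zero_mem _
  | add x y _ _ hx hy => rw [map_add]; exact add_mem hx hy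
  | smul r x _ hx => rw [map_smul]; exact Submodule.smul_mem _ r hx

lemma map_mem_cent (φ : L ≃ₗ⁅ℂ⁆ L) {e x : L} (hx : x ∈ cent e) : φ x ∈ cent (φ e) := by
  rw [mem_cent] at *
  rw [← LieEquiv.map_lie, hx, map_zero]

/-- A reachable nilpotent element `e` in an `sl₂`-triple whose reductive centralizer is perfect. -/
structure Reach (h e f : L) : Prop where
  lie_he : ⁅h, e⁆ = (2 : ℂ) • e
  lie_hf : ⁅h, f⁆ = (-2 : ℂ) • f
  lie_ef : ⁅e, f⁆ = h
  mem_der : e ∈ der e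
  gz_le : gz h e ≤ brk (gz h e)

lemma Reach.map (φ : L ≃ₗ⁅ℂ⁆ L) {h e f : L} (T : Reach h e f) : Reach (φ h) (φ e) (φ f) where
  lie_he := by rw [← LieEquiv.map_lie, T.lie_he, map_smul]
  lie_hf := by rw [← LieEquiv.map_lie, T.lie_hf, map_smul]
  lie_ef := by rw [← LieEquiv.map_lie, T.lie_ef]
  mem_der := map_mem_brk φ (fun _ ↦ map_mem_cent φ) T.mem_der
  gz_le := fun x hx ↦ by
    have h1 : φ.symm x ∈ gz h e := by
      have h2 := map_mem_cent φ.symm hx.1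
      have h3 := map_mem_cent φ.symm hx.2
      rw [LieEquiv.symm_apply_apply] at h2 h3
      exact ⟨h2, h3⟩
    rw [← φ.apply_symm_apply x]
    exact map_mem_brk (S := gz h e) (T := gz (φ h) (φ e)) φ (fun y hy ↦ ⟨map_mem_cent φ hy.1, map_mem_cent φ hy.2⟩) (T.gz_le h1)

lemma cent_le_der_of_map (φ : L ≃ₗ⁅ℂ⁆ L) {e : L} (h : cent (φ e) ≤ der (φ e)) :
    cent e ≤ der e := fun x hx ↦ by
  have h1 := map_mem_brk (T := cent e) φ.symm (fun y hy ↦ by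
    have := map_mem_cent φ.symm hy
    rwa [LieEquiv.symm_apply_apply] at this) (h (map_mem_cent φ hx))
  rwa [LieEquiv.symm_apply_apply] at h1

end

section

variable {L : Type*} [LieRing L] [LieAlgebra ℂ L] [ChevalleyBasis L] {c : Q} {e f : L}

local notation "κ" => killingForm ℂ L

lemma G_le {k : ℤ} (W : Submodule ℂ L) (hH : k = 0 → ∀ a, H a ∈ W)
    (hR : ∀ a, IsRoot a → bil c a = k → R a ∈ W) : G L c k ≤ W := by
  rw [G_eq_span, Submodule.span_le]
  rintro _ ⟨⟨i | ⟨a, ha⟩, hi⟩, rfl⟩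
  · change basis (Sum.inl i) ∈ W
    rw [basis_inl]
    exact hH hi.symm _
  · change basis (Sum.inr ⟨a, ha⟩) ∈ W
    rw [basis_inr]
    exact hR a ha hi

lemma Reach.triple (T : Reach (H c) e f) : Triple c e f where
  he := by rw [mem_G, T.lie_he]; norm_num
  hf := by rw [mem_G, T.lie_hf]; norm_num
  hef := T.lie_ef

lemma gz_H (c : Q) (e : L) : gz (H c) e = G L c 0 ⊓ cent e := by
  ext x
  simp only [gz, Submodule.mem_inf, mem_G, mem_cent, Int.cast_zero, zero_smul]
  exact and_comm

lemma ht_pos_of_bil_pos {a : Q} (hc : ∀ i, 0 ≤ bil c (sr i)) (ha : IsRoot a) (h : 0 < bil c a) :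
    0 ≤ a := by
  refine ha.nonneg_or.resolve_right fun h0 ↦ h.not_ge ?_
  rw [bil_comm, bil_eq_sum]
  exact Finset.sum_nonpos fun i _ ↦ mul_nonpos_of_nonpos_of_nonneg (h0 i) (bil_comm c _ ▸ hc i)

lemma bil_sr_le_two (hc : ∀ i, 0 ≤ bil c (sr i)) (T : Triple c e f) (i : Fin 8) :
    bil c (sr i) ≤ 2 := by
  by_contra! hi
  have hR : (R (sr i) : L) ∈ G L c (bil c (sr i)) := R_mem_G c (isRoot_sr i)
  have h1 : ∀ y ∈ G L c (-2), ⁅y, (R (sr i) : L)⁆ = 0 := fun y hy ↦ by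
    rw [← lie_skew, neg_eq_zero]
    revert y
    change _ ≤ cent (R (sr i) : L)
    refine G_le _ (by norm_num) fun b hb hcb ↦ ?_
    rw [mem_cent, ← lie_skew, neg_eq_zero]
    obtain h | h | h : 0 ≤ bil b (sr i) ∨ bil b (sr i) = -1 ∨ bil b (sr i) = -2 := by
      have := (hb.bil_bounds (isRoot_sr i)).1
      omega
    · refine lie_R_R_zero hb (isRoot_sr i) h
    · exfalso
      have h2 := ht_pos_of_bil_pos hc (hb.add (isRoot_sr i) h) (by rw [bil_add_right]; omega)
      have h3 := ht_pos_of_bil_pos hc hb.neg (by rw [bil_neg_right]; omega)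
      have h4 := ht_pos h2 (hb.add (isRoot_sr i) h).ne_zero
      have h5 := ht_pos h3 hb.neg.ne_zero
      rw [ht_add, ht_sr] at h4
      rw [ht_neg] at h5
      omega
    · exfalso
      rw [hb.eq_neg_of_bil (isRoot_sr i) h, bil_neg_right] at hcb
      omega
  have := T.eq_zero_of_lie' (by omega) hR (h1 f T.hf)
  rw [← basis_inr ⟨_, isRoot_sr i⟩] at this
  exact basis.ne_zero _ this

lemma kil_fw_ne (hc : ∀ i, 0 ≤ bil c (sr i)) {i : Fin 8} (hi : bil c (sr i) ≠ 0) :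
    κ (H (fw i)) (H c) ≠ 0 := by
  have hnn : ∀ a : Q, 0 ≤ a → 0 ≤ bil c a := fun a ha ↦ by
    rw [bil_comm, bil_eq_sum]
    exact Finset.sum_nonneg fun i _ ↦ mul_nonneg (ha i) (bil_comm c _ ▸ hc i)
  rw [kil_H_H]
  have : 0 < ∑ j : Idx, deg (fw i) j * deg c j := by
    refine Finset.sum_pos' (fun j _ ↦ ?_) ⟨Sum.inr ⟨sr i, isRoot_sr i⟩, Finset.mem_univ _, ?_⟩
    · rcases j with j | ⟨a, ha⟩
      · exact le_rfl
      · change 0 ≤ bil (fw i) a * bil c a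
        rw [bil_fw]
        rcases ha.nonneg_or with h | h
        · exact mul_nonneg (h i) (hnn a h)
        · refine mul_nonneg_of_nonpos_of_nonpos (h i) ?_
          have := hnn (-a) (neg_nonneg.2 h)
          rw [bil_neg_right] at this
          omega
    · change 0 < bil (fw i) (sr i) * bil c (sr i)
      have := hc i
      rw [bil_fw, show sr i i = 1 from Pi.single_eq_same i 1]
      omega
  exact_mod_cast this.ne'

lemma bil_sr_ne_two (hc : ∀ i, 0 ≤ bil c (sr i)) (T : Reach (H c) e f) (i : Fin 8) :
    bil c (sr i) ≠ 2 := fun hi ↦ by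
  have D := T.triple
  have hω : ∀ k : ℤ, -1 ≤ k → k ≤ 1 → ∀ x ∈ G L c k, ⁅(H (fw i) : L), x⁆ = 0 := fun k h1 h2 ↦ by
    change _ ≤ cent (H (fw i) : L)
    have hpos : ∀ a, 0 ≤ a → bil c a ≤ 1 → a i = 0 := fun a ha h ↦ by
      have h3 : a i * bil (sr i) c ≤ bil a c := by
        rw [bil_eq_sum (a := a)]
        exact Finset.single_le_sum (f := fun j ↦ a j * bil (sr j) c)
          (fun j _ ↦ mul_nonneg (ha j) (bil_comm c _ ▸ hc j)) (Finset.mem_univ i)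
      rw [bil_comm, hi, bil_comm] at h3
      have : 0 ≤ a i := ha i
      omega
    refine G_le _ (fun _ a ↦ lie_H_H _ _) fun a ha hk ↦ ?_
    rw [mem_cent, lie_H_R _ ha, bil_fw]
    rcases ha.nonneg_or with h | h
    · rw [hpos a h (by omega)]; simp
    · have := hpos (-a) (neg_nonneg.2 h) (by rw [bil_neg_right]; omega)
      rw [Pi.neg_apply, neg_eq_zero] at this
      rw [this]; simp
  have hl : ∀ x y : L, ⁅(H (fw i) : L), x⁆ = 0 → ⁅(H (fw i) : L), ⁅f, x⁆⁆ = 0 →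
      κ ⁅(H (fw i) : L), f⁆ ⁅x, y⁆ = 0 := fun x y h1 h2 ↦ by
    rw [kil_lie, leibniz_lie, map_add, ← kil_lie, h2, ← kil_lie, h1]
    simp
  have key := D.map_eq_zero_of_mem_der (κ ⁅(H (fw i) : L), f⁆)
    (fun x hx y _ ↦ hl x y (hω 0 (by norm_num) (by norm_num) x hx.1)
      (by rw [D.lie_f_eq_zero hx.1 hx.2, lie_zero]))
    (fun x hx y _ ↦ hl x y (hω 1 (by norm_num) (by norm_num) x hx.1)
      (hω (-1) (by norm_num) (by norm_num) _ (by simpa using lie_mem_G D.hf hx.1)))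
    T.mem_der
  rw [kil_lie, ← lie_skew, T.lie_ef, map_neg, neg_eq_zero] at key
  exact kil_fw_ne hc (by omega) key

lemma bil_sr_zero_or_one (hc : ∀ i, 0 ≤ bil c (sr i)) (T : Reach (H c) e f) (i : Fin 8) :
    bil c (sr i) = 0 ∨ bil c (sr i) = 1 := by
  have := bil_sr_le_two hc T.triple i
  have := bil_sr_ne_two hc T i
  have := hc i
  omega

/-- Two elements of degree two lying in the open orbit are conjugate. -/
lemma exists_map_eq {e' : L} (he : e ∈ G L c 2) (he' : e' ∈ G L c 2)
    (hs : ∀ z ∈ G L c 2, ∃ x ∈ G L c 0, ⁅e, x⁆ = z) (hs' : ∀ z ∈ G L c 2, ∃ x ∈ G L c 0, ⁅e', x⁆ = z) :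
    ∃ φ : L ≃ₗ⁅ℂ⁆ L, φ e = e' ∧ φ (H c) = H c := by
  have : FiniteDimensional ℂ L := finiteDimensional_of_chevalleyBasis
  have hm : ∀ t : ℂ, e + t • (e' - e) ∈ G L c 2 := fun t ↦
    add_mem he (Submodule.smul_mem _ _ (sub_mem he' he))
  let F : Set ℂ := {t | ¬ ∀ z ∈ G L c 2, ∃ x ∈ G L c 0, ⁅e + t • (e' - e), x⁆ = z}
  have hF : F.Finite := by
    refine (finite_not_surjective (Triple.adG he 0) (Triple.adG (sub_mem he' he) 0) ?_).subset fun t ht h ↦ ht ?_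
    · intro z
      obtain ⟨x, hx, h⟩ := hs z.1 z.2
      exact ⟨⟨x, hx⟩, Subtype.ext h⟩
    · intro z hz
      obtain ⟨x, hx⟩ := h ⟨z, hz⟩
      refine ⟨x, x.2, ?_⟩
      have := congrArg Subtype.val hx
      rw [add_lie, smul_lie]
      exact this
  have key := rel_of_eventually hF (fun s t ↦ ∃ φ : L ≃ₗ⁅ℂ⁆ L,
    φ (e + s • (e' - e)) = e + t • (e' - e) ∧ φ (H c) = H c) ?_ ?_ ?_ (x := 0) (y := 1) ?_ ?_
  · simpa using key
  · rintro s t ⟨φ, h1, h2⟩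
    exact ⟨φ.symm, by rw [← h1, LieEquiv.symm_apply_apply],
      by conv_lhs => rw [← h2, LieEquiv.symm_apply_apply]⟩
  · rintro s t u ⟨φ, h1, h2⟩ ⟨ψ, h3, h4⟩
    exact ⟨φ.trans ψ, by rw [LieEquiv.trans_apply, h1, h3], by rw [LieEquiv.trans_apply, h2, h4]⟩
  · intro t ht
    have h1 := exists_isExp (G L c 0) ⊥ (G L c 2) (s₀ := e + t • (e' - e)) (v := e' - e)
      (hm t) bot_le (fun a ha w hw ↦ by simpa using lie_mem_G ha hw)
      (fun w hw ↦ by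
        obtain ⟨x, hx, h⟩ := not_not.1 ht w hw
        exact ⟨-x, neg_mem hx, 0, zero_mem _, by rw [neg_lie, lie_skew, h, add_zero]⟩)
      (sub_mem he' he)
    have h2 : Tendsto (fun s : ℂ ↦ s - t) (𝓝 t) (𝓝 0) := by
      have : Continuous fun s : ℂ ↦ s - t := by fun_prop
      simpa using this.tendsto t
    filter_upwards [h2.eventually h1] with s
    rintro ⟨a, ha, φ, hexp, u, hu, hφ⟩
    rw [(Submodule.mem_bot ℂ).1 hu, add_zero, add_assoc, ← add_smul, add_sub_cancel] at hφ
    refine ⟨φ, hφ, hexp.fix ?_⟩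
    rw [← lie_skew, mem_G.1 ha]
    simp
  · exact not_not.2 (by simpa using hs)
  · exact not_not.2 (by simpa using hs')

/-- Replacing `e` by a standard representative of the open orbit in degree two. -/
lemma Reach.exists_reach {e' : L} (T : Reach (H c) e f) (he' : e' ∈ G L c 2)
    (hs' : ∀ z ∈ G L c 2, ∃ x ∈ G L c 0, ⁅e', x⁆ = z) :
    (∃ f', Reach (H c) e' f') ∧ (cent e' ≤ der e' → cent e ≤ der e) := by
  obtain ⟨φ, h1, h2⟩ := exists_map_eq T.triple.he he'
    (fun z hz ↦ T.triple.surjective (by norm_num) (by simpa using hz)) hs'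
  refine ⟨⟨φ f, ?_⟩, fun h ↦ cent_le_der_of_map φ (by rwa [h1])⟩
  have := T.map φ
  rwa [h1, h2] at this

end

end E8

namespace E8

/-- Residues modulo sixteen. -/
def res (z : ℤ) : ℕ := (z % 16).toNat

/-- The integer in `[-8, 7]` with a given residue modulo sixteen. -/
def sgnd (d : ℕ) : ℤ := bif Nat.blt d 8 then Int.ofNat d else Int.negSucc (Nat.sub 15 d)

lemma res_lt (z : ℤ) : res z < 16 := by unfold res; omega

lemma res_cast (z : ℤ) : (res z : ℤ) = z % 16 := by unfold res; omega

lemma res_add (y z : ℤ) : res (y + z) = (res y + res z) % 16 := by unfold res; omega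

lemma sgnd_res {z : ℤ} (h : -8 ≤ z) (h' : z ≤ 7) : sgnd (res z) = z := by
  have h1 := res_cast z
  have h2 := res_lt z
  unfold sgnd
  rcases lt_or_ge (res z) 8 with h3 | h3
  · rw [show Nat.blt (res z) 8 = true by rwa [Nat.blt_eq], cond_true, Int.ofNat_eq_natCast]
    omega
  · rw [show Nat.blt (res z) 8 = false by
      rw [← Bool.not_eq_true, Nat.blt_eq]; omega, cond_false, Int.negSucc_eq,
      Nat.sub_eq]
    omega

/-- Numbers with given digits in base 2048. -/
def pack (l : List ℕ) : ℕ := l.foldr (fun x n ↦ x + 2048 * n) 0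

lemma pack_add (l l' : List ℕ) (h : l.length = l'.length) :
    pack l + pack l' = pack (List.zipWith (· + ·) l l') := by
  induction l generalizing l' with
  | nil => simp_all [pack, List.length_eq_zero_iff.1 h.symm]
  | cons x l ih =>
    obtain _ | ⟨y, l'⟩ := l'
    · simp at h
    · have := ih l' (by simpa using h)
      simp only [pack, List.zipWith_cons_cons, List.foldr_cons] at this ⊢
      omega

lemma pack_append (l l' : List ℕ) : pack (l ++ l') = pack l + 2048 ^ l.length * pack l' := by
  induction l with
  | nil => simp [pack]
  | cons x l ih =>
    simp only [pack, List.cons_append, List.foldr_cons, List.length_cons] at ih ⊢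
    rw [ih]
    ring

lemma pack_land (l : List ℕ) (h : ∀ x ∈ l, x < 2048) :
    pack l &&& pack (List.replicate l.length 15) = pack (l.map (· % 16)) := by
  have key : ∀ x y z : ℕ, x < 2048 → (x + 2048 * y) &&& (15 + 2048 * z) = x % 16 + 2048 * (y &&& z) := by
    intro x y z hx
    have h16 : x % 16 < 2 ^ 11 := by omega
    refine Nat.eq_of_testBit_eq fun j ↦ ?_
    rw [add_comm x, add_comm 15, add_comm (x % 16), Nat.testBit_and, show 2048 = 2 ^ 11 from rfl,
      Nat.testBit_two_pow_mul_add _ hx, Nat.testBit_two_pow_mul_add _ (by norm_num : 15 < 2 ^ 11),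
      Nat.testBit_two_pow_mul_add _ h16]
    split_ifs
    · rw [← Nat.testBit_and, show (15 : ℕ) = 2 ^ 4 - 1 from rfl, Nat.and_two_pow_sub_one_eq_mod]
    · rw [Nat.testBit_and]
  induction l with
  | nil => rfl
  | cons x l ih =>
    have h1 := ih fun y hy ↦ h y (List.mem_cons_of_mem _ hy)
    simp only [pack, List.map_cons, List.foldr_cons, List.length_cons, List.replicate_succ] at h1 ⊢
    rw [key _ _ _ (h x List.mem_cons_self), h1]

lemma pack_mul (x y : Fin 8 → ℕ) (hx : ∀ i, x i < 16) (hy : ∀ i, y i < 16) (u v : ℕ) :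
    (pack [x 0, x 1, x 2, x 3, x 4, x 5, x 6, x 7] + 2048 ^ 8 * u) *
      (pack [y 7, y 6, y 5, y 4, y 3, y 2, y 1, y 0] + 2048 ^ 8 * v) / 2048 ^ 7 % 2048 =
    ∑ i, x i * y i := by
  have hxy : ∀ i j, x i * y j ≤ 225 := fun i j ↦
    (Nat.mul_le_mul (Nat.le_of_lt_succ (hx i)) (Nat.le_of_lt_succ (hy j)))
  obtain ⟨lo, hi, h1, h2⟩ : ∃ lo hi, lo < 2048 ^ 7 ∧
      (pack [x 0, x 1, x 2, x 3, x 4, x 5, x 6, x 7] + 2048 ^ 8 * u) *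
        (pack [y 7, y 6, y 5, y 4, y 3, y 2, y 1, y 0] + 2048 ^ 8 * v) =
      lo + 2048 ^ 7 * ((∑ i, x i * y i) + 2048 * hi) := by
    refine ⟨x 0 * y 7 + 2048 * ((x 0 * y 6 + x 1 * y 7) + 2048 * ((x 0 * y 5 + x 1 * y 6 + x 2 * y 7)
      + 2048 * ((x 0 * y 4 + x 1 * y 5 + x 2 * y 6 + x 3 * y 7)
      + 2048 * ((x 0 * y 3 + x 1 * y 4 + x 2 * y 5 + x 3 * y 6 + x 4 * y 7)
      + 2048 * ((x 0 * y 2 + x 1 * y 3 + x 2 * y 4 + x 3 * y 5 + x 4 * y 6 + x 5 * y 7)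
      + 2048 * (x 0 * y 1 + x 1 * y 2 + x 2 * y 3 + x 3 * y 4 + x 4 * y 5 + x 5 * y 6 + x 6 * y 7)))))),
      (x 1 * y 0 + x 2 * y 1 + x 3 * y 2 + x 4 * y 3 + x 5 * y 4 + x 6 * y 5 + x 7 * y 6)
      + 2048 * ((x 2 * y 0 + x 3 * y 1 + x 4 * y 2 + x 5 * y 3 + x 6 * y 4 + x 7 * y 5)
      + 2048 * ((x 3 * y 0 + x 4 * y 1 + x 5 * y 2 + x 6 * y 3 + x 7 * y 4)
      + 2048 * ((x 4 * y 0 + x 5 * y 1 + x 6 * y 2 + x 7 * y 3)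
      + 2048 * ((x 5 * y 0 + x 6 * y 1 + x 7 * y 2) + 2048 * ((x 6 * y 0 + x 7 * y 1)
      + 2048 * (x 7 * y 0))))))
      + pack [x 0, x 1, x 2, x 3, x 4, x 5, x 6, x 7] * v
      + u * pack [y 7, y 6, y 5, y 4, y 3, y 2, y 1, y 0] + 2048 ^ 8 * u * v, ?_, ?_⟩
    · have h07 := hxy 0 7; have h06 := hxy 0 6; have h17 := hxy 1 7; have h05 := hxy 0 5
      have h16 := hxy 1 6; have h27 := hxy 2 7; have h04 := hxy 0 4; have h15 := hxy 1 5
      have h26 := hxy 2 6; have h37 := hxy 3 7; have h03 := hxy 0 3; have h14 := hxy 1 4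
      have h25 := hxy 2 5; have h36 := hxy 3 6; have h47 := hxy 4 7; have h02 := hxy 0 2
      have h13 := hxy 1 3; have h24 := hxy 2 4; have h35 := hxy 3 5; have h46 := hxy 4 6
      have h57 := hxy 5 7; have h01 := hxy 0 1; have h12 := hxy 1 2; have h23 := hxy 2 3
      have h34 := hxy 3 4; have h45 := hxy 4 5; have h56 := hxy 5 6; have h67 := hxy 6 7
      omega
    · simp only [pack, List.foldr_cons, List.foldr_nil, Fin.sum_univ_eight]
      ring
  have h3 : ∑ i, x i * y i ≤ ∑ _ : Fin 8, 225 := Finset.sum_le_sum fun i _ ↦ hxy i i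
  rw [h2, Nat.add_mul_div_left _ _ (by norm_num), Nat.div_eq_of_lt h1]
  simp at h3
  omega

/-- The values of the coordinates of `a`, of the pairings with the simple roots, and of the sign
cocycle on the simple roots; the latter two in reverse order. -/
def lin (a : Q) : List ℤ :=
  [a 0, a 1, a 2, a 3, a 4, a 5, a 6, a 7,
    2 * a 7 - a 6, 2 * a 6 - a 5 - a 7, 2 * a 5 - a 4 - a 6, 2 * a 4 - a 3 - a 5,
    2 * a 3 - a 1 - a 2 - a 4, 2 * a 2 - a 0 - a 3, 2 * a 1 - a 3, 2 * a 0 - a 2,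
    a 7, a 6 + a 7, a 5 + a 6, a 4 + a 5, a 3 + a 4, a 2 + a 3, a 1 + a 3, a 0 + a 2]

/-- A vector of the root lattice packed into a natural number. -/
def enc (a : Q) : ℕ := pack ((lin a).map res)

/-- The vector packed into a natural number. -/
def dec (n : ℕ) : Q := fun i ↦ sgnd (n / 2048 ^ (i : ℕ) % 16)

/-- The natural number packing the sum of two vectors. -/
def addc (n m : ℕ) : ℕ := Nat.land (Nat.add n m) (pack (List.replicate 24 15))

/-- The pairing of packed vectors modulo sixteen. -/
def bilc (n m : ℕ) : ℕ := Nat.mod (Nat.div (Nat.mul n (Nat.div m (2048 ^ 8))) (2048 ^ 7)) 16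

/-- The sign cocycle on packed vectors modulo sixteen. -/
def sgnc (n m : ℕ) : ℕ := Nat.mod (Nat.div (Nat.mul n (Nat.div m (2048 ^ 16))) (2048 ^ 7)) 16

lemma bilc_eq (n m : ℕ) : bilc n m = n * (m / 2048 ^ 8) / 2048 ^ 7 % 16 := rfl

lemma sgnc_eq (n m : ℕ) : sgnc n m = n * (m / 2048 ^ 16) / 2048 ^ 7 % 16 := rfl

lemma enc_add (a b : Q) : enc (a + b) = addc (enc a) (enc b) := by
  have hl : lin (a + b) = List.zipWith (· + ·) (lin a) (lin b) := by
    simp only [lin, Pi.add_apply, List.zipWith_cons_cons, List.zipWith_nil_right]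
    ring_nf
  have h1 := pack_add ((lin a).map res) ((lin b).map res) rfl
  have h2 := pack_land (List.zipWith (· + ·) ((lin a).map res) ((lin b).map res)) fun x hx ↦ by
    simp only [lin, List.map_cons, List.map_nil, List.zipWith_cons_cons, List.zipWith_nil_right] at hx
    have h : ∀ y z : ℤ, res y + res z < 2048 := fun y z ↦ by
      have := res_lt y; have := res_lt z; omega
    have h3 : ∀ l : List (ℤ × ℤ), x ∈ l.map (fun p ↦ res p.1 + res p.2) → x < 2048 := fun l hl ↦ by
      obtain ⟨p, -, rfl⟩ := List.mem_map.1 hl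
      exact h _ _
    refine h3 (List.zip (lin a) (lin b)) ?_
    simpa only [lin, List.zip, List.zipWith_cons_cons, List.zipWith_nil_right, List.map_cons,
      List.map_nil] using hx
  rw [enc, addc, Nat.add_eq, enc, enc, h1, hl]
  refine Eq.trans ?_ h2.symm
  rw [List.map_zipWith, List.map_zipWith, List.zipWith_map]
  simp only [res_add]

lemma enc_split (a : Q) : ∃ u, enc a = pack [res (a 0), res (a 1), res (a 2), res (a 3), res (a 4),
    res (a 5), res (a 6), res (a 7)] + 2048 ^ 8 * u :=
  ⟨_, pack_append [_, _, _, _, _, _, _, _] _⟩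

lemma pack_lt (l : List ℕ) (h : ∀ x ∈ l, x < 2048) : pack l < 2048 ^ l.length := by
  induction l with
  | nil => simp [pack]
  | cons x l ih =>
    have h1 := ih fun y hy ↦ h y (List.mem_cons_of_mem _ hy)
    have h2 := h x List.mem_cons_self
    simp only [pack, List.foldr_cons, List.length_cons, pow_succ] at h1 ⊢
    omega

lemma pack_append_div (l l' : List ℕ) (h : ∀ x ∈ l, x < 2048) :
    pack (l ++ l') / 2048 ^ l.length = pack l' := by
  rw [pack_append, Nat.add_mul_div_left _ _ (by positivity), Nat.div_eq_of_lt (pack_lt l h), zero_add]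

lemma sum_res_mul (u v : Fin 8 → ℤ) : (∑ i, res (u i) * res (v i)) % 16 = res (∑ i, u i * v i) := by
  zify
  rw [res_cast, Finset.sum_int_mod, Finset.sum_int_mod (f := fun i ↦ u i * v i)]
  simp only [res_cast, ← Int.mul_emod]

lemma bilc_enc (a b : Q) : bilc (enc a) (enc b) = res (bil a b) := by
  obtain ⟨u, hu⟩ := enc_split a
  have h1 := pack_append_div (((lin b).map res).take 8) (((lin b).map res).drop 8) fun x hx ↦ by
    obtain ⟨z, -, rfl⟩ := List.mem_map.1 (List.mem_of_mem_take hx)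
    exact (res_lt z).trans (by norm_num)
  have h2 : enc b / 2048 ^ 8 = pack (((lin b).map res).drop 8) := by
    rw [← h1, List.take_append_drop]
    rfl
  let v : Fin 8 → ℤ := ![2 * b 0 - b 2, 2 * b 1 - b 3, 2 * b 2 - b 0 - b 3, 2 * b 3 - b 1 - b 2 - b 4,
    2 * b 4 - b 3 - b 5, 2 * b 5 - b 4 - b 6, 2 * b 6 - b 5 - b 7, 2 * b 7 - b 6]
  have h3 : ((lin b).map res).drop 8 = [res (v 7), res (v 6), res (v 5), res (v 4), res (v 3), res (v 2),
    res (v 1), res (v 0)] ++ ((lin b).map res).drop 16 := rfl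
  have h4 := pack_mul (fun i ↦ res (a i)) (fun i ↦ res (v i)) (fun _ ↦ res_lt _) (fun _ ↦ res_lt _)
    u (pack (((lin b).map res).drop 16))
  rw [bilc_eq, h2, hu, h3, pack_append, show ∀ a b c d e f g h : ℕ, [a, b, c, d, e, f, g, h].length = 8 from
    fun _ _ _ _ _ _ _ _ ↦ rfl, ← Nat.mod_mod_of_dvd _ (by norm_num : 16 ∣ 2048),
    h4, sum_res_mul]
  refine congrArg res ?_
  simp [Fin.sum_univ_eight, v, bil]
  ring

lemma sgnc_enc (a b : Q) : sgnc (enc a) (enc b) = res (sgnExp a b) := by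
  obtain ⟨u, hu⟩ := enc_split a
  have h1 := pack_append_div (((lin b).map res).take 16) (((lin b).map res).drop 16) fun x hx ↦ by
    obtain ⟨z, -, rfl⟩ := List.mem_map.1 (List.mem_of_mem_take hx)
    exact (res_lt z).trans (by norm_num)
  have h2 : enc b / 2048 ^ 16 = pack (((lin b).map res).drop 16) := by
    rw [← h1, List.take_append_drop]
    rfl
  let v : Fin 8 → ℤ := ![b 0 + b 2, b 1 + b 3, b 2 + b 3, b 3 + b 4, b 4 + b 5, b 5 + b 6, b 6 + b 7,
    b 7]
  have h3 : ((lin b).map res).drop 16 = [res (v 7), res (v 6), res (v 5), res (v 4), res (v 3),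
    res (v 2), res (v 1), res (v 0)] := rfl
  have h4 := pack_mul (fun i ↦ res (a i)) (fun i ↦ res (v i)) (fun _ ↦ res_lt _) (fun _ ↦ res_lt _)
    u 0
  rw [Nat.mul_zero, Nat.add_zero] at h4
  rw [sgnc_eq, h2, hu, h3, ← Nat.mod_mod_of_dvd _ (by norm_num : 16 ∣ 2048),
    h4, sum_res_mul]
  refine congrArg res ?_
  simp [Fin.sum_univ_eight, v, sgnExp]
  ring

lemma pack_digit (l : List ℕ) (h : ∀ x ∈ l, x < 2048) (i : ℕ) (hi : i < l.length) :
    pack l / 2048 ^ i % 16 = l[i] % 16 := by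
  induction l generalizing i with
  | nil => simp at hi
  | cons x l ih =>
    obtain _ | i := i
    · simp only [pack, List.foldr_cons, pow_zero, List.getElem_cons_zero]
      omega
    · rw [pow_succ', ← Nat.div_div_eq_div_mul]
      refine Eq.trans ?_ (ih (fun y hy ↦ h y (List.mem_cons_of_mem _ hy)) i (by simpa using hi))
      congr 2
      have := h x List.mem_cons_self
      simp only [pack, List.foldr_cons]
      omega

lemma dec_enc {a : Q} (ha : IsRoot a) : dec (enc a) = a := by
  funext i
  have h := ha.coord_le i
  have h1 : ((lin a).map res)[(i : ℕ)]'(by simp [lin]; omega) = res (a i) := by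
    fin_cases i <;> rfl
  rw [dec, enc, pack_digit _ _ _ (by simp [lin]; omega), h1, Nat.mod_eq_of_lt (res_lt _),
    sgnd_res (by omega) (by omega)]
  rintro x hx
  obtain ⟨z, -, rfl⟩ := List.mem_map.1 hx
  exact (res_lt z).trans (by norm_num)

end E8

namespace E8

/-- The coordinates of the positive roots, eight decimal digits for each root. -/
def rootDigits : ℕ :=
  1111000011100000110000001000000001110000011000000100000000110000001000000001
  + 10 ^ 80 * (1011110010111000101100001010000000111110001111000011100000110000001000001000000
  + 10 ^ 80 * (1111000011100000011111100111110001111000011100000110000001000001000000001011111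
  + 10 ^ 80 * (1122111011221100112210001121111011211100112110001121000011111110111111001111100
  + 10 ^ 80 * (11110000101111111011111010111100101110001011000010100000011222210112221101122210
  + 10 ^ 80 * (11122110111221001112111111121110111211001112100011111111111111101111110011111000
  + 10 ^ 80 * (11222110112221001122111111221110112211001122100011122221111222111112221011122111
  + 10 ^ 80 * (11232221112322111123221011232111112321101123210011222221112222111122221011222111
  + 10 ^ 80 * (12232221122322111223221012232111122321101223210011233321112332211123321111233210
  + 10 ^ 80 * (12343210122443211224332112243221122432111224321012233321122332211223321112233210
  + 10 ^ 80 * (22343321223432212234321122343210133543211235432112344321123433211234322112343211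
  + 10 ^ 80 * (23465432234654312346542123465321234643212345432122454321233543212235432122344321)))))))))))

/-- The packed `k`-th root; the roots with `k < 120` are the positive ones, and the numbers of
opposite roots differ by `120`. -/
def posCode (k : ℕ) : ℕ :=
  let d := Nat.div rootDigits (Nat.pow 10 (Nat.mul 8 k))
  Nat.land (
    Nat.add (Nat.mul (Nat.mod (Nat.div d 10000000) 10) 14474011154664524427946373219622260526425523827914461316661356121680118808577) (
    Nat.add (Nat.mul (Nat.mod (Nat.div d 1000000) 10) 7067388259113537318333190048643681897668712806598858064776052793789122560) (
    Nat.add (Nat.mul (Nat.mod (Nat.div d 100000) 10) 14474014605537697823228267544984727921417841638176649060869503449084754657280) (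
    Nat.add (Nat.mul (Nat.mod (Nat.div d 10000) 10) 7070840817283599297141894890297968282095010715438545004575131212995100672) (
    Nat.add (Nat.mul (Nat.mod (Nat.div d 1000) 10) 1685819418975575590187766009203110036476403294646730588819562692608) (
    Nat.add (Nat.mul (Nat.mod (Nat.div d 100) 10) 823154013171667768646370121681206072498243796250252708751081472) (
    Nat.add (Nat.mul (Nat.mod (Nat.div d 10) 10) 401930670493978402659360410977151402587106890596521357606912) (
    Nat.mul (Nat.mod d 10) 196255210202137891923515825672435092674265432026007994368))))))))
    (pack (List.replicate 24 15))

def code (k : ℕ) : ℕ :=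
  bif Nat.blt k 120 then posCode k else
    Nat.land (Nat.sub (pack (List.replicate 24 16)) (posCode (Nat.sub k 120)))
      (pack (List.replicate 24 15))

/-- The `k`-th root. -/
def root (k : ℕ) : Q := dec (code k)

/-- The numbers of the simple roots. -/
def srIndex : Fin 8 → ℕ := ![21, 10, 22, 11, 6, 3, 1, 0]

instance (a : Q) : Decidable (IsRoot a) := inferInstanceAs (Decidable (bil a a = 2))

set_option maxRecDepth 10000 in
lemma root_aux : ∀ k < 240, IsRoot (root k) ∧ Nat.beq (code k) (enc (root k)) = true := by
  decide +kernel

set_option maxRecDepth 10000 in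
lemma root_aux' : ∀ k < 120, (∀ i, 0 ≤ root k i) ∧ (∀ i, root (k + 120) i = -root k i) ∧
    (k < 119 → Nat.blt (code k) (code (k + 1)) = true) ∧
    ∀ i, bilc (code k) (code (srIndex i)) = 15 → ∃ j < 120, Nat.beq (code j)
      (addc (code k) (code (srIndex i))) = true := by
  decide +kernel

lemma srIndex_lt (i : Fin 8) : srIndex i < 120 := by
  revert i
  decide

lemma root_srIndex (i : Fin 8) : root (srIndex i) = sr i := by
  revert i
  decide +kernel

lemma isRoot_root {k : ℕ} (hk : k < 240) : IsRoot (root k) := (root_aux k hk).1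

lemma code_eq {k : ℕ} (hk : k < 240) : code k = enc (root k) :=
  Nat.eq_of_beq_eq_true (root_aux k hk).2

lemma root_nonneg {k : ℕ} (hk : k < 120) : 0 ≤ root k := (root_aux' k hk).1

lemma root_add {k : ℕ} (hk : k < 120) : root (k + 120) = -root k := funext (root_aux' k hk).2.1

lemma exists_root_of_nonneg {a : Q} (ha : IsRoot a) (h0 : 0 ≤ a) : ∃ k < 120, root k = a := by
  obtain ⟨n, hn⟩ : ∃ n : ℕ, ht a = n := Int.eq_ofNat_of_zero_le (ht_pos h0 ha.ne_zero).le
  induction n generalizing a with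
  | zero => exact absurd hn (ht_pos h0 ha.ne_zero).ne'
  | succ n ih =>
    rcases ha.simple_or h0 with ⟨i, rfl⟩ | ⟨i, hi⟩
    · exact ⟨srIndex i, srIndex_lt i, root_srIndex i⟩
    · obtain ⟨k, hk, h⟩ := ih (ha.sub (isRoot_sr i) hi) (ha.sub_sr_nonneg h0 hi)
        (by rw [ht_sub, ht_sr, hn]; simp)
      have hs : srIndex i < 240 := (srIndex_lt i).trans (by norm_num)
      obtain ⟨j, hj, h1⟩ := (root_aux' k hk).2.2.2 i (by
        rw [code_eq hs, code_eq (by omega), bilc_enc, h, root_srIndex, bil_sub_left, hi, bil_sr_self]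
        rfl)
      refine ⟨j, hj, ?_⟩
      have h2 := Nat.eq_of_beq_eq_true h1
      rw [code_eq hs, code_eq (show k < 240 by omega), code_eq (show j < 240 by omega), ← enc_add, h,
        root_srIndex, sub_add_cancel] at h2
      rw [← dec_enc (isRoot_root (show j < 240 by omega)), h2, dec_enc ha]

lemma code_lt {j k : ℕ} (h : j < k) (hk : k < 120) : code j < code k := by
  induction k, h using Nat.le_induction with
  | base => simpa using (root_aux' j (by omega)).2.2.1 (by omega)
  | succ k h ih =>
    have := (root_aux' k (by omega)).2.2.1 (by omega)
    rw [Nat.blt_eq] at this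
    exact (ih (by omega)).trans this

lemma root_inj_of_lt {j k : ℕ} (hj : j < 120) (hk : k < 120) (h : root j = root k) : j = k := by
  have h1 : code j = code k := by rw [code_eq (by omega), code_eq (by omega), h]
  rcases lt_trichotomy j k with h2 | h2 | h2
  · exact absurd h1 (code_lt h2 hk).ne
  · exact h2
  · exact absurd h1 (code_lt h2 hj).ne'

/-- The coweight with given values on the simple roots. -/
def cw (y : Fin 8 → ℕ) : Q := ∑ i, (y i : ℤ) • fw i

/-- The packed coweight with given values on the simple roots. -/
def pk (y : Fin 8 → ℕ) : ℕ := pack [y 7, y 6, y 5, y 4, y 3, y 2, y 1, y 0]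

/-- The value of a packed coweight on a packed positive root. -/
def dot (n p : ℕ) : ℕ := Nat.mod (Nat.div (Nat.mul n p) (2048 ^ 7)) 2048

lemma bil_sum_left (s : Finset (Fin 8)) (u : Fin 8 → Q) (a : Q) :
    bil (∑ i ∈ s, u i) a = ∑ i ∈ s, bil (u i) a := by
  induction s using Finset.induction_on with
  | empty => simp [bil]
  | insert i s hi ih => rw [Finset.sum_insert hi, Finset.sum_insert hi, bil_add_left, ih]

lemma bil_cw (y : Fin 8 → ℕ) (a : Q) : bil (cw y) a = ∑ i, y i * a i := by
  rw [cw, bil_sum_left]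
  simp only [bil_smul_left, bil_fw]

lemma dot_code {y : Fin 8 → ℕ} (hy : ∀ i, y i < 16) {k : ℕ} (hk : k < 120) :
    (dot (code k) (pk y) : ℤ) = bil (cw y) (root k) := by
  obtain ⟨u, hu⟩ := enc_split (root k)
  have h1 := pack_mul (fun i ↦ res (root k i)) y (fun _ ↦ res_lt _) hy u 0
  rw [Nat.mul_zero, Nat.add_zero, ← hu, ← code_eq (by omega)] at h1
  have h2 : dot (code k) (pk y) = ∑ i, res (root k i) * y i := h1
  rw [h2, bil_cw]
  push_cast
  refine Finset.sum_congr rfl fun i _ ↦ ?_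
  have h3 := (isRoot_root (show k < 240 by omega)).coord_le i
  have h4 : 0 ≤ root k i := root_nonneg hk i
  rw [res_cast, Int.emod_eq_of_lt h4 (by omega), mul_comm]

lemma sum_digit (c : ℕ → ℕ) (hc : ∀ j, c j < 2048) {n M : ℕ} (h : n < M) :
    (∑ j ∈ Finset.range M, c j * 2048 ^ j) / 2048 ^ n % 2048 = c n := by
  induction n generalizing c M with
  | zero =>
    obtain ⟨M, rfl⟩ := Nat.exists_eq_add_of_lt h
    rw [Nat.zero_add, Finset.sum_range_succ']
    simp only [pow_succ, ← mul_assoc, ← Finset.sum_mul]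
    have := hc 0
    omega
  | succ n ih =>
    obtain _ | M := M
    · omega
    · rw [Finset.sum_range_succ', pow_succ', ← Nat.div_div_eq_div_mul]
      simp only [pow_succ, ← mul_assoc, ← Finset.sum_mul]
      have h1 := hc 0
      have h2 := ih (fun j ↦ c (j + 1)) (fun j ↦ hc _) (by omega : n < M)
      rw [← h2]
      congr 2
      omega

lemma sum_pow_digit (s : Finset ℕ) (hs : s.card < 2048) (f : ℕ → ℕ) (n : ℕ) :
    (∑ k ∈ s, 2048 ^ f k) / 2048 ^ n % 2048 = (s.filter fun k ↦ f k = n).card := by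
  obtain ⟨M, hM⟩ : ∃ M, n < M ∧ ∀ k ∈ s, f k < M :=
    ⟨n + 1 + ∑ k ∈ s, (f k + 1), by omega, fun k hk ↦ by
      have := Finset.single_le_sum (f := fun k ↦ f k + 1) (fun _ _ ↦ Nat.zero_le _) hk
      omega⟩
  rw [← sum_digit (fun j ↦ (s.filter fun k ↦ f k = j).card)
    (fun j ↦ (Finset.card_filter_le _ _).trans_lt hs) hM.1]
  congr 2
  rw [← Finset.sum_fiberwise_of_maps_to (t := Finset.range M) (g := f)
    fun k hk ↦ Finset.mem_range.2 (hM.2 k hk)]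
  refine Finset.sum_congr rfl fun j _ ↦ ?_
  rw [Finset.sum_congr rfl fun k hk ↦ by rw [(Finset.mem_filter.1 hk).2], Finset.sum_const,
    smul_eq_mul]

/-- The number of positive roots on which a packed coweight takes each given value. -/
def hist (p : ℕ) : ℕ → ℕ
  | 0 => 0
  | k + 1 => Nat.add (hist p k) (Nat.pow 2048 (dot (code k) p))

/-- The number of positive roots on which a packed coweight takes a given value. -/
def cnt (p n : ℕ) : ℕ := Nat.mod (Nat.div (hist p 120) (Nat.pow 2048 n)) 2048

lemma cnt_eq (p n : ℕ) :
    cnt p n = ((Finset.range 120).filter fun k ↦ dot (code k) p = n).card := by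
  rw [← sum_pow_digit _ (by simp)]
  have h : ∀ m, hist p m = ∑ k ∈ Finset.range m, 2048 ^ dot (code k) p := fun m ↦ by
    induction m with
    | zero => rfl
    | succ m ih => rw [Finset.sum_range_succ, ← ih]; rfl
  rw [← h]
  rfl

lemma card_root {P : Q → Prop} [DecidablePred P] (hP : ∀ a, P a → 0 ≤ a) :
    Fintype.card {a : {a : Q // IsRoot a} // P a.1} =
      ((Finset.range 120).filter fun k ↦ P (root k)).card := by
  rw [Fintype.card_subtype]
  symm
  refine Finset.card_bij (fun k hk ↦ ⟨root k, isRoot_root (by simp at hk; omega)⟩) ?_ ?_ ?_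
  · intro k hk
    simpa using (Finset.mem_filter.1 hk).2
  · intro j hj k hk h
    simp only [Finset.mem_filter, Finset.mem_range] at hj hk
    exact root_inj_of_lt hj.1 hk.1 (congrArg Subtype.val h)
  · rintro ⟨a, ha⟩ h
    simp only [Finset.mem_filter, Finset.mem_univ, true_and] at h
    obtain ⟨k, hk, rfl⟩ := exists_root_of_nonneg ha (hP _ h)
    exact ⟨k, by simpa using ⟨hk, h⟩, rfl⟩

end E8

namespace E8

open ChevalleyBasis

/-- The packed roots. -/
def IsCode (n : ℕ) : Prop := ∃ a, IsRoot a ∧ n = enc a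

lemma IsCode.isRoot {n : ℕ} (h : IsCode n) : IsRoot (dec n) := by
  obtain ⟨a, ha, h⟩ := h
  rwa [h, dec_enc ha]

lemma IsCode.enc_dec {n : ℕ} (h : IsCode n) : enc (dec n) = n := by
  obtain ⟨a, ha, h⟩ := h
  rw [h, dec_enc ha]

lemma isCode_code {k : ℕ} (hk : k < 240) : IsCode (code k) := ⟨_, isRoot_root hk, code_eq hk⟩

/-- A multiple of a coroot or of a root vector. -/
structure Term where
  /-- The coefficient. -/
  z : ℤ
  /-- Whether the term is a coroot. -/
  h : Bool
  /-- The packed root. -/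
  n : ℕ

/-- The bracket of two terms. -/
def lieT (s t : Term) : List Term :=
  bif s.h then bif t.h then [] else [⟨s.z * t.z * sgnd (bilc s.n t.n), false, t.n⟩]
  else bif t.h then [⟨-(s.z * t.z * sgnd (bilc t.n s.n)), false, s.n⟩]
  else bif Nat.beq (bilc s.n t.n) 15 then
    [⟨bif Nat.beq (Nat.mod (sgnc s.n t.n) 2) 0 then s.z * t.z else -(s.z * t.z), false,
      addc s.n t.n⟩]
  else bif Nat.beq (bilc s.n t.n) 14 then [⟨-(s.z * t.z), true, s.n⟩] else []

/-- The bracket of two lists of terms. -/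
def lieL (s t : List Term) : List Term := s.flatMap fun x ↦ t.flatMap (lieT x)

/-- Adding a multiple of a root vector. -/
def ins (t : Term) : List Term → List Term
  | [] => [t]
  | u :: l => bif Nat.beq t.n u.n then ⟨t.z + u.z, false, u.n⟩ :: l else u :: ins t l

/-- A test for the vanishing of a combination of terms. -/
def isZero (l : List Term) : Bool :=
  ((l.filter fun t ↦ !t.h).foldr ins []).all (fun t ↦ t.z == 0) &&
    (List.finRange 8).all fun i ↦ ((l.filter fun t ↦ t.h).map fun t ↦ t.z * dec t.n i).sum == 0

/-- The coefficient of a root vector in a combination of terms. -/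
def coef (l : List Term) (n : ℕ) : ℤ :=
  (l.map fun t ↦ bif !t.h && Nat.beq t.n n then t.z else 0).sum

lemma mod_two_sgnc (a b : Q) :
    Nat.beq (Nat.mod (sgnc (enc a) (enc b)) 2) 0 = true ↔ eps a b = 1 := by
  rw [Nat.beq_eq, sgnc_enc, eps]
  have h1 := res_cast (sgnExp a b)
  rcases Int.even_or_odd (sgnExp a b) with h | h
  · rw [Int.negOnePow_even _ h]
    obtain ⟨r, hr⟩ := h
    simp only [Units.val_one, iff_true]
    change res _ % 2 = 0
    omega
  · rw [Int.negOnePow_odd _ h]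
    obtain ⟨r, hr⟩ := h
    simp only [Units.val_neg, Units.val_one, show (-1 : ℤ) ≠ 1 by norm_num, iff_false]
    change ¬res _ % 2 = 0
    omega

lemma eps_eq_neg_one {a b : Q} (h : eps a b ≠ 1) : eps a b = -1 := by
  rcases Int.units_eq_one_or (sgnExp a b).negOnePow with h1 | h1
  · exact absurd (by rw [eps, h1, Units.val_one]) h
  · rw [eps, h1, Units.val_neg, Units.val_one]

section

variable (L : Type*) [LieRing L] [LieAlgebra ℂ L] [ChevalleyBasis L]

/-- The element of the Lie algebra defined by a term. -/
noncomputable def valT (t : Term) : L := (t.z : ℂ) • bif t.h then H (dec t.n) else R (dec t.n)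

/-- The element of the Lie algebra defined by a list of terms. -/
noncomputable def val (l : List Term) : L := (l.map (valT L)).sum

lemma val_nil : val L [] = 0 := rfl

lemma val_cons (t : Term) (l : List Term) : val L (t :: l) = valT L t + val L l := by
  simp [val]

lemma val_append (l l' : List Term) : val L (l ++ l') = val L l + val L l' := by
  simp [val]

lemma val_singleton (t : Term) : val L [t] = valT L t := by simp [val]

lemma isCode_lieT {s t : Term} (hs : IsCode s.n) (ht : IsCode t.n) : ∀ u ∈ lieT s t, IsCode u.n := by
  obtain ⟨a, ha, ha'⟩ := id hs
  obtain ⟨b, hb, hb'⟩ := id ht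
  intro u hu
  rw [lieT] at hu
  rcases Bool.eq_false_or_eq_true s.h with h1 | h1 <;>
    rcases Bool.eq_false_or_eq_true t.h with h2 | h2 <;>
    simp only [h1, h2, cond_true, cond_false, List.not_mem_nil, List.mem_singleton] at hu
  · rwa [hu]
  · rwa [hu]
  · rcases Bool.eq_false_or_eq_true (Nat.beq (bilc s.n t.n) 15) with h3 | h3
    · rw [h3, cond_true, List.mem_singleton] at hu
      have h5 := Nat.eq_of_beq_eq_true h3
      have h6 := ha.bil_bounds hb
      have h7 := res_cast (bil a b)
      rw [ha', hb', bilc_enc] at h5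
      rw [hu, ha', hb']
      exact ⟨a + b, ha.add hb (by omega), (enc_add a b).symm⟩
    · rw [h3, cond_false] at hu
      rcases Bool.eq_false_or_eq_true (Nat.beq (bilc s.n t.n) 14) with h4 | h4
      · rw [h4, cond_true, List.mem_singleton] at hu
        rwa [hu]
      · rw [h4, cond_false] at hu
        simp at hu

lemma val_lieT {s t : Term} (hs : IsCode s.n) (ht : IsCode t.n) :
    val L (lieT s t) = ⁅valT L s, valT L t⁆ := by
  obtain ⟨a, ha, ha'⟩ := hs
  obtain ⟨b, hb, hb'⟩ := ht
  rw [lieT, valT, valT, smul_lie, lie_smul, smul_smul, ha', hb', dec_enc ha, dec_enc hb]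
  have h6 := ha.bil_bounds hb
  have h7 := res_cast (bil a b)
  rcases Bool.eq_false_or_eq_true s.h with h1 | h1 <;>
    rcases Bool.eq_false_or_eq_true t.h with h2 | h2 <;>
    simp only [h1, h2, cond_true, cond_false]
  · rw [lie_H_H, smul_zero, val_nil]
  · rw [bilc_enc, sgnd_res (by omega) (by omega), val_singleton, valT, lie_H_R a hb, smul_smul]
    simp [dec_enc hb]
  · rw [bilc_enc, bil_comm b a, sgnd_res (by omega) (by omega), val_singleton, valT,
      ← lie_skew, lie_H_R b ha, bil_comm b a]
    simp [dec_enc ha, smul_smul]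
  · rw [bilc_enc]
    rcases Bool.eq_false_or_eq_true (Nat.beq (res (bil a b)) 15) with h3 | h3
    · have h5 : bil a b = -1 := by
        have := Nat.eq_of_beq_eq_true h3
        omega
      rw [h3, cond_true, val_singleton, valT, lie_R_R ha hb h5, smul_smul, ← enc_add,
        dec_enc (ha.add hb h5), cond_false]
      congr 1
      by_cases he : eps a b = 1
      · rw [(mod_two_sgnc a b).2 he, he]
        simp
      · rw [Bool.eq_false_iff.2 (mt (mod_two_sgnc a b).1 he), eps_eq_neg_one he]
        simp
    · have h5 : bil a b ≠ -1 := fun h ↦ by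
        have := Nat.ne_of_beq_eq_false h3
        omega
      rw [h3, cond_false]
      rcases Bool.eq_false_or_eq_true (Nat.beq (res (bil a b)) 14) with h4 | h4
      · have h8 : bil a b = -2 := by
          have := Nat.eq_of_beq_eq_true h4
          omega
        have h9 : b = -a := by rw [ha.eq_neg_of_bil hb h8, neg_neg]
        rw [h4, cond_true, val_singleton, valT, h9, lie_R_R_neg ha, dec_enc ha]
        simp
      · have h8 : bil a b ≠ -2 := fun h ↦ by
          have := Nat.ne_of_beq_eq_false h4
          omega
        rw [h4, cond_false, lie_R_R_zero ha hb (by omega), smul_zero, val_nil]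

lemma isCode_lieL {s t : List Term} (hs : ∀ x ∈ s, IsCode x.n) (ht : ∀ x ∈ t, IsCode x.n) :
    ∀ u ∈ lieL s t, IsCode u.n := by
  intro u hu
  simp only [lieL, List.mem_flatMap] at hu
  obtain ⟨x, hx, y, hy, h⟩ := hu
  exact isCode_lieT (hs x hx) (ht y hy) u h

lemma val_lieL {s t : List Term} (hs : ∀ x ∈ s, IsCode x.n) (ht : ∀ x ∈ t, IsCode x.n) :
    val L (lieL s t) = ⁅val L s, val L t⁆ := by
  have h1 : ∀ x, IsCode x.n → val L (t.flatMap (lieT x)) = ⁅valT L x, val L t⁆ := fun x hx ↦ by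
    induction t with
    | nil => simp [val]
    | cons y t ih =>
      rw [List.flatMap_cons, val_append, val_cons, lie_add, ih fun z hz ↦ ht z (by simp [hz]),
        val_lieT L hx (ht y (by simp))]
  induction s with
  | nil => simp [val, lieL]
  | cons x s ih =>
    rw [lieL, List.flatMap_cons, val_append, val_cons, add_lie, ← ih fun z hz ↦ hs z (by simp [hz]),
      h1 x (hs x (by simp)), lieL]

lemma val_ins {t : Term} (ht : t.h = false) {l : List Term} (hl : ∀ u ∈ l, u.h = false) :
    val L (ins t l) = valT L t + val L l ∧ ∀ u ∈ ins t l, u.h = false := by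
  induction l with
  | nil => simpa [ins, val] using ht
  | cons u l ih =>
    have hu := hl u (by simp)
    have ih := ih fun v hv ↦ hl v (by simp [hv])
    rw [ins]
    rcases Bool.eq_false_or_eq_true (Nat.beq t.n u.n) with h | h
    · rw [h, cond_true, val_cons, val_cons, valT, valT, valT, ht, hu, Nat.eq_of_beq_eq_true h]
      refine ⟨by simp [add_smul, add_assoc], fun v hv ↦ ?_⟩
      rcases List.mem_cons.1 hv with rfl | hv
      · rfl
      · exact hl v (by simp [hv])
    · rw [h, cond_false, val_cons, val_cons, ih.1]
      refine ⟨by abel, fun v hv ↦ ?_⟩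
      rcases List.mem_cons.1 hv with rfl | hv
      · exact hu
      · exact ih.2 v hv

lemma val_foldr_ins {l : List Term} (hl : ∀ u ∈ l, u.h = false) :
    val L (l.foldr ins []) = val L l ∧ ∀ u ∈ l.foldr ins [], u.h = false := by
  induction l with
  | nil => simp
  | cons t l ih =>
    have ih := ih fun v hv ↦ hl v (by simp [hv])
    have h := val_ins L (hl t (by simp)) ih.2
    exact ⟨by rw [List.foldr_cons, h.1, ih.1, val_cons], h.2⟩

lemma val_eq_zero {l : List Term} (h : isZero l = true) : val L l = 0 := by
  rw [isZero, Bool.and_eq_true, List.all_eq_true, List.all_eq_true] at h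
  have h1 : ∀ l : List Term, val L l =
      val L (l.filter fun t ↦ !t.h) + val L (l.filter fun t ↦ t.h) := fun l ↦ by
    induction l with
    | nil => simp [val]
    | cons t l ih =>
      rcases Bool.eq_false_or_eq_true t.h with ht | ht <;>
        simp only [List.filter_cons, ht, val_cons, ih, Bool.not_true, Bool.not_false, if_true,
          Bool.false_eq_true, if_false] <;> abel
  have h2 : ∀ l : List Term, (∀ t ∈ l, t.h = true) →
      val L l = H (fun i ↦ (l.map fun t ↦ t.z * dec t.n i).sum) := fun l hl ↦ by
    induction l with
    | nil => exact (map_zero H).symm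
    | cons t l ih =>
      have h3 : (fun i ↦ ((t :: l).map fun t ↦ t.z * dec t.n i).sum) =
          t.z • dec t.n + fun i ↦ (l.map fun t ↦ t.z * dec t.n i).sum := by
        funext i
        simp
      rw [h3, map_add, ← ih fun v hv ↦ hl v (by simp [hv]), val_cons, valT, hl t (by simp), cond_true,
        map_zsmul, Int.cast_smul_eq_zsmul]
  rw [h1, h2 (l.filter fun t ↦ t.h) fun t ht ↦ (List.mem_filter.1 ht).2]
  have h4 : (fun i ↦ ((l.filter fun t ↦ t.h).map fun t ↦ t.z * dec t.n i).sum) = 0 := by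
    funext i
    simpa using h.2 i (List.mem_finRange i)
  have h5 := (val_foldr_ins L (l := l.filter fun t ↦ !t.h) fun t ht ↦ by
    simpa using (List.mem_filter.1 ht).2).1
  rw [h4, map_zero, add_zero, ← h5, val]
  refine List.sum_eq_zero fun x hx ↦ ?_
  obtain ⟨t, ht, rfl⟩ := List.mem_map.1 hx
  rw [valT, beq_iff_eq.1 (h.1 t ht), Int.cast_zero, zero_smul]

lemma repr_val {l : List Term} (hl : ∀ x ∈ l, IsCode x.n) {n : ℕ} (hn : IsCode n) :
    basis.repr (val L l) (Sum.inr ⟨dec n, hn.isRoot⟩) = coef l n := by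
  induction l with
  | nil => simp [val, coef]
  | cons t l ih =>
    have ht := hl t (by simp)
    rw [val_cons, map_add, Finsupp.add_apply, ih fun v hv ↦ hl v (by simp [hv]), coef, coef,
      List.map_cons, List.sum_cons, Int.cast_add]
    congr 1
    rw [valT, map_smul, Finsupp.smul_apply]
    rcases Bool.eq_false_or_eq_true t.h with h | h
    · rw [h, H_eq_sum]
      simp [← basis_inl]
    · rw [h, cond_false, ← basis_inr (⟨_, ht.isRoot⟩ : {a : Q // IsRoot a}), Module.Basis.repr_self]
      rcases Bool.eq_false_or_eq_true (Nat.beq t.n n) with h1 | h1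
      · have h2 := Nat.eq_of_beq_eq_true h1
        subst h2
        simp
      · have h2 : dec t.n ≠ dec n := fun h2 ↦
          Nat.ne_of_beq_eq_false h1 (by rw [← ht.enc_dec, ← hn.enc_dec, h2])
        simp [h1, h2]

end

end E8

namespace E8

open ChevalleyBasis Module

/-- The binary digits of a number. -/
def bits (S : ℕ) (i : Fin 8) : ℕ := S / 2 ^ (i : ℕ) % 2

/-- The hexadecimal digits of a number. -/
def hexits (q : ℕ) (i : Fin 8) : ℕ := q / 16 ^ (i : ℕ) % 16

lemma bits_lt (S : ℕ) (i : Fin 8) : bits S i < 16 := (Nat.mod_lt _ (by norm_num)).trans (by norm_num)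

lemma hexits_lt (S : ℕ) (i : Fin 8) : hexits S i < 16 := Nat.mod_lt _ (by norm_num)

lemma blt_of_lt {j k : ℕ} (h : j < k) : Nat.blt j k = true := by
  rwa [Nat.blt_eq]

lemma blt_of_le {j k : ℕ} (h : k ≤ j) : Nat.blt j k = false :=
  Bool.eq_false_iff.2 fun h1 ↦ h.not_gt (by rwa [Nat.blt_eq] at h1)

lemma lt_of_blt {j k : ℕ} (h : Nat.blt j k = true) : j < k := by
  rwa [Nat.blt_eq] at h

/-- The value of a packed coweight on the `k`-th root. -/
def wt (p k : ℕ) : ℤ :=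
  bif Nat.blt k 120 then dot (code k) p else
    bif Nat.blt k 240 then -dot (code (Nat.sub k 120)) p else 0

lemma wt_pk {y : Fin 8 → ℕ} (hy : ∀ i, y i < 16) {k : ℕ} (hk : k < 240) :
    wt (pk y) k = bil (cw y) (root k) := by
  rcases lt_or_ge k 120 with h | h
  · rw [wt, blt_of_lt h, cond_true, dot_code hy h]
  · obtain ⟨k, rfl⟩ := Nat.exists_eq_add_of_le' h
    rw [wt, blt_of_le h, blt_of_lt hk, cond_true, cond_false,
      root_add (by omega), bil_neg_right, ← dot_code hy (by omega)]
    rfl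

lemma wt_of_le (p : ℕ) {k : ℕ} (hk : 240 ≤ k) : wt p k = 0 := by
  rw [wt, blt_of_le (by omega),
    blt_of_le (by omega)]
  rfl

/-- The combination of terms with given coefficients and numbers: the `k`-th root vector has the
number `k`, the `k`-th coroot the number `k + 240`. -/
def vec (l : List (ℤ × ℕ)) : List Term :=
  l.map fun t ↦ bif Nat.blt t.2 240 then ⟨t.1, false, code t.2⟩ else
    ⟨t.1, true, code (Nat.sub t.2 240)⟩

/-- A test for the validity of the numbers in a combination. -/
def valid (l : List (ℤ × ℕ)) : Bool := l.all fun t ↦ Nat.blt t.2 480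

/-- A test for the weight of the terms in a combination. -/
def hasWt (p : ℕ) (n : ℤ) (l : List (ℤ × ℕ)) : Bool :=
  l.all fun t ↦ Nat.blt t.2 480 && wt p t.2 == n

lemma valid_of_hasWt {p : ℕ} {n : ℤ} {l : List (ℤ × ℕ)} (h : hasWt p n l = true) :
    valid l = true := by
  rw [hasWt, List.all_eq_true] at h
  rw [valid, List.all_eq_true]
  exact fun t ht ↦ (Bool.and_eq_true _ _ ▸ h t ht).1

lemma isCode_vec {l : List (ℤ × ℕ)} (h : valid l = true) : ∀ x ∈ vec l, IsCode x.n := by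
  rw [valid, List.all_eq_true] at h
  intro x hx
  obtain ⟨t, ht, rfl⟩ := List.mem_map.1 hx
  have h1 := lt_of_blt (h t ht)
  rcases lt_or_ge t.2 240 with h2 | h2
  · rw [blt_of_lt h2, cond_true]
    exact isCode_code h2
  · rw [blt_of_le h2, cond_false]
    have h3 : Nat.sub t.2 240 < 240 := by
      change t.2 - 240 < 240
      omega
    dsimp only
    generalize Nat.sub t.2 240 = k at h3 ⊢
    exact isCode_code h3

section

variable (L : Type*) [LieRing L] [LieAlgebra ℂ L] [ChevalleyBasis L]

/-- The element of the Lie algebra with given coefficients. -/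
noncomputable def el (l : List (ℤ × ℕ)) : L := val L (vec l)

variable {L}

lemma el_mem_G {y : Fin 8 → ℕ} (hy : ∀ i, y i < 16) {n : ℤ} {l : List (ℤ × ℕ)}
    (h : hasWt (pk y) n l = true) : el L l ∈ G L (cw y) n := by
  rw [hasWt, List.all_eq_true] at h
  refine list_sum_mem fun x hx ↦ ?_
  obtain ⟨u, hu, rfl⟩ := List.mem_map.1 hx
  obtain ⟨t, ht, rfl⟩ := List.mem_map.1 hu
  obtain ⟨h1, h2⟩ := Bool.and_eq_true _ _ ▸ h t ht
  have h1 := lt_of_blt h1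
  have h2 := beq_iff_eq.1 h2
  refine Submodule.smul_mem _ _ ?_
  rcases lt_or_ge t.2 240 with h3 | h3
  · rw [blt_of_lt h3, cond_true, cond_false, ← h2, wt_pk hy h3]
    exact R_mem_G _ (isRoot_root h3)
  · rw [wt_of_le _ h3] at h2
    rw [blt_of_le (by omega), cond_false, cond_true, ← h2]
    exact H_mem_G _ _

/-- A test for the vanishing of the bracket of two combinations. -/
def lieZero (s t : List (ℤ × ℕ)) : Bool := isZero (lieL (vec s) (vec t))

lemma lie_el {s t : List (ℤ × ℕ)} (hs : valid s = true) (ht : valid t = true) :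
    ⁅el L s, el L t⁆ = val L (lieL (vec s) (vec t)) :=
  (val_lieL L (isCode_vec hs) (isCode_vec ht)).symm

lemma lie_el_eq_zero {s t : List (ℤ × ℕ)} (hs : valid s = true) (ht : valid t = true)
    (h : lieZero s t = true) : ⁅el L s, el L t⁆ = 0 := by
  rw [lie_el hs ht, val_eq_zero L h]

/-- The sum of the simple coroots with given coefficients. -/
def corootSum (c : Q) : List (ℤ × ℕ) := (List.finRange 8).map fun i ↦ (c i, Nat.add 240 (srIndex i))

lemma el_corootSum (c : Q) : el L (corootSum c) = H c := by
  have h1 : ∀ i, valT L (bif Nat.blt (Nat.add 240 (srIndex i)) 240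
      then ⟨c i, false, code (Nat.add 240 (srIndex i))⟩ else
        ⟨c i, true, code (Nat.sub (Nat.add 240 (srIndex i)) 240)⟩) = (c i : ℂ) • H (sr i) := fun i ↦ by
    have h2 : Nat.sub (Nat.add 240 (srIndex i)) 240 = srIndex i := Nat.add_sub_cancel_left ..
    rw [blt_of_le (show 240 ≤ Nat.add 240 (srIndex i) from Nat.le_add_right _ _), cond_false, h2,
      valT, cond_true, ← root_srIndex i]
    rfl
  rw [H_eq_sum, el, val, vec, corootSum, List.map_map, List.map_map]
  simp only [Function.comp_def, h1]
  rw [← List.sum_ofFn, List.ofFn_eq_map]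

/-- The opposite of a combination. -/
def negL (l : List (ℤ × ℕ)) : List (ℤ × ℕ) := l.map fun t ↦ (-t.1, t.2)

lemma el_negL (l : List (ℤ × ℕ)) : el L (negL l) = -el L l := by
  induction l with
  | nil => exact neg_zero.symm
  | cons t l ih =>
    have h : ∀ u v, el L (u :: v) = el L [u] + el L v := fun u v ↦ by
      rw [el, vec, List.map_cons, val_cons, el, vec, List.map_singleton, val_singleton]
      rfl
    rw [negL, List.map_cons, h, h t, neg_add, ← ih, negL]
    congr 1
    rw [el, vec, List.map_singleton, val_singleton, el, vec, List.map_singleton, val_singleton]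
    dsimp only
    rcases Bool.eq_false_or_eq_true (Nat.blt t.2 240) with h1 | h1 <;>
      simp [h1, valT]

lemma valid_negL {l : List (ℤ × ℕ)} (h : valid l = true) : valid (negL l) = true := by
  rw [valid, List.all_eq_true] at h ⊢
  intro t ht
  obtain ⟨u, hu, rfl⟩ := List.mem_map.1 ht
  exact h u hu

/-- A test for the equality of the bracket of two combinations with a third one. -/
def lieEq (s t u : List (ℤ × ℕ)) : Bool := isZero (lieL (vec s) (vec t) ++ vec (negL u))

lemma lie_el_eq {s t u : List (ℤ × ℕ)} (hs : valid s = true) (ht : valid t = true)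
    (h : lieEq s t u = true) : ⁅el L s, el L t⁆ = el L u := by
  have h1 := val_eq_zero L h
  rwa [val_append, ← lie_el hs ht, ← el, el_negL, add_neg_eq_zero] at h1

/-- The coefficient of a root vector in a combination. -/
def cf (l : List (ℤ × ℕ)) (k : ℕ) : ℤ := coef (vec l) (code k)

lemma repr_el {l : List (ℤ × ℕ)} (hl : valid l = true) {k : ℕ} (hk : k < 240) :
    basis.repr (el L l) (Sum.inr ⟨root k, isRoot_root hk⟩) = cf l k :=
  repr_val L (isCode_vec hl) (isCode_code hk)

end

section

variable {L : Type*} [LieRing L] [LieAlgebra ℂ L] [ChevalleyBasis L]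

lemma bil_cw_sr (y : Fin 8 → ℕ) (i : Fin 8) : bil (cw y) (sr i) = y i := by
  rw [bil_cw]
  simp [sr, Pi.single_apply]

lemma cw_nonneg (y : Fin 8 → ℕ) (i : Fin 8) : 0 ≤ bil (cw y) (sr i) := by
  rw [bil_cw_sr]
  positivity

lemma ext_bil {c d : Q} (h : ∀ i, bil c (sr i) = bil d (sr i)) : c = d :=
  sub_eq_zero.1 (eq_zero_of_bil_self _ (by
    rw [bil_eq_sum]
    refine Finset.sum_eq_zero fun i _ ↦ ?_
    rw [bil_comm, bil_sub_left, h, sub_self, mul_zero]))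

lemma exists_bits {c : Q} (hc : ∀ i, bil c (sr i) = 0 ∨ bil c (sr i) = 1) :
    ∃ S < 256, c = cw (bits S) := by
  have h1 : ∀ y : Fin 8 → Fin 2, ∑ j, (y j : ℕ) * 2 ^ (j : ℕ) < 256 ∧
      ∀ i, bits (∑ j, (y j : ℕ) * 2 ^ (j : ℕ)) i = y i := by
    decide +kernel
  obtain ⟨h2, h3⟩ := h1 fun i ↦ if bil c (sr i) = 0 then 0 else 1
  refine ⟨_, h2, ext_bil fun i ↦ ?_⟩
  rw [bil_cw_sr, h3]
  rcases hc i with h | h <;> simp [h]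

instance (c : Q) (n : ℤ) : DecidablePred fun a : Q ↦ bil c a = n ∧ 0 ≤ a :=
  fun _ ↦ inferInstanceAs (Decidable (_ ∧ ∀ _, _ ≤ _))

lemma finrank_G_eq_cnt {y : Fin 8 → ℕ} (hy : ∀ i, y i < 16) {n : ℕ} (hn : 0 < n) :
    finrank ℂ (G L (cw y) n) = cnt (pk y) n := by
  rw [finrank_G, cnt_eq]
  have h1 : Fintype.card {i : Idx // deg (cw y) i = n} =
      Fintype.card {a : {a : Q // IsRoot a} // bil (cw y) a.1 = n ∧ 0 ≤ a.1} := by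
    refine Fintype.card_congr ⟨fun i ↦ match i with
      | ⟨.inl _, h⟩ => absurd h (by change (0 : ℤ) ≠ n; omega)
      | ⟨.inr a, h⟩ => ⟨a, h, ht_pos_of_bil_pos (cw_nonneg y) a.2 (by rw [show bil (cw y) a.1 = n from h]; omega)⟩,
      fun a ↦ ⟨.inr a.1, a.2.1⟩, ?_, fun a ↦ rfl⟩
    rintro ⟨i | a, h⟩
    · exact absurd h (by change (0 : ℤ) ≠ n; omega)
    · rfl
  rw [h1, card_root (P := fun a ↦ bil (cw y) a = n ∧ 0 ≤ a) fun a h ↦ h.2]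
  congr 1
  refine Finset.filter_congr fun k hk ↦ ?_
  have hk := Finset.mem_range.1 hk
  rw [← dot_code hy hk, Nat.cast_inj]
  exact and_iff_left (root_nonneg hk)

end

end E8

namespace E8

open ChevalleyBasis Module

/-- The restrictions on the dimensions of the homogeneous components coming from a reachable
nilpotent element. -/
def admissible (p : ℕ) : Bool :=
  Nat.blt (cnt p 3) (cnt p 1) && (Nat.blt (cnt p 4) (cnt p 2) && (List.range 30).all fun n ↦
    Nat.ble (cnt p (Nat.add n 3)) (cnt p (Nat.add n 1)) &&
      Nat.beq (Nat.mod (cnt p (Nat.add (Nat.mul 2 n) 1)) 2) 0)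

set_option synthInstance.maxSize 1000 in
set_option maxRecDepth 10000 in
/-- The weighted diagrams of the reachable nilpotent orbits, and those which the dimension
restrictions do not exclude. -/
lemma mem_of_admissible : ∀ S < 256, S ≠ 0 → admissible (pk (bits S)) = true →
    S ∈ [128, 1, 64, 2, 129, 32, 4, 65, 16, 132, 66, 8, 17, 72] ∨ S ∈ [33, 161, 136, 169] ∨
      S ∈ [160, 36, 137, 164, 81, 41] ∨ S ∈ [68, 80, 20, 73] := by
  decide +kernel

variable {L : Type*} [LieRing L] [LieAlgebra ℂ L] [ChevalleyBasis L] {S : ℕ} {e f : L}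

lemma cw_bits_zero : cw (bits 0) = 0 := by
  have : bits 0 = fun _ ↦ 0 := by
    funext i
    simp [bits]
  rw [this, cw]
  simp

lemma Triple.admissible (T : Triple (cw (bits S)) e f) (h0 : cw (bits S) ≠ 0) (hr : e ∈ der e) :
    admissible (pk (bits S)) = true := by
  have hn : ∀ {n : ℕ}, 0 < n → finrank ℂ (G L (cw (bits S)) n) = cnt (pk (bits S)) n :=
    finrank_G_eq_cnt (bits_lt S)
  have h1 : cnt (pk (bits S)) 3 < cnt (pk (bits S)) 1 := by
    have := T.finrank_lt_of_mem_der h0 hr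
    rw [← hn (by norm_num), ← hn (by norm_num)]
    exact_mod_cast this
  have h2 : cnt (pk (bits S)) 4 < cnt (pk (bits S)) 2 := by
    have := T.finrank_lt h0
    rw [← hn (by norm_num), ← hn (by norm_num)]
    exact_mod_cast this
  rw [E8.admissible, blt_of_lt h1, blt_of_lt h2, Bool.true_and, Bool.true_and, List.all_eq_true]
  intro n _
  rw [Bool.and_eq_true, Nat.ble_eq, Nat.beq_eq]
  constructor
  · have := T.finrank_le (k := n + 1) (by omega)
    rw [show (n + 1 + 2 : ℤ) = (n + 3 : ℕ) by push_cast; ring, show (n + 1 : ℤ) = (n + 1 : ℕ) by simp,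
      hn (by omega), hn (by omega)] at this
    exact this
  · have := T.even_finrank (n := 2 * n + 1) ⟨n, rfl⟩
    rw [hn (by omega), Nat.even_iff] at this
    exact this

/-- A reduction of the theorem to the weighted diagrams of the nilpotent orbits. -/
lemma Reach.cent_le_der {h e f : L} (T : Reach h e f)
    (hcase : ∀ S : ℕ, ∀ e f : L, Reach (H (cw (bits S))) e f →
      S ∈ [128, 1, 64, 2, 129, 32, 4, 65, 16, 132, 66, 8, 17, 72] ∨ S ∈ [33, 161, 136, 169] ∨
        S ∈ [160, 36, 137, 164, 81, 41] ∨ S ∈ [68, 80, 20, 73] → cent e ≤ der e) :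
    cent e ≤ der e := by
  have hzero : ∀ {h e f : L}, Reach h e f → h = 0 → cent e ≤ der e := by
    intro h e f T h0
    subst h0
    have he : e = 0 := by
      have := T.lie_he
      rw [zero_lie] at this
      simpa using this.symm
    subst he
    intro x _
    have h1 : x ∈ gz (0 : L) 0 := ⟨by simp [mem_cent], by simp [mem_cent]⟩
    exact brk_mono inf_le_left (T.gz_le h1)
  by_cases h0 : h = 0
  · exact hzero T h0
  obtain ⟨φ, c, hφ⟩ := exists_map_eq_H (h := h) (e := e) (f := f)
    ⟨h0, T.lie_ef, by simpa [two_smul] using T.lie_he, by simpa [two_smul] using T.lie_hf⟩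
  obtain ⟨ψ, d, hψ, hd⟩ := exists_dominant (L := L) c
  refine cent_le_der_of_map φ (cent_le_der_of_map ψ ?_)
  have T := (T.map φ).map ψ
  rw [hφ, hψ] at T
  obtain ⟨S, hS, rfl⟩ := exists_bits (bil_sr_zero_or_one hd T)
  by_cases h0 : cw (bits S) = 0
  · exact hzero T (by rw [h0, map_zero])
  refine hcase S _ _ T (mem_of_admissible S hS (fun h ↦ h0 (by rw [h, cw_bits_zero])) ?_)
  exact T.triple.admissible h0 T.mem_der

end E8

namespace E8

open ChevalleyBasis Module

/-- A coordinate of a combination of terms. -/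
def coord (l : List Term) (k : ℕ) : ℤ :=
  bif Nat.blt k 240 then coef l (code k) else
    (l.map fun t ↦ bif t.h then t.z * dec t.n (Fin.ofNat 8 k) else 0).sum

/-- A test for linear independence: each combination has a nonzero coordinate which vanishes on the
following combinations. -/
def pivots : List (List Term × ℕ) → Bool
  | [] => true
  | p :: l => !(coord p.1 p.2 == 0) && (l.all fun q ↦ coord q.1 p.2 == 0) && pivots l

section

variable (L : Type*) [LieRing L] [LieAlgebra ℂ L] [ChevalleyBasis L]

lemma exists_coord (k : ℕ) :
    ∃ φ : L →ₗ[ℂ] ℂ, ∀ l : List Term, (∀ x ∈ l, IsCode x.n) → φ (val L l) = coord l k := by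
  rcases lt_or_ge k 240 with h | h
  · refine ⟨basis.coord (Sum.inr ⟨dec (code k), (isCode_code h).isRoot⟩), fun l hl ↦ ?_⟩
    rw [Basis.coord_apply, repr_val L hl (isCode_code h), coord, blt_of_lt h, cond_true]
  · refine ⟨basis.coord (Sum.inl (Fin.ofNat 8 k)), fun l hl ↦ ?_⟩
    rw [coord, blt_of_le h, cond_false]
    generalize Fin.ofNat 8 k = i
    induction l with
    | nil => simp [val]
    | cons t l ih =>
      have ht := hl t (by simp)
      rw [val_cons, map_add, ih fun v hv ↦ hl v (by simp [hv]), List.map_cons, List.sum_cons,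
        Int.cast_add]
      congr 1
      rw [valT, map_smul, Basis.coord_apply]
      rcases Bool.eq_false_or_eq_true t.h with h | h
      · rw [h, cond_true, cond_true, H_eq_sum]
        simp [← basis_inl, Finsupp.single_apply]
      · rw [h, cond_false, cond_false, ← basis_inr (⟨_, ht.isRoot⟩ : {a : Q // IsRoot a}),
          Basis.repr_self]
        simp

variable {L}

lemma length_le_finrank [FiniteDimensional ℂ L] {l : List (List Term × ℕ)} (hl : pivots l = true)
    (hc : ∀ p ∈ l, ∀ x ∈ p.1, IsCode x.n) (W : Submodule ℂ L) (hW : ∀ p ∈ l, val L p.1 ∈ W) :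
    l.length ≤ finrank ℂ W := by
  induction l generalizing W with
  | nil => exact Nat.zero_le _
  | cons p l ih =>
    simp only [pivots, Bool.and_eq_true, List.all_eq_true, beq_iff_eq, Bool.not_eq_true',
      beq_eq_false_iff_ne] at hl
    obtain ⟨φ, hφ⟩ := exists_coord L p.2
    have h1 := ih hl.2 (fun q hq ↦ hc q (by simp [hq])) (W ⊓ LinearMap.ker φ) fun q hq ↦
      ⟨hW q (by simp [hq]), by
        change φ _ = 0
        rw [hφ _ (hc q (by simp [hq])), hl.1.2 q hq, Int.cast_zero]⟩
    have h2 : finrank ℂ ↥(W ⊓ LinearMap.ker φ) < finrank ℂ W := by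
      refine Submodule.finrank_lt_finrank_of_lt (inf_le_left.lt_of_ne fun h ↦ hl.1.1 ?_)
      have h3 : val L p.1 ∈ W ⊓ LinearMap.ker φ := by
        rw [h]
        exact hW p (by simp)
      have h4 : φ (val L p.1) = 0 := h3.2
      rwa [hφ _ (hc p (by simp)), Int.cast_eq_zero] at h4
    rw [List.length_cons]
    omega

lemma le_span_of_pivots [FiniteDimensional ℂ L] {l : List (List (ℤ × ℕ) × ℕ)}
    (hl : pivots (l.map fun p ↦ (vec p.1, p.2)) = true) (hv : ∀ p ∈ l, valid p.1 = true)
    {W : Submodule ℂ L} (hW : ∀ p ∈ l, el L p.1 ∈ W) (hr : finrank ℂ W ≤ l.length) :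
    W ≤ Submodule.span ℂ {v | ∃ p ∈ l, el L p.1 = v} := by
  have h1 : Submodule.span ℂ {v | ∃ p ∈ l, el L p.1 = v} ≤ W := by
    rw [Submodule.span_le]
    rintro _ ⟨p, hp, rfl⟩
    exact hW p hp
  refine (Submodule.eq_of_le_of_finrank_le h1 ?_).ge
  refine hr.trans ?_
  have := length_le_finrank hl (fun p hp ↦ ?_)
    (Submodule.span ℂ {v | ∃ p ∈ l, el L p.1 = v}) (fun p hp ↦ ?_)
  · rwa [List.length_map] at this
  · obtain ⟨q, hq, rfl⟩ := List.mem_map.1 hp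
    exact isCode_vec (hv q hq)
  · obtain ⟨q, hq, rfl⟩ := List.mem_map.1 hp
    exact Submodule.subset_span ⟨q, hq, rfl⟩

/-- The dimension of a homogeneous component. -/
def dimG (p n : ℕ) : ℕ := bif Nat.beq n 0 then 8 + 2 * cnt p 0 else cnt p n

lemma finrank_G_le {y : Fin 8 → ℕ} (hy : ∀ i, y i < 16) (n : ℕ) :
    finrank ℂ (G L (cw y) n) ≤ dimG (pk y) n := by
  rcases Nat.eq_zero_or_pos n with rfl | hn
  swap
  · rw [finrank_G_eq_cnt hy hn, dimG, Bool.eq_false_iff.2 fun h ↦ hn.ne' (Nat.eq_of_beq_eq_true h),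
      cond_false]
  have h1 : cnt (pk y) 0 = Fintype.card {a : {a : Q // IsRoot a} // bil (cw y) a.1 = 0 ∧ 0 ≤ a.1} := by
    rw [card_root (P := fun a ↦ bil (cw y) a = 0 ∧ 0 ≤ a) fun a h ↦ h.2, cnt_eq]
    congr 1
    refine Finset.filter_congr fun k hk ↦ ?_
    have hk := Finset.mem_range.1 hk
    rw [← dot_code hy hk, Nat.cast_eq_zero]
    exact (and_iff_left (root_nonneg hk)).symm
  have h2 : dimG (pk y) 0 = Fintype.card (Fin 8 ⊕ {a : {a : Q // IsRoot a} // bil (cw y) a.1 = 0 ∧ 0 ≤ a.1} ⊕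
      {a : {a : Q // IsRoot a} // bil (cw y) a.1 = 0 ∧ 0 ≤ a.1}) := by
    rw [Fintype.card_sum, Fintype.card_sum, ← h1, Fintype.card_fin, ← two_mul]
    rfl
  rw [finrank_G, h2]
  refine Fintype.card_le_of_surjective (fun i ↦ match i with
    | .inl i => ⟨.inl i, rfl⟩
    | .inr (.inl a) => ⟨.inr a.1, a.2.1⟩
    | .inr (.inr a) => ⟨.inr ⟨-a.1.1, a.1.2.neg⟩, by
      change bil (cw y) (-a.1.1) = 0
      rw [bil_neg_right, a.2.1, neg_zero]⟩) ?_
  rintro ⟨i | ⟨a, ha⟩, h⟩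
  · exact ⟨.inl i, rfl⟩
  · have h : bil (cw y) a = 0 := h
    rcases ha.nonneg_or with h0 | h0
    · exact ⟨.inr (.inl ⟨⟨a, ha⟩, h, h0⟩), rfl⟩
    · refine ⟨.inr (.inr ⟨⟨-a, ha.neg⟩, by rw [bil_neg_right, h, neg_zero], neg_nonneg.2 h0⟩), ?_⟩
      simp

/-- A test for an `sl₂`-triple. -/
def isTriple (S : ℕ) (es fs : List (ℤ × ℕ)) : Bool :=
  hasWt (pk (bits S)) 2 es && hasWt (pk (bits S)) (-2) fs && lieEq es fs (corootSum (cw (bits S)))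

lemma triple_of_isTriple {S : ℕ} {es fs : List (ℤ × ℕ)} (h : isTriple S es fs = true) :
    Triple (cw (bits S)) (el L es) (el L fs) := by
  simp only [isTriple, Bool.and_eq_true] at h
  exact ⟨el_mem_G (bits_lt S) h.1.1, el_mem_G (bits_lt S) h.1.2, by
    rw [lie_el_eq (valid_of_hasWt h.1.1) (valid_of_hasWt h.1.2) h.2, el_corootSum]⟩

lemma Reach.exists_of_isTriple {S : ℕ} {es fs : List (ℤ × ℕ)} {e f : L}
    (T : Reach (H (cw (bits S))) e f) (h : isTriple S es fs = true) :
    (∃ f', Reach (H (cw (bits S))) (el L es) f') ∧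
      (cent (el L es) ≤ der (el L es) → cent e ≤ der e) :=
  have h1 := triple_of_isTriple (L := L) h
  T.exists_reach h1.he fun _ hz ↦ h1.surjective (by norm_num) (by simpa using hz)

/-- A test for a basis of a homogeneous component of a centralizer. -/
def isBasis (S n : ℕ) (es : List (ℤ × ℕ)) (l : List (List (ℤ × ℕ) × ℕ)) : Bool :=
  (l.all fun p ↦ hasWt (pk (bits S)) n p.1 && lieZero es p.1) &&
    pivots (l.map fun p ↦ (vec p.1, p.2)) &&
    Nat.ble (dimG (pk (bits S)) n) (l.length + cnt (pk (bits S)) (n + 2))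

lemma G_inf_cent_le {S n : ℕ} {es : List (ℤ × ℕ)} {l : List (List (ℤ × ℕ) × ℕ)} {f : L}
    (T : Triple (cw (bits S)) (el L es) f) (hes : valid es = true) (hl : isBasis S n es l = true) :
    G L (cw (bits S)) n ⊓ cent (el L es) ≤ Submodule.span ℂ {v | ∃ p ∈ l, el L p.1 = v} := by
  have : FiniteDimensional ℂ L := finiteDimensional_of_chevalleyBasis
  simp only [isBasis, Bool.and_eq_true, List.all_eq_true] at hl
  refine le_span_of_pivots hl.1.2 (fun p hp ↦ valid_of_hasWt (hl.1.1 p hp).1) (fun p hp ↦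
    ⟨el_mem_G (bits_lt S) (hl.1.1 p hp).1, mem_cent.2
      (lie_el_eq_zero hes (valid_of_hasWt (hl.1.1 p hp).1) (hl.1.1 p hp).2)⟩) ?_
  have h1 := T.finrank_ker (k := n) (by omega)
  have h2 := finrank_G_le (L := L) (bits_lt S) n
  have h3 := finrank_G_eq_cnt (L := L) (bits_lt S) (n := n + 2) (by omega)
  rw [Nat.cast_add, Nat.cast_ofNat] at h3
  have h4 := Nat.le_of_ble_eq_true hl.2
  omega

/-- A test for the weight of the terms in a combination under a difference of two packed
coweights. -/
def hasWtSub (p q : ℕ) (n : ℤ) (l : List (ℤ × ℕ)) : Bool :=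
  l.all fun t ↦ Nat.blt t.2 480 && wt p t.2 - wt q t.2 == n

lemma el_mem_G_sub {y z : Fin 8 → ℕ} (hy : ∀ i, y i < 16) (hz : ∀ i, z i < 16) {n : ℤ}
    {l : List (ℤ × ℕ)} (h : hasWtSub (pk y) (pk z) n l = true) : el L l ∈ G L (cw y - cw z) n := by
  rw [hasWtSub, List.all_eq_true] at h
  refine list_sum_mem fun x hx ↦ ?_
  obtain ⟨u, hu, rfl⟩ := List.mem_map.1 hx
  obtain ⟨t, ht, rfl⟩ := List.mem_map.1 hu
  obtain ⟨h1, h2⟩ := Bool.and_eq_true _ _ ▸ h t ht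
  have h1 := lt_of_blt h1
  have h2 := beq_iff_eq.1 h2
  refine Submodule.smul_mem _ _ ?_
  rcases lt_or_ge t.2 240 with h3 | h3
  · rw [blt_of_lt h3, cond_true, cond_false, ← h2, wt_pk hy h3, wt_pk hz h3, ← bil_sub_left]
    exact R_mem_G _ (isRoot_root h3)
  · rw [wt_of_le _ h3, wt_of_le _ h3] at h2
    rw [blt_of_le (by omega), cond_false, cond_true, ← h2]
    exact H_mem_G _ _

end

end E8

namespace E8

open ChevalleyBasis Module

section

variable {L : Type*} [LieRing L] [LieAlgebra ℂ L] [ChevalleyBasis L] {c : Q} {e f : L}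

local notation "κ" => killingForm ℂ L

/-- If the reductive part of the centralizer has a central torus then it is not perfect. -/
lemma Reach.eq_zero_of_gz_le (T : Reach (H c) e f) {t : Q} (he : e ∈ G L t 0)
    (ht : gz (H c) e ≤ G L t 0) {a : Q} (ha : IsRoot a) : bil t a = 0 := by
  by_contra hta
  refine kil_H_self_ne (L := L) ha hta ?_
  rw [mem_G, Int.cast_zero, zero_smul] at he
  have h1 : (H t : L) ∈ brk (gz (H c) e) := T.gz_le ⟨
    mem_cent.2 (by rw [← lie_skew, he, neg_zero]), mem_cent.2 (lie_H_H c t)⟩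
  have h3 : brk (gz (H c) e) ≤ LinearMap.ker (κ (H t)) := by
    rw [brk, Submodule.span_le]
    rintro _ ⟨x, hx, y, -, rfl⟩
    have h := ht hx
    rw [mem_G, Int.cast_zero, zero_smul] at h
    change κ _ _ = 0
    rw [← kil_lie, h, map_zero, LinearMap.zero_apply]
  exact h3 h1

/-- A certificate for a central torus in the reductive part of the centralizer. -/
def torusTest : ℕ × List (ℤ × ℕ) × List (ℤ × ℕ) × ℕ × ℕ × List (List (ℤ × ℕ) × ℕ) → Bool
  | (S, es, fs, p, q, l) => isTriple S es fs && hasWtSub (pk (hexits p)) (pk (hexits q)) 0 es &&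
    (!(List.finRange 8).all fun i ↦ Nat.beq (hexits p i) (hexits q i)) && isBasis S 0 es l &&
    l.all fun x ↦ hasWtSub (pk (hexits p)) (pk (hexits q)) 0 x.1

lemma Reach.false_of_torusTest {S : ℕ} {es fs : List (ℤ × ℕ)} {p q : ℕ}
    {l : List (List (ℤ × ℕ) × ℕ)} {e f : L}
    (T : Reach (H (cw (bits S))) e f) (h : torusTest (S, es, fs, p, q, l) = true) : False := by
  simp only [torusTest, Bool.and_eq_true] at h
  obtain ⟨⟨⟨⟨h1, h2⟩, h3⟩, h4⟩, h5⟩ := h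
  obtain ⟨f', T'⟩ := (T.exists_of_isTriple h1).1
  have h6 := G_inf_cent_le T'.triple (by
    simp only [isTriple, Bool.and_eq_true] at h1
    exact valid_of_hasWt h1.1.1) h4
  rw [Nat.cast_zero, ← gz_H] at h6
  have h7 : ∀ i, hexits p i = hexits q i := fun i ↦ by
    have h8 := T'.eq_zero_of_gz_le (el_mem_G_sub (hexits_lt p) (hexits_lt q) h2) (h6.trans (by
      rw [Submodule.span_le]
      rintro _ ⟨x, hx, rfl⟩
      exact el_mem_G_sub (hexits_lt p) (hexits_lt q) (List.all_eq_true.1 h5 x hx))) (isRoot_sr i)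
    rw [bil_sub_left, bil_cw_sr, bil_cw_sr] at h8
    omega
  rw [Bool.not_eq_true', ← Bool.not_eq_true, List.all_eq_true] at h3
  exact h3 fun i _ ↦ (Nat.beq_eq ..).mpr (h7 i)

/-- Certificates for four orbits whose reductive centralizer is not perfect. -/
def torusData : List (ℕ × List (ℤ × ℕ) × List (ℤ × ℕ) × ℕ × ℕ × List (List (ℤ × ℕ) × ℕ)) := [
  (33, [(1, 42), (1, 46), (1, 60), (1, 66), (1, 84)], [(-2, 180), (-2, 186), (-3, 204), (-3, 166), (-4, 162)], 1074790912, 33685505, [([(1, 11)], 11), ([(1, 24)], 24), ([(1, 131)], 131), ([(1, 144)], 144), ([(1, 251)], 243), ([(1, 130), (-1, 33)], 33), ([(1, 136), (1, 29)], 29), ([(1, 149), (1, 16)], 16), ([(1, 153), (-1, 10)], 10), ([(1, 262), (1, 246)], 244), ([(1, 262), (1, 240)], 242)]),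
  (161, [(1, 15), (1, 32), (1, 40), (1, 56), (1, 68)], [(-6, 176), (-6, 188), (-4, 152), (-1, 160), (-4, 135)], 100925952, 810557473, [([(1, 23)], 23), ([(1, 17)], 17), ([(1, 33)], 33), ([(1, 143)], 143), ([(1, 137)], 137), ([(1, 153)], 153), ([(1, 262), (1, 251)], 243), ([(1, 250), (-1, 262), (1, 246)], 244), ([(-1, 250), (1, 262), (1, 241)], 241)]),
  (136, [(1, 15), (1, 32), (1, 34), (1, 38), (1, 61), (1, 64)], [(-6, 181), (-6, 184), (-4, 152), (-1, 154), (-1, 158), (-4, 135)], 2098176, 268439618, [([(1, 121), (1, 6)], 6), ([(1, 126), (1, 1)], 1), ([(-1, 246), (1, 241)], 246), ([(-1, 250), (1, 262), (1, 246), (1, 243)], 241)]),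
  (169, [(1, 5), (1, 9), (1, 13), (1, 31), (1, 33), (1, 44), (1, 50)], [(-11, 170), (-7, 169), (-7, 165), (-11, 164), (-13, 151), (-8, 153), (7, 138), (7, 146), (-13, 133), (-7, 129), (-7, 125)], 269484544, 33558529, [([(-1, 262), (1, 241)], 242)])]

set_option maxRecDepth 10000 in
lemma torusData_test : torusData.all torusTest = true := by decide +kernel

lemma false_of_torus {S : ℕ} (hS : S ∈ [33, 161, 136, 169]) {e f : L}
    (T : Reach (H (cw (bits S))) e f) : False := by
  have h := List.all_eq_true.1 torusData_test
  have h1 : [33, 161, 136, 169] = torusData.map Prod.fst := rfl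
  rw [h1] at hS
  obtain ⟨⟨S, es, fs, p, q, l⟩, hd, rfl⟩ := List.mem_map.1 hS
  exact T.false_of_torusTest (h _ hd)

end

end E8

namespace E8

open ChevalleyBasis Module

section

variable {L : Type*} [LieRing L] [LieAlgebra ℂ L] [ChevalleyBasis L] {c : Q} {e f : L}

local notation "κ" => killingForm ℂ L

lemma kil_R_eq {a : Q} (ha : IsRoot a) (v : L) :
    κ (R (-a)) v = basis.repr v (Sum.inr ⟨a, ha⟩) * κ (R a) (R (-a)) := by
  suffices κ (R (-a)) = κ (R a) (R (-a)) • basis.coord (Sum.inr ⟨a, ha⟩) by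
    rw [this, LinearMap.smul_apply, Basis.coord_apply, smul_eq_mul, mul_comm]
  refine basis.ext fun i ↦ ?_
  rw [LinearMap.smul_apply, Basis.coord_apply, Basis.repr_self]
  rcases i with i | ⟨b, hb⟩
  · rw [basis_inl, kil_G (c := a) ?_ (R_mem_G a ha.neg) (H_mem_G a _)]
    · simp
    · rw [bil_neg_right, show bil a a = 2 from ha]
      norm_num
  · rw [basis_inr, Finsupp.single_apply]
    split_ifs with h
    · obtain rfl : b = a := by simpa using h
      rw [kil_comm, smul_eq_mul, mul_one]
    · rw [kil_R_R_of_ne ha.neg hb, smul_zero]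
      intro h1
      exact h (by rw [neg_add_eq_zero] at h1; subst h1; rfl)

lemma exists_two_mul_kil_R {a : Q} (ha : IsRoot a) :
    ∃ r : ℕ, 0 < r ∧ 2 * κ (R a) (R (-a)) = -(r : ℂ) := by
  have h : 0 < ∑ i : Idx, deg a i * deg a i :=
    Finset.sum_pos' (fun i _ ↦ mul_self_nonneg _) ⟨Sum.inr ⟨a, ha⟩, Finset.mem_univ _, by
      change 0 < bil a a * bil a a
      rw [show bil a a = 2 from ha]
      norm_num⟩
  obtain ⟨r, hr⟩ := Int.eq_ofNat_of_zero_le h.le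
  refine ⟨r, by omega, ?_⟩
  rw [two_mul_kil_R_R_neg ha, kil_H_H]
  congr 1
  exact_mod_cast hr

/-- A test for a combination which has a negative Killing product with `es`. -/
def isOpp (es y : List (ℤ × ℕ)) : Bool :=
  y.all fun t ↦ Nat.ble 120 t.2 && Nat.blt t.2 240 && decide (0 < t.1) &&
    decide (0 < cf es (Nat.sub t.2 120))

lemma kil_isOpp {es y : List (ℤ × ℕ)} (hes : valid es = true) (h : isOpp es y = true) :
    ∃ r : ℕ, (y ≠ [] → 0 < r) ∧ 2 * κ (el L y) (el L es) = -(r : ℂ) := by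
  induction y with
  | nil => exact ⟨0, by simp [el, vec, val]⟩
  | cons t y ih =>
    rw [isOpp, List.all_cons, Bool.and_eq_true, ← isOpp] at h
    obtain ⟨r, -, hr⟩ := ih h.2
    obtain ⟨⟨⟨h1, h2⟩, h3⟩, h4⟩ := by simpa only [Bool.and_eq_true, decide_eq_true_eq] using h.1
    have h2 := lt_of_blt h2
    obtain ⟨k, hk⟩ := Nat.exists_eq_add_of_le' (Nat.le_of_ble_eq_true h1)
    have hk' : Nat.sub t.2 120 = k := by rw [hk]; exact Nat.add_sub_cancel ..
    rw [hk'] at h4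
    have hk'' : k < 240 := by omega
    obtain ⟨s, hs, hs'⟩ := exists_two_mul_kil_R (L := L) (isRoot_root hk'')
    have h5 : el L (t :: y) = (t.1 : ℂ) • R (-root k) + el L y := by
      rw [el, vec, List.map_cons, val_cons, blt_of_lt h2, cond_true, valT, cond_false, el, vec,
        ← root_add (by omega), ← hk]
      rfl
    obtain ⟨m, hm⟩ := Int.eq_ofNat_of_zero_le h3.le
    obtain ⟨n, hn⟩ := Int.eq_ofNat_of_zero_le h4.le
    refine ⟨m * n * s + r, fun _ ↦ ?_, ?_⟩
    · have : 0 < m * n * s := Nat.mul_pos (Nat.mul_pos (by omega) (by omega)) hs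
      omega
    · rw [h5, map_add, LinearMap.add_apply, map_smul, LinearMap.smul_apply,
        kil_R_eq (isRoot_root hk''), repr_el hes hk'', hn, hm, smul_eq_mul]
      push_cast
      linear_combination hr + (m : ℂ) * n * hs'

/-- An obstruction to reachability. -/
lemma kil_eq_zero_of_reach (T : Reach (H c) e f) {y : L} {s t : Set L}
    (hs : G L c 0 ⊓ cent e ≤ Submodule.span ℂ s) (ht : G L c 1 ⊓ cent e ≤ Submodule.span ℂ t)
    (h : ∀ x ∈ s ∪ t, ∃ w, ⁅y, x⁆ = ⁅e, w⁆) : κ y e = 0 := by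
  have h1 : Submodule.span ℂ (s ∪ t) ≤ (LinearMap.range (LieAlgebra.ad ℂ L e)).comap (LieAlgebra.ad ℂ L y) := by
    rw [Submodule.span_le]
    intro x hx
    obtain ⟨w, hw⟩ := h x hx
    exact ⟨w, hw.symm⟩
  have h2 : ∀ x ∈ Submodule.span ℂ (s ∪ t), ∀ z ∈ cent e, κ y ⁅x, z⁆ = 0 := fun x hx z hz ↦ by
    obtain ⟨w, hw⟩ := h1 hx
    rw [LieAlgebra.ad_apply, LieAlgebra.ad_apply] at hw
    rw [← kil_lie, ← hw, ← lie_skew, map_neg, LinearMap.neg_apply, kil_lie, mem_cent.1 hz, map_zero,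
      neg_zero]
  exact T.triple.map_eq_zero_of_mem_der (κ y)
    (fun x hx z hz ↦ h2 x (Submodule.span_mono Set.subset_union_left (hs hx)) z hz.2)
    (fun x hx z hz ↦ h2 x (Submodule.span_mono Set.subset_union_right (ht hx)) z hz.2) T.mem_der

/-- A test for a list of elements which are sent by `ad y` to the image of `ad es`. -/
def isLift (es y : List (ℤ × ℕ)) (l : List (List (ℤ × ℕ) × ℕ × List (ℤ × ℕ))) : Bool :=
  l.all fun p ↦ valid p.1 && valid p.2.2 && isZero (lieL (vec y) (vec p.1) ++ lieL (vec (negL es)) (vec p.2.2))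

lemma exists_of_isLift {es y : List (ℤ × ℕ)} {l : List (List (ℤ × ℕ) × ℕ × List (ℤ × ℕ))}
    (hes : valid es = true) (hy : valid y = true) (hl : isLift es y l = true)
    {p : List (ℤ × ℕ) × ℕ × List (ℤ × ℕ)} (hp : p ∈ l) :
    ∃ w : L, ⁅el L y, el L p.1⁆ = ⁅el L es, w⁆ := by
  have h := List.all_eq_true.1 hl p hp
  simp only [Bool.and_eq_true] at h
  have h1 := val_eq_zero L h.2
  rw [val_append, ← lie_el hy h.1.1, ← lie_el (valid_negL hes) h.1.2, el_negL, neg_lie,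
    add_neg_eq_zero] at h1
  exact ⟨_, h1⟩

/-- A certificate for a nilpotent element which is not reachable. -/
def notReachTest : ℕ × List (ℤ × ℕ) × List (ℤ × ℕ) × List (ℤ × ℕ) ×
    List (List (ℤ × ℕ) × ℕ × List (ℤ × ℕ)) × List (List (ℤ × ℕ) × ℕ × List (ℤ × ℕ)) → Bool
  | (S, es, fs, y, l, m) => isTriple S es fs && valid y && !y.isEmpty && isOpp es y &&
    isBasis S 0 es (l.map fun p ↦ (p.1, p.2.1)) && isBasis S 1 es (m.map fun p ↦ (p.1, p.2.1)) &&
    isLift es y (l ++ m)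

lemma Reach.false_of_notReachTest {S : ℕ} {es fs y : List (ℤ × ℕ)}
    {l m : List (List (ℤ × ℕ) × ℕ × List (ℤ × ℕ))} {e f : L}
    (T : Reach (H (cw (bits S))) e f) (h : notReachTest (S, es, fs, y, l, m) = true) : False := by
  simp only [notReachTest, Bool.and_eq_true] at h
  obtain ⟨⟨⟨⟨⟨⟨h1, h2⟩, h3⟩, h4⟩, h5⟩, h6⟩, h7⟩ := h
  obtain ⟨f', T'⟩ := (T.exists_of_isTriple h1).1
  have hes : valid es = true := by
    simp only [isTriple, Bool.and_eq_true] at h1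
    exact valid_of_hasWt h1.1.1
  obtain ⟨r, hr, hr'⟩ := kil_isOpp (L := L) hes h4
  have h8 : κ (el L y) (el L es) = 0 := by
    refine kil_eq_zero_of_reach T' (G_inf_cent_le T'.triple hes h5)
      (G_inf_cent_le T'.triple hes h6) ?_
    rintro x (⟨p, hp, rfl⟩ | ⟨p, hp, rfl⟩) <;> obtain ⟨q, hq, rfl⟩ := List.mem_map.1 hp
    · exact exists_of_isLift hes h2 h7 (List.mem_append_left _ hq)
    · exact exists_of_isLift hes h2 h7 (List.mem_append_right _ hq)
  rw [h8, mul_zero, zero_eq_neg, Nat.cast_eq_zero] at hr'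
  exact (hr (by rintro rfl; exact absurd h3 (by decide))).ne' hr'

end

/-- Certificates for six nilpotent orbits which are not reachable. -/
def notReachData : List (ℕ × List (ℤ × ℕ) × List (ℤ × ℕ) × List (ℤ × ℕ) ×
    List (List (ℤ × ℕ) × ℕ × List (ℤ × ℕ)) × List (List (ℤ × ℕ) × ℕ × List (ℤ × ℕ))) := [
  (160, [(1, 15), (1, 53), (1, 61), (1, 99)],
    [(-3, 173), (-1, 181), (-4, 219), (-3, 135)],
    [(1, 219)],
    [
      ([(1, 1)], 1, []), ([(1, 6)], 6, []), ([(1, 16)], 16, []), ([(1, 17)], 17, []),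
      ([(1, 44)], 44, []), ([(1, 45)], 45, []), ([(1, 54)], 54, []), ([(1, 121)], 121, []),
      ([(1, 126)], 126, []), ([(1, 136)], 136, []), ([(1, 137)], 137, []), ([(1, 164)], 164, []),
      ([(1, 165)], 165, []), ([(1, 174)], 174, []), ([(1, 246)], 244, []), ([(1, 241)], 246, []),
      ([(-1, 11), (1, 49)], 11, []), ([(-1, 12), (1, 50)], 12, []), ([(1, 130), (1, 43)], 43, []),
      ([(1, 163), (1, 10)], 10, []), ([(1, 169), (-1, 131)], 131, []),
      ([(1, 170), (-1, 132)], 132, []), ([(1, 250), (1, 251)], 243, []),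
      ([(1, 261), (-1, 250), (1, 262)], 240, [])],
    [
      ([(1, 3)], 3, []), ([(1, 4)], 4, []), ([(1, 7)], 7, []), ([(1, 8)], 8, []),
      ([(1, 18)], 18, []), ([(1, 46)], 46, []), ([(1, 19)], 19, []), ([(1, 47)], 47, []),
      ([(1, 55)], 55, []), ([(1, 58)], 58, []), ([(1, 56)], 56, []), ([(1, 59)], 59, []),
      ([(-1, 13), (1, 51)], 13, []), ([(-1, 14), (1, 52)], 14, [])]),
  (36, [(1, 32), (1, 35), (1, 37), (1, 46), (1, 57), (1, 59), (1, 64)],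
    [(-2, 177), (-4, 179), (-1, 184), (-6, 166), (-6, 152), (-4, 155), (-2, 157)],
    [(1, 177), (5, 179), (1, 184)],
    [
      ([(-1, 261), (-3, 250), (1, 246), (2, 241), (2, 240)], 240, []),
      ([(1, 131), (2, 126), (-2, 121), (-1, 120), (3, 17), (-1, 21)], 21, [(17, 193), (-2, 198), (2, 200), (3, 216)]),
      ([(-1, 141), (1, 137), (-2, 0), (-1, 1), (2, 6), (3, 11)], 1, [(-8, 191), (-8, 209), (5, 211)])],
    [
      ([(-1, 18), (1, 49)], 18, [(1, 196)]), ([(1, 15), (-1, 24)], 24, []),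
      ([(1, 9), (1, 14), (2, 23), (-1, 45)], 23, [(2, 181), (-2, 185), (-3, 205)]),
      ([(-1, 3), (1, 19), (-1, 28), (2, 50)], 3, [(-8, 190), (2, 195), (8, 162)]),
      ([(1, 5), (1, 8), (1, 13), (-1, 22), (3, 33), (2, 44)], 22, [(1, 182), (-2, 186), (-1, 188), (3, 206), (-2, 160)]),
      ([(1, 4), (1, 7), (-1, 20), (-2, 29), (-1, 43), (3, 54)], 4, [(8, 183), (4, 187), (-7, 189), (1, 194), (-1, 161)])]),
  (137, [(1, 15), (1, 32), (1, 33), (1, 40), (1, 44), (1, 50)],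
    [(-8, 170), (-8, 164), (-5, 152), (-1, 153), (-9, 160), (-5, 135)],
    [(1, 170)],
    [
      ([(1, 1)], 1, []), ([(1, 121)], 121, []), ([(1, 241)], 246, []),
      ([(1, 130), (-1, 6), (1, 22)], 22, [(1, 207)]),
      ([(-1, 142), (1, 126), (-1, 10)], 10, [(1, 200)]), ([(-1, 250), (1, 262), (1, 246)], 241, [])],
    [
      ([(1, 16)], 16, []), ([(1, 24)], 24, []), ([(-1, 11), (1, 17), (1, 28)], 11, [(1, 191)]),
      ([(-1, 12), (-1, 23), (1, 29)], 23, [(-1, 181)])]),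
  (164, [(1, 9), (1, 25), (1, 31), (1, 35), (1, 55), (1, 59), (1, 64)],
    [(2, 171), (-7, 175), (-2, 179), (-6, 184), (-2, 151), (-5, 155), (-2, 145), (-5, 135), (-10, 129)],
    [(1, 155)],
    [
      ([(1, 141), (1, 121), (1, 6), (-2, 12), (-1, 10)], 10, [(1, 183), (1, 187)]),
      ([(-1, 136), (2, 130), (1, 132), (-1, 1), (-1, 21)], 1, [(-1, 206), (-1, 161)]),
      ([(1, 261), (-2, 250), (-2, 251), (-2, 246), (1, 241)], 240, [])],
    [
      ([(-1, 4), (1, 43)], 4, [(-1, 159)]), ([(-1, 18), (1, 29)], 18, []),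
      ([(-1, 3), (-1, 8), (2, 14), (-1, 22), (2, 45)], 3, [(2, 152), (-2, 156)]),
      ([(1, 7), (-2, 13), (2, 24), (1, 19), (1, 50)], 7, [(1, 177), (-1, 147)])]),
  (81, [(1, 26), (1, 27), (1, 20), (1, 35), (1, 37), (1, 45), (1, 51)],
    [(-8, 171), (4, 174), (4, 185), (-8, 165), (4, 156), (-8, 155), (-1, 157), (-6, 140), (2, 139), (-4, 147), (-2, 146), (2, 129), (-4, 128)],
    [(1, 171)],
    [
      ([(-1, 250), (-1, 262), (1, 243)], 241, []),
      ([(1, 131), (1, 123), (1, 22), (-1, 10)], 10, [(-1, 197)]),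
      ([(1, 148), (-1, 130), (1, 142), (1, 3)], 3, [(1, 205)])],
    [
      ([(1, 13)], 13, []), ([(1, 29)], 29, []),
      ([(1, 7), (-1, 12), (-1, 25), (1, 18)], 7, [(1, 186)]),
      ([(1, 6), (-1, 24), (1, 17), (1, 30)], 6, [(-1, 176)])]),
  (41, [(1, 14), (1, 25), (1, 20), (1, 31), (1, 33), (1, 45), (1, 49)],
    [(-10, 169), (-10, 165), (-6, 151), (-1, 153), (-12, 140), (-12, 145), (-6, 134)],
    [(1, 153), (14, 145)],
    [
      ([(1, 142), (1, 121), (2, 120), (-1, 6), (-1, 10)], 10, [(-7, 177), (7, 186), (7, 190), (7, 162)]),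
      ([(1, 130), (1, 126), (-1, 0), (-2, 1), (-1, 22)], 1, [(-7, 175), (-7, 179), (7, 188), (7, 160)]),
      ([(-1, 250), (1, 262), (-1, 246), (2, 241), (2, 240)], 241, [])],
    [
      ([(1, 3), (1, 8), (-2, 12), (1, 16), (3, 29), (1, 21)], 3, [(-8, 173), (-5, 184), (3, 167), (-3, 155), (-8, 159)]),
      ([(1, 4), (1, 9), (-3, 11), (-1, 24), (2, 28), (1, 43)], 11, [(-3, 172), (-5, 174), (8, 166), (6, 154), (-3, 158)])])]

set_option maxRecDepth 100000 in
lemma notReachData_test : notReachData.all notReachTest = true := by decide +kernel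

lemma false_of_notReach {L : Type*} [LieRing L] [LieAlgebra ℂ L] [ChevalleyBasis L] {S : ℕ}
    (hS : S ∈ [160, 36, 137, 164, 81, 41]) {e f : L} (T : Reach (H (cw (bits S))) e f) : False := by
  have h := List.all_eq_true.1 notReachData_test
  have h1 : [160, 36, 137, 164, 81, 41] = notReachData.map Prod.fst := rfl
  rw [h1] at hS
  obtain ⟨⟨S, es, fs, y, l, m⟩, hd, rfl⟩ := List.mem_map.1 hS
  exact T.false_of_notReachTest (h _ hd)

end E8

namespace E8

open ChevalleyBasis Module

/-- A certificate for the nonexistence of an `sl₂`-triple: the element `es` lies in the open orbit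
and kills an element of negative degree. -/
def noTripleTest : ℕ × List (ℤ × ℕ) × List (List (ℤ × ℕ) × ℕ) × ℤ × List (ℤ × ℕ) × ℕ → Bool
  | (S, es, l, n, x, k) => hasWt (pk (bits S)) 2 es && (l.all fun p ↦ hasWt (pk (bits S)) 0 p.1) &&
    pivots (l.map fun p ↦ (lieL (vec es) (vec p.1), p.2)) &&
    Nat.ble (cnt (pk (bits S)) 2) l.length && decide (n < 0) && hasWt (pk (bits S)) n x &&
    lieZero es x && Nat.blt k 240 && !(cf x k == 0)

lemma Reach.false_of_noTripleTest {L : Type*} [LieRing L] [LieAlgebra ℂ L] [ChevalleyBasis L]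
    {S : ℕ} {es x : List (ℤ × ℕ)} {l : List (List (ℤ × ℕ) × ℕ)} {n : ℤ} {k : ℕ} {e f : L}
    (T : Reach (H (cw (bits S))) e f) (h : noTripleTest (S, es, l, n, x, k) = true) : False := by
  have : FiniteDimensional ℂ L := finiteDimensional_of_chevalleyBasis
  simp only [noTripleTest, Bool.and_eq_true, decide_eq_true_eq, Bool.not_eq_true',
    beq_eq_false_iff_ne, List.all_eq_true] at h
  obtain ⟨⟨⟨⟨⟨⟨⟨⟨h1, h2⟩, h3⟩, h4⟩, h5⟩, h6⟩, h7⟩, h8⟩, h9⟩ := h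
  have hes := valid_of_hasWt h1
  have he : el L es ∈ G L (cw (bits S)) 2 := el_mem_G (bits_lt S) h1
  have key : G L (cw (bits S)) 2 ≤ (G L (cw (bits S)) 0).map (LieAlgebra.ad ℂ L (el L es)) := by
    have h10 : (G L (cw (bits S)) 0).map (LieAlgebra.ad ℂ L (el L es)) ≤ G L (cw (bits S)) 2 := by
      rintro _ ⟨y, hy, rfl⟩
      exact lie_mem_G he hy
    refine (Submodule.eq_of_le_of_finrank_le h10 ?_).ge
    have h11 := finrank_G_eq_cnt (L := L) (bits_lt S) (n := 2) (by norm_num)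
    have h12 := length_le_finrank h3 (fun p hp ↦ ?_)
      ((G L (cw (bits S)) 0).map (LieAlgebra.ad ℂ L (el L es))) (fun p hp ↦ ?_)
    · rw [List.length_map] at h12
      exact h11.le.trans ((Nat.le_of_ble_eq_true h4).trans h12)
    · obtain ⟨q, hq, rfl⟩ := List.mem_map.1 hp
      exact isCode_lieL (isCode_vec hes) (isCode_vec (valid_of_hasWt (h2 q hq)))
    · obtain ⟨q, hq, rfl⟩ := List.mem_map.1 hp
      exact ⟨_, el_mem_G (bits_lt S) (h2 q hq), lie_el hes (valid_of_hasWt (h2 q hq))⟩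
  obtain ⟨f', T'⟩ := (T.exists_reach he key).1
  have h13 := T'.triple.eq_zero_of_lie h5 (el_mem_G (bits_lt S) h6)
    (lie_el_eq_zero hes (valid_of_hasWt h6) h7)
  have h14 := repr_el (L := L) (valid_of_hasWt h6) (lt_of_blt h8)
  rw [h13, map_zero, Finsupp.zero_apply, eq_comm, Int.cast_eq_zero] at h14
  exact h9 h14

/-- Certificates for four characteristics without nilpotent orbits. -/
def noTripleData : List (ℕ × List (ℤ × ℕ) × List (List (ℤ × ℕ) × ℕ) × ℤ × List (ℤ × ℕ) × ℕ) := [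
  (68, [(1, 32), (1, 35), (1, 48), (1, 61), (1, 68), (1, 84)],
    [
      ([(1, 11)], 74), ([(1, 0)], 36), ([(1, 138)], 47), ([(1, 133)], 52), ([(1, 136)], 26),
      ([(1, 127)], 64), ([(1, 126)], 65), ([(1, 141)], 27), ([(1, 131)], 31), ([(1, 123)], 59),
      ([(1, 18)], 62), ([(1, 13)], 41), ([(1, 17)], 60), ([(1, 12)], 39), ([(1, 16)], 57),
      ([(1, 7)], 40), ([(1, 6)], 38), ([(1, 21)], 56), ([(1, 10)], 53),
      ([(-1, 262), (-1, 251), (-1, 243)], 35), ([(-1, 262), (-1, 251), (-1, 246), (-1, 243)], 68),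
      ([(-1, 261), (-1, 250), (-1, 262), (-1, 251)], 84), ([(-1, 243)], 61),
      ([(1, 251), (1, 246)], 32), ([(-1, 261), (-1, 262), (1, 246)], 48)],
    -1, [(1, 178), (1, 153), (-1, 140), (-2, 144), (-1, 134)], 144),
  (80, [(1, 8), (1, 36), (1, 53), (1, 56), (1, 74)],
    [
      ([(1, 143)], 58), ([(1, 131)], 68), ([(1, 23)], 26), ([(1, 11)], 14), ([(1, 0)], 9),
      ([(1, 148)], 15), ([(1, 164)], 37), ([(1, 163)], 20), ([(1, 136)], 27), ([(1, 141)], 32),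
      ([(1, 130)], 48), ([(1, 120)], 35), ([(1, 49)], 52), ([(1, 28)], 31), ([(1, 44)], 47),
      ([(1, 43)], 67), ([(1, 16)], 19), ([(1, 22)], 66), ([(1, 21)], 57), ([(1, 10)], 84),
      ([(1, 250), (2, 262), (1, 251), (-1, 240)], 53), ([(1, 262)], 56),
      ([(2, 250), (2, 262), (1, 251), (-1, 240)], 74),
      ([(1, 261), (1, 250), (3, 262), (1, 251), (-1, 240)], 36),
      ([(1, 261), (2, 250), (4, 262), (2, 251), (-1, 240)], 8)],
    -1, [(1, 137)], 137),
  (20, [(1, 25), (1, 29), (1, 35), (1, 48), (1, 52), (1, 54), (1, 57)],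
    [
      ([(1, 21)], 46), ([(1, 3)], 55), ([(1, 10)], 30), ([(1, 0)], 53), ([(1, 124)], 50),
      ([(1, 141)], 36), ([(1, 4)], 31), ([(1, 11)], 33), ([(1, 120)], 56), ([(1, 130)], 47),
      ([(1, 136)], 45), ([(1, 123)], 24), ([(1, 121)], 51), ([(1, 5)], 32), ([(1, 2)], 27),
      ([(1, 16)], 34), ([(1, 1)], 26),
      ([(-2, 261), (-2, 250), (-3, 262), (-5, 251), (-4, 246), (-2, 243), (-1, 241)], 54),
      ([(1, 251), (2, 246), (1, 243), (1, 241)], 57),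
      ([(-2, 261), (-2, 250), (-3, 262), (-3, 251), (-2, 246), (-2, 243), (-1, 241)], 52),
      ([(-1, 262), (-1, 251), (-1, 241)], 35),
      ([(-1, 262), (1, 251), (2, 246), (2, 243), (1, 241)], 29),
      ([(-1, 261), (-1, 250), (-2, 262), (-2, 251), (-1, 246), (-1, 243)], 25),
      ([(1, 250), (1, 251), (1, 246), (1, 243)], 48)],
    -1, [(1, 138)], 138),
  (73, [(1, 15), (1, 26), (1, 20), (1, 37), (1, 46), (1, 49)],
    [
      ([(1, 120)], 19), ([(1, 10)], 31), ([(1, 127)], 33), ([(1, 126)], 34), ([(1, 142)], 14),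
      ([(1, 123)], 45), ([(1, 130)], 44), ([(1, 7)], 51), ([(1, 6)], 50), ([(1, 22)], 32),
      ([(1, 0)], 27), ([(-1, 251)], 15), ([(1, 261), (1, 262), (1, 251), (1, 246), (-1, 243)], 20),
      ([(1, 261), (1, 246), (-1, 243)], 26),
      ([(-1, 250), (-1, 262), (-2, 251), (-1, 246), (-1, 243)], 37), ([(-1, 243)], 46),
      ([(-1, 250), (-1, 262), (-2, 251), (-1, 243)], 49)],
    -4, [(1, 179)], 179)]

set_option maxRecDepth 100000 in
lemma noTripleData_test : noTripleData.all noTripleTest = true := by decide +kernel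

lemma false_of_noTriple {L : Type*} [LieRing L] [LieAlgebra ℂ L] [ChevalleyBasis L] {S : ℕ}
    (hS : S ∈ [68, 80, 20, 73]) {e f : L} (T : Reach (H (cw (bits S))) e f) : False := by
  have h := List.all_eq_true.1 noTripleData_test
  have h1 : [68, 80, 20, 73] = noTripleData.map Prod.fst := rfl
  rw [h1] at hS
  obtain ⟨⟨S, es, l, n, x, k⟩, hd, rfl⟩ := List.mem_map.1 hS
  exact T.false_of_noTripleTest (h _ hd)

end E8

namespace E8

open ChevalleyBasis Module

section

variable {L : Type*} [LieRing L] [LieAlgebra ℂ L] [ChevalleyBasis L] {c t : Q} {e f : L}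

variable (L) in
/-- The part of degree at least `n` of the centralizer of a torus element. -/
noncomputable def posG (c t : Q) (n : ℤ) : Submodule ℂ L :=
  Submodule.span ℂ (Set.range fun i : {i : Idx // n ≤ deg c i ∧ deg t i = 0} ↦ (basis i.1 : L))

lemma finrank_posG (c t : Q) (n : ℤ) :
    finrank ℂ (posG L c t n) = Fintype.card {i : Idx // n ≤ deg c i ∧ deg t i = 0} :=
  finrank_span_eq_card (basis.linearIndependent.comp _ Subtype.val_injective)

lemma mem_posG {n k : ℤ} (hn : n ≤ k) {x : L} (hx : x ∈ G L c k) (hx' : x ∈ G L t 0) :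
    x ∈ posG L c t n := by
  rw [← basis.sum_repr x]
  refine Submodule.sum_mem _ fun i _ ↦ ?_
  by_cases h : deg c i = k ∧ deg t i = 0
  · exact Submodule.smul_mem _ _ (Submodule.subset_span ⟨⟨i, h.1 ▸ hn, h.2⟩, rfl⟩)
  · rw [not_and_or] at h
    rcases h with h | h
    · simp [repr_eq_zero_of_mem_G hx h]
    · simp [repr_eq_zero_of_mem_G hx' h]

lemma posG_le_map (T : Triple c e f) (he : e ∈ G L t 0) :
    posG L c t 3 ≤ (posG L c t 1).map (LieAlgebra.ad ℂ L e) := by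
  rw [posG, Submodule.span_le]
  rintro _ ⟨⟨i, h1, h2⟩, rfl⟩
  obtain ⟨x, hx, hx'⟩ := T.surjective (k := deg c i - 2) (by omega) (z := basis i) (by
    rw [sub_add_cancel]
    exact basis_mem_G c i)
  refine ⟨proj t 0 x, mem_posG (k := deg c i - 2) (by omega) (proj_mem_G t c 0 _ hx) (proj_mem t 0 x), ?_⟩
  have h3 := basis_mem_G (L := L) t i
  rw [h2] at h3
  change ⁅e, proj t 0 x⁆ = _
  rw [← proj_lie he, hx', add_zero, proj_of_mem h3]

lemma finrank_posG_inf_cent_le (T : Triple c e f) (he : e ∈ G L t 0) :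
    finrank ℂ ↥(posG L c t 1 ⊓ cent e) ≤
      Fintype.card {i : Idx // (1 ≤ deg c i ∧ deg c i ≤ 2) ∧ deg t i = 0} := by
  have : FiniteDimensional ℂ L := finiteDimensional_of_chevalleyBasis
  have h1 := Submodule.finrank_mono (posG_le_map T he)
  have h2 : finrank ℂ ((posG L c t 1).map (LieAlgebra.ad ℂ L e : L →ₗ[ℂ] L)) +
      finrank ℂ ↥(posG L c t 1 ⊓ cent e) = finrank ℂ (posG L c t 1) := by
    have h := LinearMap.finrank_range_add_finrank_ker
      ((LieAlgebra.ad ℂ L e : L →ₗ[ℂ] L).domRestrict (posG L c t 1))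
    rw [LinearMap.range_domRestrict, LinearMap.ker_domRestrict] at h
    rw [← h]
    congr 1
    exact (LinearEquiv.finrank_eq (Submodule.comapSubtypeEquivOfLe inf_le_left)).symm.trans (by
      rw [Submodule.comap_inf, Submodule.comap_subtype_self, top_inf_eq]
      rfl)
  rw [finrank_posG] at h1 h2
  have h3 : Fintype.card {i : Idx // 1 ≤ deg c i ∧ deg t i = 0} =
      Fintype.card {i : Idx // 3 ≤ deg c i ∧ deg t i = 0} +
      Fintype.card {i : Idx // (1 ≤ deg c i ∧ deg c i ≤ 2) ∧ deg t i = 0} := by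
    rw [← Fintype.card_subtype_or_disjoint]
    · exact Fintype.card_congr (Equiv.subtypeEquivRight fun i ↦ by omega)
    · rw [Pi.disjoint_iff]
      intro i
      rw [Prop.disjoint_iff]
      omega
  omega

/-- The centralizer of `e` is generated by the torus, the reductive part and the subalgebra of
invariants of the torus. -/
lemma Reach.cent_le_der_of_posG (T : Reach (H c) e f) (he : e ∈ G L t 0)
    (h : posG L c t 1 ⊓ cent e ≤ der e) : cent e ≤ der e := by
  intro x hx
  have hHt : ⁅e, (H t : L)⁆ = 0 := by
    rw [mem_G, Int.cast_zero, zero_smul] at he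
    rw [← lie_skew, he, neg_zero]
  refine mem_of_proj_mem c _ fun k ↦ ?_
  have hk : ⁅e, proj c k x⁆ = 0 := lie_proj_eq_zero T.triple.he k hx
  rcases lt_trichotomy k 0 with h0 | rfl | h0
  · rw [T.triple.eq_zero_of_lie h0 (proj_mem c k x) hk]
    exact zero_mem _
  · refine brk_mono (inf_le_left : gz (H c) e ≤ cent e) (T.gz_le ?_)
    rw [gz_H]
    exact ⟨proj_mem c 0 x, hk⟩
  · refine mem_of_proj_mem t _ fun j ↦ ?_
    have hj : ⁅e, proj t j (proj c k x)⁆ = 0 := lie_proj_eq_zero he j hk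
    rcases eq_or_ne j 0 with rfl | hj0
    · exact h ⟨mem_posG (Int.add_one_le_of_lt h0) (proj_mem_G t c 0 k (proj_mem c k x)) (proj_mem t 0 _), hj⟩
    · have h1 := lie_mem_der hHt hj
      rw [mem_G.1 (proj_mem t j _)] at h1
      exact (Submodule.smul_mem_iff _ (by exact_mod_cast hj0)).1 h1

end

/-- The number of roots of degree one or two which vanish on a torus element. -/
def cntTorus (p u v : ℕ) : ℕ :=
  Nat.count (fun k ↦ (Nat.beq (dot (code k) p) 1 || Nat.beq (dot (code k) p) 2) &&
    Nat.beq (dot (code k) u) (dot (code k) v)) 120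

/-- A test for a bracket in the centralizer. -/
def bracketTest (S u v : ℕ) (es : List (ℤ × ℕ)) :
    List (ℤ × ℕ) × List (ℤ × ℕ) × ℤ × ℤ × ℤ → Bool
  | (x, y, a, b, j) => hasWt (pk (bits S)) a x && hasWt (pk (bits S)) b y && decide (1 ≤ a + b) &&
    hasWtSub (pk (hexits u)) (pk (hexits v)) j x && hasWtSub (pk (hexits u)) (pk (hexits v)) (-j) y &&
    lieZero es x && lieZero es y

/-- A sum of brackets. -/
def bracketSum (l : List (List (ℤ × ℕ) × List (ℤ × ℕ) × ℤ × ℤ × ℤ)) : List Term :=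
  l.flatMap fun x ↦ lieL (vec x.1) (vec x.2.1)

/-- A certificate for an orbit for which the centralizer is generated by brackets. -/
def strongTest : ℕ × List (ℤ × ℕ) × List (ℤ × ℕ) × ℕ × ℕ ×
    List (List (List (ℤ × ℕ) × List (ℤ × ℕ) × ℤ × ℤ × ℤ) × ℕ) → Bool
  | (S, es, fs, u, v, l) => isTriple S es fs && hasWtSub (pk (hexits u)) (pk (hexits v)) 0 es &&
    (l.all fun p ↦ p.1.all (bracketTest S u v es)) &&
    pivots (l.map fun p ↦ (bracketSum p.1, p.2)) &&
    Nat.ble (cntTorus (pk (bits S)) (pk (hexits u)) (pk (hexits v))) l.length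

section

variable {L : Type*} [LieRing L] [LieAlgebra ℂ L] [ChevalleyBasis L] {S u v : ℕ} {e f : L}

instance (y z w : Fin 8 → ℕ) : DecidablePred fun a : Q ↦
    ((1 ≤ bil (cw y) a ∧ bil (cw y) a ≤ 2) ∧ bil (cw z - cw w) a = 0) ∧ 0 ≤ a :=
  fun _ ↦ inferInstanceAs (Decidable (_ ∧ ∀ _, _ ≤ _))

lemma card_eq_cntTorus {y z w : Fin 8 → ℕ} (hy : ∀ i, y i < 16) (hz : ∀ i, z i < 16)
    (hw : ∀ i, w i < 16) :
    Fintype.card {i : Idx // (1 ≤ deg (cw y) i ∧ deg (cw y) i ≤ 2) ∧ deg (cw z - cw w) i = 0} =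
      cntTorus (pk y) (pk z) (pk w) := by
  have h1 : Fintype.card {i : Idx // (1 ≤ deg (cw y) i ∧ deg (cw y) i ≤ 2) ∧ deg (cw z - cw w) i = 0} =
      Fintype.card {a : {a : Q // IsRoot a} //
        ((1 ≤ bil (cw y) a.1 ∧ bil (cw y) a.1 ≤ 2) ∧ bil (cw z - cw w) a.1 = 0) ∧ 0 ≤ a.1} := by
    refine Fintype.card_congr ⟨fun i ↦ match i with
      | ⟨.inl _, h⟩ => absurd h.1.1 (by change ¬1 ≤ (0 : ℤ); omega)
      | ⟨.inr a, h⟩ => ⟨a, h, ht_pos_of_bil_pos (cw_nonneg y) a.2 (Int.lt_of_add_one_le h.1.1)⟩,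
      fun a ↦ ⟨.inr a.1, a.2.1⟩, ?_, fun a ↦ rfl⟩
    rintro ⟨i | a, h⟩
    · exact absurd h.1.1 (by change ¬1 ≤ (0 : ℤ); omega)
    · rfl
  rw [h1, card_root (P := fun a ↦ ((1 ≤ bil (cw y) a ∧ bil (cw y) a ≤ 2) ∧ bil (cw z - cw w) a = 0) ∧
    0 ≤ a) fun a h ↦ h.2, cntTorus, Nat.count_eq_card_filter_range]
  congr 1
  refine Finset.filter_congr fun k hk ↦ ?_
  have hk := Finset.mem_range.1 hk
  rw [bil_sub_left, ← dot_code hy hk, ← dot_code hz hk, ← dot_code hw hk, and_iff_left (root_nonneg hk)]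
  simp only [Bool.and_eq_true, Bool.or_eq_true, Nat.beq_eq]
  omega

lemma val_bracketSum_mem {es : List (ℤ × ℕ)} (hes : valid es = true)
    {l : List (List (ℤ × ℕ) × List (ℤ × ℕ) × ℤ × ℤ × ℤ)} (hl : l.all (bracketTest S u v es) = true) :
    val L (bracketSum l) ∈ posG L (cw (bits S)) (cw (hexits u) - cw (hexits v)) 1 ⊓ cent (el L es) ⊓
      der (el L es) := by
  induction l with
  | nil => exact zero_mem _
  | cons p l ih =>
    rw [List.all_cons, Bool.and_eq_true] at hl
    rw [bracketSum, List.flatMap_cons, val_append]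
    refine add_mem ?_ (ih hl.2)
    obtain ⟨x, y, a, b, j⟩ := p
    have h := hl.1
    simp only [bracketTest, Bool.and_eq_true, decide_eq_true_eq] at h
    obtain ⟨⟨⟨⟨⟨⟨h1, h2⟩, h3⟩, h4⟩, h5⟩, h6⟩, h7⟩ := h
    have hx := valid_of_hasWt h1
    have hy := valid_of_hasWt h2
    have h8 := lie_el_eq_zero (L := L) hes hx h6
    have h9 := lie_el_eq_zero (L := L) hes hy h7
    rw [← lie_el hx hy]
    refine ⟨⟨mem_posG h3 (lie_mem_G (el_mem_G (bits_lt S) h1) (el_mem_G (bits_lt S) h2)) ?_, ?_⟩,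
      lie_mem_der h8 h9⟩
    · have := lie_mem_G (el_mem_G_sub (L := L) (hexits_lt u) (hexits_lt v) h4)
        (el_mem_G_sub (hexits_lt u) (hexits_lt v) h5)
      rwa [add_neg_cancel] at this
    · change ⁅_, _⁆ = _
      rw [leibniz_lie, h8, h9, zero_lie, lie_zero, add_zero]

lemma Reach.cent_le_der_of_strongTest {es fs : List (ℤ × ℕ)}
    {l : List (List (List (ℤ × ℕ) × List (ℤ × ℕ) × ℤ × ℤ × ℤ) × ℕ)}
    (T : Reach (H (cw (bits S))) e f) (h : strongTest (S, es, fs, u, v, l) = true) :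
    cent e ≤ der e := by
  have : FiniteDimensional ℂ L := finiteDimensional_of_chevalleyBasis
  simp only [strongTest, Bool.and_eq_true] at h
  obtain ⟨⟨⟨⟨h1, h2⟩, h3⟩, h4⟩, h5⟩ := h
  have hes : valid es = true := by
    simp only [isTriple, Bool.and_eq_true] at h1
    exact valid_of_hasWt h1.1.1
  obtain ⟨⟨f', T'⟩, h6⟩ := T.exists_of_isTriple h1
  have he := el_mem_G_sub (L := L) (hexits_lt u) (hexits_lt v) h2
  have h3 := List.all_eq_true.1 h3
  refine h6 (T'.cent_le_der_of_posG he (inf_eq_left.1 (Submodule.eq_of_le_of_finrank_le inf_le_left ?_)))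
  refine (finrank_posG_inf_cent_le T'.triple he).trans ?_
  rw [card_eq_cntTorus (bits_lt S) (hexits_lt u) (hexits_lt v)]
  have h7 := length_le_finrank h4 (fun p hp ↦ ?_)
    (posG L (cw (bits S)) (cw (hexits u) - cw (hexits v)) 1 ⊓ cent (el L es) ⊓ der (el L es))
    (fun p hp ↦ ?_)
  · rw [List.length_map] at h7
    exact (Nat.le_of_ble_eq_true h5).trans h7
  · obtain ⟨q, hq, rfl⟩ := List.mem_map.1 hp
    intro x hx
    obtain ⟨r, hr, hx⟩ := List.mem_flatMap.1 hx
    have h8 := List.all_eq_true.1 (h3 q hq) r hr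
    obtain ⟨x, y, a, b, j⟩ := r
    simp only [bracketTest, Bool.and_eq_true] at h8
    exact isCode_lieL (isCode_vec (valid_of_hasWt h8.1.1.1.1.1.1))
      (isCode_vec (valid_of_hasWt h8.1.1.1.1.1.2)) _ hx
  · obtain ⟨q, hq, rfl⟩ := List.mem_map.1 hp
    exact val_bracketSum_mem hes (h3 q hq)

end

/-- Certificates for the orbits for which the centralizer of an element is perfect. -/
def strongData : List (ℕ × List (ℤ × ℕ) × List (ℤ × ℕ) × ℕ × ℕ ×
    List (List (List (ℤ × ℕ) × List (ℤ × ℕ) × ℤ × ℤ × ℤ) × ℕ)) := [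
  (128, [(1, 119)], [(-1, 239)], 940048384, 2102350,
    [
      ([([(1, 48)], [(1, 105)], 1, 1, -2)], 119)]),
  (1, [(1, 106), (1, 119)], [(-1, 226), (-1, 239)], 1677741059, 3932320,
    [
      ([([(1, 63)], [(1, 100)], 1, 1, -3)], 119), ([([(1, 50)], [(1, 77)], 1, 1, -3)], 106)]),
  (64, [(1, 82), (1, 97), (1, 114)], [(-1, 202), (-1, 217), (-1, 234)], 623051920, 45065,
    [
      ([([(1, 47)], [(1, 39)], 1, 1, -6)], 82), ([([(1, 86)], [(1, 71)], 1, 1, -1)], 114),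
      ([([(1, 62)], [(1, 35)], 1, 1, -1)], 97)]),
  (2, [(1, 85), (1, 88), (1, 103), (1, 111)], [(-1, 205), (-1, 208), (-1, 223), (-1, 231)], 536873986, 69345360,
    [
      ([([(1, 18)], [(1, 67)], 1, 1, -11)], 88), ([([(1, 61)], [(1, 76)], 1, 1, -7)], 111),
      ([([(1, 39)], [(1, 71)], 1, 1, -5)], 103), ([([(1, 35)], [(1, 50)], 1, 1, -5)], 85)]),
  (129, [(1, 63), (1, 100), (1, 106)], [(-2, 183), (-2, 220), (-1, 226)], 16781552, 539100930,
    [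
      ([([(-1, 0), (1, 21)], [(1, 42), (1, 99)], 1, 1, -2)], 63),
      ([([(1, 48)], [(1, 105)], 2, 2, -13)], 119), ([([(1, 66)], [(1, 58)], 1, 1, -2)], 106)]),
  (32, [(1, 61), (1, 72), (1, 96), (1, 99)], [(-1, 181), (-2, 192), (-2, 216), (-1, 219)], 268435546, 37818624,
    [
      ([([(-1, 3), (1, 36)], [(-1, 59), (1, 70)], 1, 1, -4)], 72),
      ([([(1, 41)], [(1, 108)], 2, 2, -9)], 119), ([([(1, 4)], [(1, 58)], 1, 1, -6)], 61),
      ([([(1, 31)], [(1, 74)], 1, 1, -4)], 99)]),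
  (4, [(1, 66), (1, 81), (1, 86), (1, 90), (1, 97)], [(-2, 186), (-2, 201), (-1, 206), (-1, 210), (-1, 217)], 3170560, 402915348,
    [
      ([([(1, 27), (1, 31)], [(-1, 44), (1, 58)], 1, 1, -3)], 66),
      ([([(1, 72)], [(1, 75)], 2, 2, -2)], 113), ([([(1, 32)], [(1, 54)], 1, 1, -4)], 86),
      ([([(1, 42)], [(1, 55)], 1, 1, -7)], 97), ([([(1, 38)], [(1, 51)], 1, 1, -1)], 90)]),
  (65, [(1, 42), (1, 48), (1, 80), (1, 85), (1, 88)], [(-2, 200), (-2, 205), (-2, 208), (-2, 168), (-1, 162)], 536873728, 18944056,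
    [
      ([([(-1, 8), (1, 51)], [(-1, 36), (1, 74)], 1, 1, -4)], 80),
      ([([(1, 19), (-1, 21)], [(-1, 27), (1, 64)], 1, 1, -8)], 48),
      ([([(1, 52)], [(1, 76)], 2, 2, -5)], 108), ([([(1, 95)], [(1, 71)], 2, 2, -2)], 117),
      ([([(1, 4)], [(1, 39)], 1, 1, -3)], 42)]),
  (16, [(1, 42), (1, 60), (1, 69), (1, 72), (1, 74), (1, 87)], [(-2, 180), (-1, 189), (-1, 192), (-2, 194), (-2, 207), (-2, 162)], 1107305504, 4521986,
    [
      ([([(1, 14), (1, 46)], [(1, 32), (1, 33)], 1, 1, -5)], 42),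
      ([([(-1, 6), (1, 18)], [(-1, 57), (1, 66)], 1, 1, -5)], 60),
      ([([(1, 61)], [(1, 86)], 2, 2, -8)], 112), ([([(1, 37)], [(1, 79)], 2, 2, -4)], 104),
      ([([(1, 47)], [(1, 29)], 1, 1, -3)], 69), ([([(1, 7)], [(1, 67)], 1, 1, -9)], 72)]),
  (132, [(1, 36), (1, 53), (1, 64), (1, 80), (1, 87)], [(-3, 173), (-1, 184), (-4, 200), (-1, 207), (-3, 156)], 102769410, 805699680,
    [
      ([([(-1, 9), (-1, 24), (-2, 28), (1, 40)], [(-1, 15), (-1, 45), (-2, 49), (1, 61)], 1, 1, -1)], 36),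
      ([([(1, 11), (1, 21)], [(1, 103)], 0, 4, 2)], 104), ([([(1, 96)], [(1, 72)], 3, 3, -1)], 119),
      ([([(1, 55)], [(1, 31)], 1, 1, -1)], 87), ([([(1, 54)], [(1, 22)], 1, 1, -3)], 64)]),
  (66, [(1, 31), (1, 32), (1, 57), (1, 80), (1, 84)], [(-4, 177), (2, 176), (2, 201), (-4, 200), (-1, 204), (-2, 152), (-2, 151)], 2170912, 16778754,
    [
      ([([(1, 1), (-1, 29), (1, 54)], [(1, 83), (1, 88)], 1, 3, -1)], 89),
      ([([(-1, 47), (-1, 48), (-1, 49), (1, 68)], [(1, 14), (1, 15), (1, 16), (1, 37)], 1, 1, -4)], 57),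
      ([([(1, 27), (-1, 28), (1, 74)], [(1, 9), (1, 10), (1, 58)], 1, 1, -2)], 32),
      ([([(1, 1), (-1, 29), (1, 54)], [(-1, 4), (-1, 30), (1, 55)], 1, 1, -1)], 31),
      ([([(1, 39)], [(1, 109)], 2, 4, 3)], 119), ([([(1, 19)], [(1, 113)], 2, 4, 6)], 118),
      ([([(1, 51)], [(1, 33)], 1, 1, -1)], 84)]),
  (8, [(1, 34), (1, 38), (1, 58), (1, 63), (1, 66), (1, 70)], [(-2, 178), (-3, 183), (-2, 186), (-3, 190), (-4, 154), (-1, 158)], 285212801, 3215872,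
    [
      ([([(1, 15), (1, 23), (-1, 45)], [(-1, 18), (1, 32), (-1, 52)], 1, 1, -3)], 34),
      ([([(1, 14), (-1, 24)], [(-1, 88), (1, 92)], 1, 3, -4)], 97),
      ([([(1, 12), (1, 44)], [(1, 31), (-1, 51)], 1, 1, -2)], 58),
      ([([(1, 14), (-1, 24)], [(1, 19), (-1, 29)], 1, 1, -4)], 38),
      ([([(1, 76)], [(1, 93)], 3, 3, -1)], 119), ([([(1, 71)], [(1, 54)], 2, 2, -4)], 106)]),
  (17, [(1, 38), (1, 41), (1, 46), (1, 52), (1, 54), (1, 67)], [(-3, 172), (-3, 174), (-3, 187), (-3, 166), (-4, 158), (-4, 161)], 604053507, 2098240,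
    [
      ([([(1, 77)], [(1, 70)], 3, 3, -1)], 113), ([([(1, 87)], [(1, 60)], 3, 3, -5)], 112),
      ([([(1, 4), (-1, 11)], [(1, 91)], 0, 4, 2)], 95),
      ([([(1, 148), (-1, 2)], [(1, 99)], 0, 4, 6)], 101),
      ([([(1, 130), (1, 142), (-1, 1), (-1, 5)], [(1, 37), (-1, 51), (1, 64)], 0, 2, 4)], 52),
      ([([(1, 7), (2, 24), (-1, 17), (1, 32), (-2, 43)], [(-1, 13), (-2, 26), (1, 19), (1, 36), (-2, 44)], 1, 1, -1), ([(-2, 130), (-2, 142), (2, 1), (2, 5)], [(1, 37), (-1, 51), (1, 64)], 0, 2, 4)], 46)]),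
  (72, [(1, 14), (1, 27), (1, 31), (1, 33), (1, 53), (1, 55), (1, 68)], [(-6, 173), (-4, 175), (-4, 188), (-3, 151), (-4, 153), (-3, 147), (-6, 134)], 50336258, 539099168,
    [
      ([([(1, 41)], [(1, 66)], 3, 3, -5)], 102), ([([(1, 47), (1, 64)], [(1, 98)], 2, 6, 4)], 116),
      ([([(-1, 1), (-1, 23), (-1, 45), (1, 49)], [(1, 93), (1, 95)], 1, 5, 3), ([(-1, 41)], [(1, 66)], 3, 3, -5)], 96),
      ([([(1, 20), (1, 37)], [(1, 47), (1, 64)], 2, 2, -4)], 63),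
      ([([(-1, 1), (-1, 23), (-1, 45), (1, 49)], [(-1, 39), (-1, 40), (1, 62)], 1, 3, 3), ([(1, 20), (1, 37)], [(1, 47), (1, 64)], 2, 2, -4)], 78),
      ([([(-1, 9), (-1, 13), (1, 17), (1, 30)], [(-1, 1), (-1, 23), (-1, 45), (1, 49)], 1, 1, -3)], 33),
      ([([(-2, 141), (-1, 142), (1, 0), (2, 3), (1, 6), (-1, 10)], [(-2, 26), (1, 48), (1, 52), (-1, 54), (2, 65)], 0, 2, -2), ([(-2, 9), (-2, 13), (2, 17), (2, 30)], [(-1, 1), (-1, 23), (-1, 45), (1, 49)], 1, 1, -3)], 27)])]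

set_option maxRecDepth 100000 in
lemma strongData_test : strongData.all strongTest = true := by decide +kernel

lemma cent_le_der_of_strong {L : Type*} [LieRing L] [LieAlgebra ℂ L] [ChevalleyBasis L] {S : ℕ}
    (hS : S ∈ [128, 1, 64, 2, 129, 32, 4, 65, 16, 132, 66, 8, 17, 72]) {e f : L}
    (T : Reach (H (cw (bits S))) e f) : cent e ≤ der e := by
  have h := List.all_eq_true.1 strongData_test
  have h1 : [128, 1, 64, 2, 129, 32, 4, 65, 16, 132, 66, 8, 17, 72] = strongData.map Prod.fst := rfl
  rw [h1] at hS
  obtain ⟨⟨S, es, fs, u, v, l⟩, hd, rfl⟩ := List.mem_map.1 hS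
  exact T.cent_le_der_of_strongTest (h _ hd)

end E8

namespace E8

lemma brk_eq_top {K : Type*} [LieRing K] [LieAlgebra ℂ K] [LieAlgebra.IsSemisimple ℂ K] :
    brk (⊤ : Submodule ℂ K) = ⊤ := by
  have h : (⊤ : LieIdeal ℂ K) ≤ ⁅(⊤ : LieIdeal ℂ K), (⊤ : LieIdeal ℂ K)⁆ := by
    rw [← LieAlgebra.IsSemisimple.sSup_atoms_eq_top (R := ℂ) (L := K), sSup_le_iff]
    intro I hI
    have h1 : ⁅I, I⁆ = I := lie_eq_self_of_isAtom_of_nonabelian I hI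
      (LieAlgebra.IsSemisimple.non_abelian_of_isAtom I hI)
    rw [LieAlgebra.IsSemisimple.sSup_atoms_eq_top, ← h1]
    exact LieSubmodule.mono_lie le_top le_top
  refine top_le_iff.1 fun x _ ↦ ?_
  have h1 := h (LieSubmodule.mem_top x)
  rw [← LieSubmodule.mem_toSubmodule, LieSubmodule.lieIdeal_oper_eq_linear_span'] at h1
  simpa [brk] using h1

lemma gz_le_brk {h e : LieAlgebra.e₈ ℂ} (hss : LieAlgebra.IsSemisimple ℂ (gZero h e)) :
    gz h e ≤ brk (gz h e) := by
  intro x hx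
  have h1 : (⟨x, hx⟩ : gZero h e) ∈ brk (⊤ : Submodule ℂ (gZero h e)) := by
    rw [brk_eq_top]
    trivial
  have h2 : brk (⊤ : Submodule ℂ (gZero h e)) ≤
      (brk (gz h e)).comap (gZero h e).toSubmodule.subtype := by
    rw [brk, Submodule.span_le]
    rintro _ ⟨y, -, z, -, rfl⟩
    exact Submodule.subset_span ⟨y, y.2, z, z.2, rfl⟩
  exact h2 h1

end E8

/-- In type E₈, if `e` lies in an sl₂-triple, is reachable, and `g(0)_e` is semisimple,
then `e` is strongly reachable. -/
theorem reachable_semisimple_strong_E8 (h e f : LieAlgebra.e₈ ℂ)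
    (hhe : ⁅h, e⁆ = (2 : ℂ) • e) (hhf : ⁅h, f⁆ = (-2 : ℂ) • f) (hef : ⁅e, f⁆ = h)
    (hreach : e ∈ derived e)
    (hss : LieAlgebra.IsSemisimple ℂ ↥(gZero h e)) :
    derived e = centralizer e := by
  refine le_antisymm ?_ ?_
  · rw [derived, Submodule.span_le]
    rintro _ ⟨x, hx, y, hy, rfl⟩
    change ⁅e, x⁆ = 0 at hx
    change ⁅e, y⁆ = 0 at hy
    change ⁅e, ⁅x, y⁆⁆ = 0
    rw [leibniz_lie, hx, hy, zero_lie, lie_zero, add_zero]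
  rcases subsingleton_or_nontrivial (LieAlgebra.e₈ ℂ) with h0 | h0
  · exact (Subsingleton.elim _ _).le
  let := E8.chevalleyBasis
  refine E8.Reach.cent_le_der ⟨hhe, hhf, hef, hreach, E8.gz_le_brk hss⟩ fun S e f T hS ↦ ?_
  rcases hS with hS | hS | hS | hS
  · exact E8.cent_le_der_of_strong hS T
  · exact (E8.false_of_torus hS T).elim
  · exact (E8.false_of_notReach hS T).elim
  · exact (E8.false_of_noTriple hS T).elim
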